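/- L∞-stability of the Ritz projection without logarithmic factor (Theorem 5.1): Let Ω and Ω̃ be convex polyhedra in ℝ³ with closure(Ω) ⊂ Ω̃, let c > 0 and let r ≥ 2 be an integer. There exists a constant C (depending only on Ω, Ω̃, c and r) with the following property: for every h > 0 and every tetrahedral partition 𝔗̃ of Ω̃ with mesh size h and quasi-uniformity constant c such that the tetrahedra of 𝔗̃ contained in closure(Ω) form a tetrahedral partition 𝔗 of Ω, for every Lipschitz function u : closure(Ω) → ℝ vanishing on ∂Ω, and for every u_h ∈ S̊_h (built from 𝔗 and degree r) satisfying ∫_Ω ∇(u − u_h)·∇χ dx = 0 for all χ ∈ S̊_h (i.e. u_h is the Ritz projection of u), one has sup_{x ∈ Ω} |u_h(x)| ≤ C · sup_{x ∈ Ω} |u(x)|. -/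

import Mathlib

open MeasureTheory Metric Set
open scoped RealInnerProductSpace ENNReal NNReal

noncomputable section

/-- Three-dimensional Euclidean space. -/
abbrev E3 : Type := EuclideanSpace ℝ (Fin 3)

/-- A convex polyhedron: a bounded convex open set which is the interior of the
convex hull of a finite set of points. -/
def IsConvexPolyhedron (Ω : Set E3) : Prop :=
  IsOpen Ω ∧ Bornology.IsBounded Ω ∧ Convex ℝ Ω ∧
    ∃ S : Finset E3, Ω = interior (convexHull ℝ (S : Set E3))

/-- The closed tetrahedron with vertices `v 0, v 1, v 2, v 3`. -/
def tet (v : Fin 4 → E3) : Set E3 := convexHull ℝ (Set.range v)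

/-- A quasi-uniform conforming tetrahedral partition of `Ω` with mesh size `h`
and quasi-uniformity constant `c`, recorded by the vertex tuples of its tetrahedra. -/
def IsTetPartition (Ω : Set E3) (T : Finset (Fin 4 → E3)) (h c : ℝ) : Prop :=
  (∀ v ∈ T, AffineIndependent ℝ v) ∧
  (⋃ v ∈ T, tet v) = closure Ω ∧
  (∀ v ∈ T, ∀ w ∈ T, tet v ≠ tet w → interior (tet v) ∩ interior (tet w) = ∅) ∧
  (∀ v ∈ T, ∀ w ∈ T, tet v ≠ tet w →
    tet v ∩ tet w = ∅ ∨ tet v ∩ tet w = convexHull ℝ (Set.range v ∩ Set.range w)) ∧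
  (∀ v ∈ T, Metric.diam (tet v) ≤ h) ∧
  (∀ v ∈ T, ∃ x : E3, Metric.closedBall x (c * h) ⊆ tet v)

/-- The finite element space `S_h` of continuous piecewise polynomials of degree `≤ r`. -/
def MemSh (Ω : Set E3) (T : Finset (Fin 4 → E3)) (r : ℕ) (u : E3 → ℝ) : Prop :=
  ContinuousOn u (closure Ω) ∧
  ∀ v ∈ T, ∃ p : MvPolynomial (Fin 3) ℝ,
    p.totalDegree ≤ r ∧ ∀ x ∈ tet v, u x = MvPolynomial.eval (fun i => x i) p

/-- The subspace `S̊_h` of finite element functions vanishing on the boundary. -/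
def MemSh0 (Ω : Set E3) (T : Finset (Fin 4 → E3)) (r : ℕ) (u : E3 → ℝ) : Prop :=
  MemSh Ω T r u ∧ ∀ x ∈ frontier Ω, u x = 0

/-- The Laplacian, as the trace of the Hessian. -/
def lap (v : E3 → ℝ) (x : E3) : ℝ :=
  ∑ i : Fin 3,
    fderiv ℝ (fun y => fderiv ℝ v y (EuclideanSpace.single i 1)) x (EuclideanSpace.single i 1)

/-- The `L^p(A)` norm. -/
def LpN (A : Set E3) (p : ℝ) (w : E3 → ℝ) : ℝ := (∫ x in A, |w x| ^ p) ^ (1 / p)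

/-- The `W^{1,p}(A)` norm. -/
def W1pN (A : Set E3) (p : ℝ) (w : E3 → ℝ) : ℝ :=
  (∫ x in A, (|w x| ^ p + ‖gradient w x‖ ^ p)) ^ (1 / p)

/-- The `W^{2,p}(A)` norm. -/
def W2pN (A : Set E3) (p : ℝ) (w : E3 → ℝ) : ℝ :=
  (∫ x in A, (|w x| ^ p + ‖gradient w x‖ ^ p + ‖iteratedFDeriv ℝ 2 w x‖ ^ p)) ^ (1 / p)

/-- affine functions -/
abbrev AF : Type := (E3 →L[ℝ] ℝ) × ℝ

def ev (A : AF) (x : E3) : ℝ := A.1 x + A.2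

def Pol3 (r : ℕ) (f : E3 → ℝ) : Prop :=
  f ∈ Submodule.span ℝ {g : E3 → ℝ | ∃ A : Fin r → AF, g = fun x => ∏ j, ev (A j) x}

def cf (r : ℕ) (z : E3 → ℝ) (p : Fin r → E3) : ℝ :=
  (r.factorial : ℝ)⁻¹ * ∑ S : Finset (Fin r),
    (-1) ^ (r + S.card) * (S.card : ℝ) ^ r * z ((S.card : ℝ)⁻¹ • ∑ i ∈ S, p i)

lemma sum_sign {r : ℕ} (φ : Fin r → Fin r) :
    (∑ S : Finset (Fin r), (if ∀ j, φ j ∈ S then (-1 : ℝ) ^ (r + S.card) else 0))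
      = if Function.Bijective φ then 1 else 0 := by
  classical
  split_ifs with hb
  · rw [Finset.sum_eq_single Finset.univ]
    · simp [← two_mul]
    · intro S _ hS
      rw [if_neg]
      intro hall
      apply hS
      ext i
      obtain ⟨j, rfl⟩ := hb.2 i
      simp [hall j]
    · simp
  · have : ¬ Function.Surjective φ := fun h => hb (Finite.surjective_iff_bijective.1 h)
    simp only [Function.Surjective, not_forall, not_exists] at this
    obtain ⟨i0, hi0⟩ := this
    apply Finset.sum_involution (fun S _ => if i0 ∈ S then S.erase i0 else insert i0 S)
    · intro S _
      by_cases hi : i0 ∈ S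
      · have h1 : (∀ j, φ j ∈ S.erase i0) ↔ ∀ j, φ j ∈ S := by
          simp [Finset.mem_erase, hi0]
        have h2 : S.card = (S.erase i0).card + 1 := by
          rw [Finset.card_erase_of_mem hi]
          have := Finset.card_pos.2 ⟨i0, hi⟩
          omega
        simp only [hi, if_true, h1]
        split_ifs
        · rw [h2]; ring
        · simp
      · have h1 : (∀ j, φ j ∈ insert i0 S) ↔ ∀ j, φ j ∈ S := by
          simp [Finset.mem_insert, hi0]
        simp only [hi, if_false, h1]
        split_ifs
        · rw [Finset.card_insert_of_notMem hi]; ring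
        · simp
    · intro S _ _
      by_cases hi : i0 ∈ S
      · simp only [hi, if_true]
        intro h
        rw [← h] at hi
        simp at hi
      · simp only [hi, if_false]
        intro h
        rw [← h] at hi
        simp at hi
    · intro S hS
      by_cases hi : i0 ∈ S
      · simp [hi]
      · simp [hi]
    · intro S _
      exact Finset.mem_univ _

lemma ryser {r : ℕ} (A : Fin r → Fin r → ℝ) :
    (∑ S : Finset (Fin r), (-1 : ℝ) ^ (r + S.card) * ∏ j, ∑ i ∈ S, A j i)
      = ∑ σ : Equiv.Perm (Fin r), ∏ j, A j (σ j) := by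
  classical
  have h1 : ∀ S : Finset (Fin r), (∏ j, ∑ i ∈ S, A j i)
      = ∑ φ : Fin r → Fin r, if ∀ j, φ j ∈ S then ∏ j, A j (φ j) else 0 := by
    intro S
    rw [Finset.prod_univ_sum, ← Finset.sum_filter]
    apply Finset.sum_congr _ (fun _ _ => rfl)
    ext φ
    simp [Fintype.mem_piFinset]
  simp_rw [h1, Finset.mul_sum]
  rw [Finset.sum_comm]
  have h2 : ∀ φ : Fin r → Fin r, (∑ S : Finset (Fin r), (-1 : ℝ) ^ (r + S.card) *
      (if ∀ j, φ j ∈ S then ∏ j, A j (φ j) else 0))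
      = if Function.Bijective φ then ∏ j, A j (φ j) else 0 := by
    intro φ
    have := congrArg (fun t => t * ∏ j, A j (φ j)) (sum_sign φ)
    simp only [Finset.sum_mul, ite_mul, zero_mul, one_mul] at this
    rw [← this]
    apply Finset.sum_congr rfl
    intro S _
    split_ifs <;> simp
  simp_rw [h2]
  rw [← Finset.sum_filter]
  refine Finset.sum_bij (fun φ h => Equiv.ofBijective φ (Finset.mem_filter.1 h).2) ?_ ?_ ?_ ?_
  · intros; simp
  · intro a _ b _ h
    exact congrArg (fun e : Equiv.Perm (Fin r) => (e : Fin r → Fin r)) h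
  · intro σ _
    refine ⟨σ, Finset.mem_filter.2 ⟨Finset.mem_univ _, σ.bijective⟩, ?_⟩
    ext; simp
  · intros; simp

lemma ev_avg (A : AF) {ι : Type*} (S : Finset ι) (p : ι → E3) (hS : S.Nonempty) :
    (S.card : ℝ) * ev A ((S.card : ℝ)⁻¹ • ∑ i ∈ S, p i) = ∑ i ∈ S, ev A (p i) := by
  have : (S.card : ℝ) ≠ 0 := by
    exact_mod_cast Finset.card_ne_zero.2 hS
  simp only [ev, map_smul, map_sum, smul_eq_mul, Finset.sum_add_distrib, Finset.sum_const,
    nsmul_eq_mul]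
  field_simp

lemma cf_prod {r : ℕ} (hr : 1 ≤ r) (A : Fin r → AF) (p : Fin r → E3) :
    cf r (fun x => ∏ j, ev (A j) x) p
      = (r.factorial : ℝ)⁻¹ * ∑ σ : Equiv.Perm (Fin r), ∏ j, ev (A j) (p (σ j)) := by
  rw [cf, ← ryser (fun j i => ev (A j) (p i))]
  congr 1
  apply Finset.sum_congr rfl
  intro S _
  rcases S.eq_empty_or_nonempty with rfl | hS
  · have : r ≠ 0 := by omega
    simp [this]
  · rw [mul_assoc]
    congr 1
    rw [Finset.prod_congr rfl (fun j _ => (ev_avg (A j) S p hS).symm)]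
    rw [Finset.prod_mul_distrib]
    simp

/-- local interpolant -/
def ipol (r : ℕ) (v : Fin 4 → E3) (L : Fin 4 → AF) (z : E3 → ℝ) (x : E3) : ℝ :=
  ∑ s : Fin r → Fin 4, cf r z (fun i => v (s i)) * ∏ i, ev (L (s i)) x

/-- barycentric coordinates -/
def IsBary (v : Fin 4 → E3) (L : Fin 4 → AF) : Prop :=
  (∀ x, ∑ i, ev (L i) x = 1) ∧ (∀ x, ∑ i, ev (L i) x • v i = x) ∧
    ∀ i j, ev (L i) (v j) = if i = j then 1 else 0

lemma ev_bary {v : Fin 4 → E3} {L : Fin 4 → AF} (h : IsBary v L) (A : AF) (x : E3) :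
    ∑ k, ev A (v k) * ev (L k) x = ev A x := by
  conv_rhs => rw [← h.2.1 x]
  have h1 := h.1 x
  rw [ev]
  simp only [map_sum, map_smul, smul_eq_mul]
  have h2 : ∀ k, ev A (v k) * ev (L k) x = ev (L k) x * A.1 (v k) + A.2 * ev (L k) x := by
    intro k; rw [ev]; ring
  simp_rw [h2, Finset.sum_add_distrib, ← Finset.mul_sum]
  rw [h1, mul_one]

lemma ipol_prod {r : ℕ} (hr : 1 ≤ r) {v : Fin 4 → E3} {L : Fin 4 → AF} (h : IsBary v L)
    (A : Fin r → AF) (x : E3) :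
    ipol r v L (fun x => ∏ j, ev (A j) x) x = ∏ j, ev (A j) x := by
  simp only [ipol, cf_prod hr, Finset.mul_sum, Finset.sum_mul]
  rw [Finset.sum_comm]
  have h1 : ∀ σ : Equiv.Perm (Fin r), (∑ s : Fin r → Fin 4,
      (r.factorial : ℝ)⁻¹ * (∏ j, ev (A j) (v (s (σ j)))) * ∏ i, ev (L (s i)) x)
      = (r.factorial : ℝ)⁻¹ * ∏ j, ev (A j) x := by
    intro σ
    have h2 : ∀ s : Fin r → Fin 4, (r.factorial : ℝ)⁻¹ * (∏ j, ev (A j) (v (s (σ j)))) *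
        ∏ i, ev (L (s i)) x = (r.factorial : ℝ)⁻¹ *
          ∏ i, (ev (A (σ.symm i)) (v (s i)) * ev (L (s i)) x) := by
      intro s
      rw [Finset.prod_mul_distrib, mul_assoc]
      congr 2
      rw [← Equiv.prod_comp σ (fun i => ev (A (σ.symm i)) (v (s i)))]
      exact Finset.prod_congr rfl fun j _ => by rw [Equiv.symm_apply_apply]
    simp_rw [h2]
    rw [← Finset.mul_sum]
    congr 1
    have h3 := Finset.prod_univ_sum (fun _ : Fin r => (Finset.univ : Finset (Fin 4)))
      (fun i k => ev (A (σ.symm i)) (v k) * ev (L k) x)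
    simp only [Fintype.piFinset_univ] at h3
    rw [← h3]
    simp_rw [ev_bary h]
    exact Equiv.prod_comp σ.symm (fun i => ev (A i) x)
  simp_rw [h1]
  rw [Finset.sum_const, Finset.card_univ, Fintype.card_perm, Fintype.card_fin, nsmul_eq_mul,
    ← mul_assoc, mul_inv_cancel₀ (by positivity), one_mul]

lemma cf_add (r : ℕ) (z w : E3 → ℝ) (p : Fin r → E3) :
    cf r (fun x => z x + w x) p = cf r z p + cf r w p := by
  simp only [cf, mul_add, Finset.sum_add_distrib]

lemma cf_smul (r : ℕ) (a : ℝ) (z : E3 → ℝ) (p : Fin r → E3) :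
    cf r (fun x => a * z x) p = a * cf r z p := by
  simp only [cf, Finset.mul_sum]
  exact Finset.sum_congr rfl fun _ _ => by ring

lemma ipol_add (r : ℕ) (v : Fin 4 → E3) (L : Fin 4 → AF) (z w : E3 → ℝ) (x : E3) :
    ipol r v L (fun x => z x + w x) x = ipol r v L z x + ipol r v L w x := by
  simp only [ipol, cf_add, add_mul, Finset.sum_add_distrib]

lemma ipol_smul (r : ℕ) (v : Fin 4 → E3) (L : Fin 4 → AF) (a : ℝ) (z : E3 → ℝ) (x : E3) :
    ipol r v L (fun x => a * z x) x = a * ipol r v L z x := by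
  simp only [ipol, cf_smul, Finset.mul_sum]
  exact Finset.sum_congr rfl fun _ _ => by ring

lemma ipol_poly {r : ℕ} (hr : 1 ≤ r) {v : Fin 4 → E3} {L : Fin 4 → AF} (h : IsBary v L)
    {f : E3 → ℝ} (hf : Pol3 r f) : ipol r v L f = f := by
  induction hf using Submodule.span_induction with
  | mem g hg => obtain ⟨A, rfl⟩ := hg; ext x; exact ipol_prod hr h A x
  | zero => ext x; simp [ipol, cf]
  | add f g _ _ hf hg =>
    ext x
    have := ipol_add r v L f g x
    rw [hf, hg] at this
    exact this
  | smul a f _ hf =>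
    ext x
    have := ipol_smul r v L a f x
    rw [hf] at this
    exact this

lemma Pol3.add {r : ℕ} {f g : E3 → ℝ} (hf : Pol3 r f) (hg : Pol3 r g) :
    Pol3 r (fun x => f x + g x) := Submodule.add_mem _ hf hg
lemma Pol3.smul {r : ℕ} {f : E3 → ℝ} (a : ℝ) (hf : Pol3 r f) :
    Pol3 r (fun x => a * f x) := Submodule.smul_mem _ a hf
lemma Pol3.sub {r : ℕ} {f g : E3 → ℝ} (hf : Pol3 r f) (hg : Pol3 r g) :
    Pol3 r (fun x => f x - g x) := Submodule.sub_mem _ hf hg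
lemma Pol3.sum {r : ℕ} {ι : Type*} (s : Finset ι) {f : ι → E3 → ℝ} (hf : ∀ i, Pol3 r (f i)) :
    Pol3 r (fun x => ∑ i ∈ s, f i x) := by
  have := Submodule.sum_mem (Submodule.span ℝ {g : E3 → ℝ | ∃ A : Fin r → AF,
    g = fun x => ∏ j, ev (A j) x}) (t := s) (f := f) (fun i _ => hf i)
  unfold Pol3
  convert this using 1
  ext x; simp
lemma Pol3.prod {r : ℕ} (A : Fin r → AF) : Pol3 r (fun x => ∏ j, ev (A j) x) :=
  Submodule.subset_span ⟨A, rfl⟩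
lemma ipol_pol (r : ℕ) (v : Fin 4 → E3) (L : Fin 4 → AF) (z : E3 → ℝ) :
    Pol3 r (ipol r v L z) :=
  Pol3.sum _ fun s => (Pol3.prod fun i => L (s i)).smul _

@[simp] lemma ev_one (x : E3) : ev (0, 1) x = 1 := by simp [ev]
@[simp] lemma ev_const (a : ℝ) (x : E3) : ev (0, a) x = a := by simp [ev]

lemma Pol3.quad {r : ℕ} (hr : 2 ≤ r) (A B : AF) : Pol3 r (fun x => ev A x * ev B x) := by
  obtain ⟨k, rfl⟩ := Nat.exists_eq_add_of_le' hr
  have := Pol3.prod (Fin.cons A (Fin.cons B (fun _ : Fin k => ((0, 1) : AF))) : Fin (k+2) → AF)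
  convert this using 2 with x
  simp [Fin.prod_univ_succ]

lemma Pol3.lin {r : ℕ} (hr : 1 ≤ r) (A : AF) : Pol3 r (fun x => ev A x) := by
  obtain ⟨k, rfl⟩ := Nat.exists_eq_add_of_le' hr
  have := Pol3.prod (Fin.cons A (fun _ : Fin k => ((0, 1) : AF)) : Fin (k+1) → AF)
  convert this using 2 with x
  simp [Fin.prod_univ_succ]

lemma Pol3.const {r : ℕ} (hr : 1 ≤ r) (a : ℝ) : Pol3 r (fun _ => a) := by
  simpa using Pol3.lin hr (0, a)

def bs (i : Fin 3) : E3 := EuclideanSpace.single i 1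
def pd (i : Fin 3) (f : E3 → ℝ) (x : E3) : ℝ := fderiv ℝ f x (bs i)

lemma hasFDerivAt_ev (A : AF) (x : E3) : HasFDerivAt (ev A) A.1 x :=
  A.1.hasFDerivAt.add_const _

lemma hasFDerivAt_prod {r : ℕ} (A : Fin r → AF) (x : E3) :
    HasFDerivAt (fun x => ∏ j, ev (A j) x)
      (∑ i, (∏ j ∈ Finset.univ.erase i, ev (A j) x) • (A i).1) x := by
  classical
  exact HasFDerivAt.finsetProd (fun i _ => hasFDerivAt_ev (A i) x)

lemma Pol3.contDiff {r : ℕ} {f : E3 → ℝ} (hf : Pol3 r f) (n : WithTop ℕ∞) :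
    ContDiff ℝ n f := by
  induction hf using Submodule.span_induction with
  | mem g hg =>
    obtain ⟨A, rfl⟩ := hg
    apply contDiff_prod
    intro i _
    exact (A i).1.contDiff.add contDiff_const
  | zero => exact contDiff_const
  | add f g _ _ hf hg => exact hf.add hg
  | smul a f _ hf => exact contDiff_const.smul hf

lemma Pol3.diff {r : ℕ} {f : E3 → ℝ} (hf : Pol3 r f) : Differentiable ℝ f :=
  (hf.contDiff 1).differentiable (by norm_num)

lemma Pol3.pd {r : ℕ} {f : E3 → ℝ} (i : Fin 3) (hf : Pol3 r f) : Pol3 r (pd i f) := by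
  classical
  induction hf using Submodule.span_induction with
  | mem g hg =>
    obtain ⟨A, rfl⟩ := hg
    have : _root_.pd i (fun x => ∏ j, ev (A j) x)
        = fun x => ∑ k, ∏ j, ev ((Function.update A k (0, (A k).1 (bs i))) j) x := by
      ext x
      rw [_root_.pd, (hasFDerivAt_prod A x).fderiv]
      simp only [_root_.sum_apply, _root_.smul_apply, smul_eq_mul]
      apply Finset.sum_congr rfl
      intro k _
      rw [← Finset.mul_prod_erase _ _ (Finset.mem_univ k), mul_comm]
      simp only [Function.update_self, ev_const]
      congr 1
      apply Finset.prod_congr rfl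
      intro j hj
      rw [Function.update_of_ne (Finset.ne_of_mem_erase hj)]
    rw [this]
    exact Pol3.sum _ fun k => Pol3.prod _
  | zero =>
    have : _root_.pd i (0 : E3 → ℝ) = fun x => 0 := by
      ext x
      simp [_root_.pd]
    rw [this]; exact Submodule.zero_mem _
  | add f g hf hg hf' hg' =>
    have : _root_.pd i (f + g) = fun x => _root_.pd i f x + _root_.pd i g x := by
      ext x
      rw [_root_.pd, fderiv_add (Pol3.diff hf x) (Pol3.diff hg x)]; rfl
    rw [this]; exact hf'.add hg'
  | smul a f hf hf' =>
    have : _root_.pd i (a • f) = fun x => a * _root_.pd i f x := by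
      ext x
      rw [_root_.pd, fderiv_const_smul (Pol3.diff hf x)]; rfl
    rw [this]; exact hf'.smul a

lemma monomial_prod (r : ℕ) : ∀ m : Fin 3 → ℕ, ∑ i, m i ≤ r →
    ∃ A : Fin r → AF, ∀ x : E3, ∏ i, x i ^ m i = ∏ j, ev (A j) x := by
  induction r with
  | zero =>
    intro m hm
    have : ∀ i, m i = 0 := by simpa using hm
    exact ⟨fun j => j.elim0, fun x => by simp [this]⟩
  | succ r ih =>
    intro m hm
    by_cases h0 : ∑ i, m i ≤ r
    · obtain ⟨A, hA⟩ := ih m h0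
      exact ⟨Fin.cons (0, 1) A, fun x => by rw [hA, Fin.prod_univ_succ]; simp⟩
    · have : ∃ i, m i ≠ 0 := by
        by_contra hcon
        push Not at hcon
        simp [hcon] at h0
      obtain ⟨i, hi⟩ := this
      have hm' : m = Function.update m i (m i - 1) + Pi.single i 1 := by
        ext j
        by_cases hj : j = i
        · subst hj; simp; omega
        · simp [hj]
      have hs : ∑ j, (Function.update m i (m i - 1)) j ≤ r := by
        rw [hm'] at hm
        simp only [Pi.add_apply, Finset.sum_add_distrib, Finset.sum_pi_single', Finset.mem_univ,
          if_true] at hm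
        simp at hm
        omega
      obtain ⟨A, hA⟩ := ih _ hs
      refine ⟨Fin.cons (EuclideanSpace.proj i, 0) A, fun x => ?_⟩
      rw [Fin.prod_univ_succ (fun j => ev ((Fin.cons (EuclideanSpace.proj i, 0) A : Fin (r+1) → AF) j) x)]
      simp only [Fin.cons_zero, Fin.cons_succ]
      rw [← hA, ← Finset.mul_prod_erase _ _ (Finset.mem_univ i),
        ← Finset.mul_prod_erase (Finset.univ) (fun j => x j ^ (Function.update m i (m i - 1)) j)
          (Finset.mem_univ i), ← mul_assoc]
      congr 1
      · simp only [Function.update_self, ev, add_zero]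
        change _ = x i * _
        rw [← pow_succ']
        congr 1; omega
      · apply Finset.prod_congr rfl
        intro j hj
        rw [Function.update_of_ne (Finset.ne_of_mem_erase hj)]

lemma pol3_of_mv {r : ℕ} (p : MvPolynomial (Fin 3) ℝ) (hp : p.totalDegree ≤ r) :
    Pol3 r (fun x => MvPolynomial.eval (fun i => x i) p) := by
  have : (fun x : E3 => MvPolynomial.eval (fun i => x i) p)
      = fun x => ∑ m ∈ p.support.attach, p.coeff m * ∏ i, x i ^ (m : Fin 3 →₀ ℕ) i := by
    ext x
    rw [MvPolynomial.eval_eq', Finset.sum_attach p.support (fun m => p.coeff m * ∏ i, x i ^ m i)]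
  rw [this]
  apply Pol3.sum
  rintro ⟨m, hm⟩
  apply Pol3.smul
  have h1 : ∑ i, m i ≤ r := by
    have := MvPolynomial.le_totalDegree hm
    rw [Finsupp.sum_fintype _ _ (by simp)] at this
    exact this.trans hp
  obtain ⟨A, hA⟩ := monomial_prod r m h1
  simp_rw [hA]
  exact Pol3.prod A

lemma ev_eq (A : AF) (x : E3) : ev A x = ∑ i, A.1 (bs i) * x i + A.2 := by
  rw [ev]
  congr 1
  conv_lhs => rw [← (EuclideanSpace.basisFun (Fin 3) ℝ).sum_repr x]
  simp [bs, mul_comm]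

lemma mv_of_pol3 {r : ℕ} {f : E3 → ℝ} (hf : Pol3 r f) :
    ∃ p : MvPolynomial (Fin 3) ℝ, p.totalDegree ≤ r ∧
      ∀ x : E3, f x = MvPolynomial.eval (fun i => x i) p := by
  induction hf using Submodule.span_induction with
  | mem g hg =>
    obtain ⟨A, rfl⟩ := hg
    refine ⟨∏ j, (∑ i, MvPolynomial.C ((A j).1 (bs i)) * MvPolynomial.X i
      + MvPolynomial.C (A j).2), ?_, ?_⟩
    · refine (MvPolynomial.totalDegree_finsetProd _ _).trans ?_
      refine (Finset.sum_le_card_nsmul _ _ 1 ?_).trans (by simp)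
      intro j _
      refine (MvPolynomial.totalDegree_add _ _).trans (max_le ?_ (by simp))
      refine (MvPolynomial.totalDegree_finsetSum _ _).trans ?_
      apply Finset.sup_le
      intro i _
      refine (MvPolynomial.totalDegree_mul _ _).trans (by simp)
    · intro x
      simp [ev_eq]
  | zero => exact ⟨0, by simp, by simp⟩
  | add f g _ _ hf hg =>
    obtain ⟨p, hp, hp'⟩ := hf
    obtain ⟨q, hq, hq'⟩ := hg
    exact ⟨p + q, (MvPolynomial.totalDegree_add _ _).trans (max_le hp hq), fun x => by
      simp [hp', hq']⟩
  | smul a f _ hf =>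
    obtain ⟨p, hp, hp'⟩ := hf
    exact ⟨a • p, (MvPolynomial.totalDegree_smul_le _ _).trans hp, fun x => by
      simp [hp']⟩

lemma exists_bary {v : Fin 4 → E3} (h : AffineIndependent ℝ v) : ∃ L, IsBary v L := by
  have htot : affineSpan ℝ (range v) = ⊤ := by
    rw [h.affineSpan_eq_top_iff_card_eq_finrank_add_one]
    simp
  let b : AffineBasis (Fin 4) ℝ E3 := ⟨v, h, htot⟩
  have hb : ∀ i, b i = v i := fun i => rfl
  refine ⟨fun i => (LinearMap.toContinuousLinearMap (b.coord i).linear, b.coord i 0), ?_⟩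
  have key : ∀ i x, ev ((LinearMap.toContinuousLinearMap (b.coord i).linear, b.coord i 0) : AF) x
      = b.coord i x := by
    intro i x
    have := (b.coord i).map_vadd 0 x
    simp only [vadd_eq_add, add_zero] at this
    rw [this]
    simp [ev]
  refine ⟨fun x => ?_, fun x => ?_, fun i j => ?_⟩
  · simp only [key]; exact b.sum_coord_apply_eq_one x
  · simp only [key]; exact b.linear_combination_coord_eq_self x
  · rw [key, ← hb]; exact b.coord_apply i j

lemma IsBary.mem_tet {v : Fin 4 → E3} {L : Fin 4 → AF} (h : IsBary v L) (x : E3) :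
    x ∈ tet v ↔ ∀ i, 0 ≤ ev (L i) x := by
  constructor
  · intro hx i
    have hc : Convex ℝ {y : E3 | 0 ≤ ev (L i) y} := by
      have : {y : E3 | 0 ≤ ev (L i) y} = {y : E3 | -(L i).2 ≤ (L i).1 y} := by
        ext y; simp only [ev, mem_ofPred_eq]; constructor <;> intro <;> linarith
      rw [this]
      exact convex_halfSpace_ge (L i).1.toLinearMap.isLinear _
    have := convexHull_min (s := range v) (t := {y : E3 | 0 ≤ ev (L i) y}) (by
      rintro _ ⟨j, rfl⟩
      simp only [mem_ofPred_eq, h.2.2]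
      split_ifs <;> norm_num) hc
    exact this hx
  · intro hx
    rw [← h.2.1 x]
    exact (convex_convexHull ℝ _).sum_mem (fun i _ => hx i) (h.1 x)
      (fun i _ => subset_convexHull ℝ _ ⟨i, rfl⟩)

lemma IsBary.le_one {v : Fin 4 → E3} {L : Fin 4 → AF} (h : IsBary v L) {x : E3}
    (hx : x ∈ tet v) (i : Fin 4) : ev (L i) x ≤ 1 := by
  rw [← h.1 x]
  exact Finset.single_le_sum (f := fun i => ev (L i) x)
    (fun j _ => (h.mem_tet x).1 hx j) (Finset.mem_univ i)

lemma vert_mem (v : Fin 4 → E3) (i : Fin 4) : v i ∈ tet v := subset_convexHull ℝ _ ⟨i, rfl⟩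
lemma tet_convex (v : Fin 4 → E3) : Convex ℝ (tet v) := convex_convexHull ℝ _
lemma tet_compact (v : Fin 4 → E3) : IsCompact (tet v) := (finite_range v).isCompact_convexHull _

/-- good tetrahedron, unit mesh size -/
def Tet1 (c : ℝ) (v : Fin 4 → E3) (L : Fin 4 → AF) : Prop :=
  IsBary v L ∧ diam (tet v) ≤ 1 ∧ ∃ x, closedBall x c ⊆ tet v

lemma Tet1.dist_le {c : ℝ} {v : Fin 4 → E3} {L : Fin 4 → AF} (h : Tet1 c v L) {x y : E3}
    (hx : x ∈ tet v) (hy : y ∈ tet v) : dist x y ≤ 1 :=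
  (dist_le_diam_of_mem (tet_compact v).isBounded hx hy).trans h.2.1

lemma Tet1.grad_le {c : ℝ} (hc : 0 < c) {v : Fin 4 → E3} {L : Fin 4 → AF} (h : Tet1 c v L)
    (i : Fin 4) : ‖(L i).1‖ ≤ 1 / c := by
  obtain ⟨xc, hxc⟩ := h.2.2
  apply ContinuousLinearMap.opNorm_le_bound _ (by positivity)
  intro y
  rcases eq_or_ne y 0 with rfl | hy
  · simp
  have hy' : 0 < ‖y‖ := norm_pos_iff.2 hy
  have hm : ∀ s : ℝ, |s| = 1 → xc + (s * c / ‖y‖) • y ∈ tet v := by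
    intro s hs
    apply hxc
    rw [mem_closedBall, dist_eq_norm, add_sub_cancel_left, norm_smul, Real.norm_eq_abs, abs_div,
      abs_mul, hs, abs_of_pos hc, abs_of_pos hy']
    field_simp; exact le_refl _
  have h1 := h.1.le_one (hm 1 (by simp)) i
  have h2 := (h.1.mem_tet _).1 (hm (-1) (by simp)) i
  have h3 := h.1.le_one (hm (-1) (by simp)) i
  have h4 := (h.1.mem_tet _).1 (hm (1) (by simp)) i
  simp only [ev, map_add, map_smul, smul_eq_mul] at h1 h2 h3 h4
  have h5 : (1 * c / ‖y‖) * (L i).1 y ≤ 1 ∧ -1 ≤ (1 * c / ‖y‖) * (L i).1 y := by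
    have : (-1 * c / ‖y‖) * (L i).1 y = -((1 * c / ‖y‖) * (L i).1 y) := by ring
    rw [this] at h2 h3
    constructor <;> linarith
  have h6 : |(1 * c / ‖y‖) * (L i).1 y| ≤ 1 := abs_le.2 ⟨h5.2, h5.1⟩
  rw [abs_mul, abs_of_pos (by positivity)] at h6
  rw [Real.norm_eq_abs]
  have : |(L i).1 y| = (1 / c * ‖y‖) * (1 * c / ‖y‖ * |(L i).1 y|) := by field_simp
  rw [this]
  exact mul_le_of_le_one_right (by positivity) h6

def Cr (r : ℕ) : ℝ := (r.factorial : ℝ)⁻¹ * ∑ S : Finset (Fin r), (S.card : ℝ) ^ r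
def C1 (r : ℕ) : ℝ := 4 ^ r * Cr r
def Ci (r : ℕ) (c : ℝ) : ℝ := 4 ^ r * Cr r * (r * (1 / c))
def C2 (r : ℕ) (c : ℝ) : ℝ := 4 * (2 * Ci r c + 2) ^ 3

lemma Cr_nonneg (r : ℕ) : 0 ≤ Cr r := by unfold Cr; positivity
lemma C1_nonneg (r : ℕ) : 0 ≤ C1 r := by have := Cr_nonneg r; unfold C1; positivity
lemma Ci_nonneg (r : ℕ) {c : ℝ} (hc : 0 < c) : 0 ≤ Ci r c := by
  have := Cr_nonneg r; unfold Ci; positivity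

lemma cf_le {r : ℕ} (hr : 1 ≤ r) {v : Fin 4 → E3} {z : E3 → ℝ} {B : ℝ} 
    (hz : ∀ x ∈ tet v, |z x| ≤ B) (s : Fin r → Fin 4) :
    |cf r z (fun i => v (s i))| ≤ Cr r * B := by
  rw [cf, abs_mul, abs_of_nonneg (by positivity), Cr, mul_assoc]
  apply mul_le_mul_of_nonneg_left _ (by positivity)
  rw [Finset.sum_mul]
  refine (Finset.abs_sum_le_sum_abs _ _).trans (Finset.sum_le_sum fun S _ => ?_)
  rw [abs_mul, abs_mul, abs_pow, abs_neg, abs_one, one_pow, one_mul,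
    abs_of_nonneg (by positivity : (0 : ℝ) ≤ (S.card : ℝ) ^ r)]
  rcases S.eq_empty_or_nonempty with rfl | hS
  · have : r ≠ 0 := by omega
    simp [this]
  · apply mul_le_mul_of_nonneg_left _ (by positivity)
    apply hz
    rw [Finset.smul_sum]
    have : (S.card : ℝ) ≠ 0 := by exact_mod_cast Finset.card_ne_zero.2 hS
    exact (tet_convex v).sum_mem (fun i _ => by positivity) (by simp [this])
      (fun i _ => vert_mem v _)

lemma ipol_le {r : ℕ} (hr : 1 ≤ r) {v : Fin 4 → E3} {L : Fin 4 → AF} (h : IsBary v L)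
    {z : E3 → ℝ} {B : ℝ} (hz : ∀ x ∈ tet v, |z x| ≤ B) {x : E3} (hx : x ∈ tet v) :
    |ipol r v L z x| ≤ C1 r * B := by
  have hB : 0 ≤ B := (abs_nonneg _).trans (hz x hx)
  rw [ipol]
  refine (Finset.abs_sum_le_sum_abs _ _).trans ?_
  have : ∀ s : Fin r → Fin 4, |cf r z (fun i => v (s i)) * ∏ i, ev (L (s i)) x| ≤ Cr r * B := by
    intro s
    rw [abs_mul]
    refine (mul_le_of_le_one_right (abs_nonneg _) ?_).trans (cf_le hr hz s)
    rw [Finset.abs_prod]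
    apply Finset.prod_le_one (fun _ _ => abs_nonneg _)
    intro i _
    rw [abs_of_nonneg ((h.mem_tet x).1 hx _)]
    exact h.le_one hx _
  refine (Finset.sum_le_sum fun s _ => this s).trans ?_
  rw [Finset.sum_const, Finset.card_univ, Fintype.card_fun, Fintype.card_fin, Fintype.card_fin,
    nsmul_eq_mul, C1]
  push_cast; exact le_of_eq (by ring)

lemma fderiv_ipol_le {r : ℕ} (hr : 1 ≤ r) {c : ℝ} (hc : 0 < c) {v : Fin 4 → E3} {L : Fin 4 → AF}
    (h : Tet1 c v L) {z : E3 → ℝ} {B : ℝ} (hz : ∀ x ∈ tet v, |z x| ≤ B) {x : E3}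
    (hx : x ∈ tet v) : ‖fderiv ℝ (ipol r v L z) x‖ ≤ Ci r c * B := by
  classical
  have hB : 0 ≤ B := (abs_nonneg _).trans (hz x hx)
  have hd : HasFDerivAt (ipol r v L z) (∑ s : Fin r → Fin 4, cf r z (fun i => v (s i)) •
      (∑ i, (∏ j ∈ Finset.univ.erase i, ev (L (s j)) x) • (L (s i)).1)) x := by
    have := HasFDerivAt.fun_sum (u := (Finset.univ : Finset (Fin r → Fin 4)))
      (fun s _ => (hasFDerivAt_prod (fun i => L (s i)) x).const_mul (cf r z (fun i => v (s i))))
    exact this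
  rw [hd.fderiv]
  refine (norm_sum_le _ _).trans ?_
  have : ∀ s : Fin r → Fin 4, ‖cf r z (fun i => v (s i)) •
      (∑ i, (∏ j ∈ Finset.univ.erase i, ev (L (s j)) x) • (L (s i)).1)‖
      ≤ Cr r * B * (r * (1 / c)) := by
    intro s
    rw [norm_smul]
    apply mul_le_mul (cf_le hr hz s) _ (norm_nonneg _) (mul_nonneg (Cr_nonneg r) hB)
    refine (norm_sum_le _ _).trans ?_
    refine (Finset.sum_le_card_nsmul _ _ (1 / c) ?_).trans (by simp)
    intro i _
    rw [norm_smul]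
    refine (mul_le_of_le_one_left (norm_nonneg _) ?_).trans (h.grad_le hc _)
    rw [Real.norm_eq_abs, Finset.abs_prod]
    apply Finset.prod_le_one (fun _ _ => abs_nonneg _)
    intro i _
    rw [abs_of_nonneg ((h.1.mem_tet x).1 hx _)]
    exact h.1.le_one hx _
  refine (Finset.sum_le_sum fun s _ => this s).trans ?_
  rw [Finset.sum_const, Finset.card_univ, Fintype.card_fun, Fintype.card_fin, Fintype.card_fin,
    nsmul_eq_mul, Ci]
  push_cast; exact le_of_eq (by ring)

/-- inverse estimate -/
lemma inv_est {r : ℕ} (hr : 1 ≤ r) {c : ℝ} (hc : 0 < c) {v : Fin 4 → E3} {L : Fin 4 → AF}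
    (h : Tet1 c v L) {f : E3 → ℝ} (hf : Pol3 r f) {B : ℝ} (hz : ∀ x ∈ tet v, |f x| ≤ B) {x : E3}
    (hx : x ∈ tet v) : ‖fderiv ℝ f x‖ ≤ Ci r c * B := by
  have := fderiv_ipol_le hr hc h hz hx
  rwa [ipol_poly hr h.1 hf] at this

lemma bs_norm (i : Fin 3) : ‖bs i‖ = 1 := by simp [bs]

lemma pd_le (i : Fin 3) (f : E3 → ℝ) (x : E3) : |pd i f x| ≤ ‖fderiv ℝ f x‖ := by
  have := (fderiv ℝ f x).le_opNorm (bs i)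
  rwa [bs_norm, mul_one] at this

lemma L2_inv {r : ℕ} (hr : 1 ≤ r) {c : ℝ} (hc : 0 < c) {v : Fin 4 → E3} {L : Fin 4 → AF}
    (h : Tet1 c v L) {f : E3 → ℝ} (hf : Pol3 r f) {x : E3} (hx : x ∈ tet v) :
    volume.real (tet v) * f x ^ 2 ≤ C2 r c * ∫ y in tet v, f y ^ 2 := by
  have hcf : Continuous f := hf.diff.continuous
  obtain ⟨x0, hx0, hmax⟩ := (tet_compact v).exists_isMaxOn ⟨x, hx⟩ (hcf.abs.continuousOn)
  have hmax' : ∀ y ∈ tet v, |f y| ≤ |f x0| := fun y hy => hmax hy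
  have hCi := Ci_nonneg r hc
  set t : ℝ := (2 * Ci r c + 2)⁻¹ with ht
  have ht0 : 0 < t := by positivity
  have ht1 : t ≤ 1 := inv_le_one_of_one_le₀ (by linarith)
  have htC : Ci r c * t ≤ 1 / 2 := by
    rw [ht, ← div_eq_mul_inv, div_le_iff₀ (by positivity)]; linarith
  set K' := AffineMap.homothety x0 t '' tet v with hK'
  have hsub : K' ⊆ tet v := by
    rintro _ ⟨y, hy, rfl⟩
    rw [AffineMap.homothety_apply, vsub_eq_sub, vadd_eq_add, add_comm]
    have := (tet_convex v).add_smul_sub_mem hx0 hy ⟨ht0.le, ht1⟩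
    exact this
  have hlow : ∀ y ∈ K', (f x0) ^ 2 / 4 ≤ f y ^ 2 := by
    intro y hy'
    have hyK := hsub hy'
    obtain ⟨w, hw, rfl⟩ := hy'
    set y := AffineMap.homothety x0 t w with hy
    have hd : ‖y - x0‖ ≤ t := by
      rw [hy, AffineMap.homothety_apply, vsub_eq_sub, vadd_eq_add, add_sub_cancel_right, norm_smul,
        Real.norm_eq_abs, abs_of_pos ht0]
      have := h.dist_le hw hx0
      rw [dist_eq_norm] at this
      exact mul_le_of_le_one_right ht0.le this
    have := (tet_convex v).norm_image_sub_le_of_norm_fderiv_le (f := f) (𝕜 := ℝ)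
      (fun z _ => hf.diff z) (fun z hz => inv_est hr hc h hf hmax' hz) hx0 hyK
    have h1 : |f y - f x0| ≤ |f x0| / 2 := by
      rw [Real.norm_eq_abs] at this
      refine this.trans ?_
      calc Ci r c * |f x0| * ‖y - x0‖ ≤ Ci r c * |f x0| * t := by gcongr
        _ = (Ci r c * t) * |f x0| := by ring
        _ ≤ 1 / 2 * |f x0| := by gcongr
        _ = _ := by ring
    have h2 : |f x0| / 2 ≤ |f y| := by
      have := abs_sub_abs_le_abs_sub (f x0) (f y)
      rw [abs_sub_comm] at this
      linarith
    have h3 : (|f x0| / 2) ^ 2 ≤ |f y| ^ 2 := by gcongr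
    rw [sq_abs, div_pow, sq_abs] at h3
    linarith
  have hvol : volume.real K' = t ^ 3 * volume.real (tet v) := by
    rw [measureReal_def, hK', Measure.addHaar_image_homothety, ENNReal.toReal_mul,
      measureReal_def, ENNReal.toReal_ofReal (by positivity)]
    simp [abs_of_pos ht0]
  have hfin : volume (tet v) ≠ ⊤ := (tet_compact v).measure_lt_top.ne
  have hint : IntegrableOn (fun y => f y ^ 2) (tet v) :=
    (hcf.pow 2).continuousOn.integrableOn_compact (tet_compact v)
  have hK'm : MeasurableSet K' := by
    have : IsCompact K' := (tet_compact v).image (AffineMap.homothety_continuous x0 t)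
    exact this.measurableSet
  have h1 : ∫ y in K', f y ^ 2 ≤ ∫ y in tet v, f y ^ 2 :=
    setIntegral_mono_set hint (ae_of_all _ fun y => sq_nonneg _) hsub.eventuallyLE
  have h2 : volume.real K' * ((f x0) ^ 2 / 4) ≤ ∫ y in K', f y ^ 2 := by
    have := setIntegral_mono_on (μ := volume) (s := K') (f := fun _ => f x0 ^ 2 / 4)
      (integrableOn_const (((measure_mono hsub).trans_lt hfin.lt_top).ne)) (hint.mono_set hsub) hK'm hlow
    simpa using this
  have h3 : f x ^ 2 ≤ f x0 ^ 2 := sq_le_sq.2 (hmax' x hx)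
  rw [hvol] at h2
  have h4 : C2 r c * t ^ 3 = 4 := by
    rw [C2, ht]; field_simp
  have hv0 : 0 ≤ volume.real (tet v) := measureReal_nonneg
  calc volume.real (tet v) * f x ^ 2 ≤ volume.real (tet v) * f x0 ^ 2 := by gcongr
    _ = (C2 r c * t ^ 3) * volume.real (tet v) * (f x0 ^ 2 / 4) := by rw [h4]; ring
    _ = C2 r c * (t ^ 3 * volume.real (tet v) * (f x0 ^ 2 / 4)) := by ring
    _ ≤ C2 r c * ∫ y in tet v, f y ^ 2 := by
        apply mul_le_mul_of_nonneg_left (h2.trans h1)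
        unfold C2; positivity

lemma glue_lip {ι : Type*} [Finite ι] (F : ι → Set E3) (hF : ∀ i, IsClosed (F i))
    (hcov : ∀ x, ∃ i, x ∈ F i) {f : E3 → ℝ} {K : ℝ≥0} (hf : ∀ i, LipschitzOnWith K f (F i)) :
    LipschitzWith K f := by
  have hcont : Continuous f := by
    apply (locallyFinite_of_finite F).continuous (eq_univ_of_forall fun x => by
      simpa using hcov x) hF
    exact fun i => (hf i).continuousOn
  apply LipschitzWith.of_dist_le_mul
  intro x y
  set p : ℝ → E3 := fun t => x + t • (y - x) with hp
  have hpc : Continuous p := by fun_prop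
  have hpd : ∀ s t, dist (p s) (p t) = |s - t| * dist x y := by
    intro s t
    simp only [hp, dist_eq_norm, add_sub_add_left_eq_sub, ← sub_smul, norm_smul, Real.norm_eq_abs]
    rw [norm_sub_rev x y]
  set s : Set ℝ := {t | dist (f x) (f (p t)) ≤ K * (t * dist x y)} with hs
  have hsub : Icc (0 : ℝ) 1 ⊆ s := by
    apply IsClosed.Icc_subset_of_forall_exists_gt
    · apply IsClosed.inter _ isClosed_Icc
      exact isClosed_le (by fun_prop) (by fun_prop)
    · simp [hs, hp]
    · rintro t ⟨hts, ht⟩ y' hy'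
      have : ∃ i, ∃ᶠ t' in nhdsWithin t (Ioi t), p t' ∈ F i := by
        by_contra hcon
        push Not at hcon
        have h1 := Filter.eventually_all.2 hcon
        obtain ⟨t', ht'⟩ := h1.exists
        obtain ⟨i, hi⟩ := hcov (p t')
        exact ht' i hi
      obtain ⟨i, hi⟩ := this
      have hti : p t ∈ F i := by
        apply (hF i).mem_of_frequently_of_tendsto hi
        exact hpc.continuousAt.mono_left nhdsWithin_le_nhds
      obtain ⟨t', ht'1, ht'2⟩ := (hi.and_eventually (Ioc_mem_nhdsGT hy')).exists
      refine ⟨t', ?_, ht'2⟩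
      have h2 := (hf i).dist_le_mul _ hti _ ht'1
      rw [hpd, abs_sub_comm, abs_of_pos (sub_pos.2 ht'2.1)] at h2
      simp only [hs, mem_ofPred_eq] at hts ⊢
      calc dist (f x) (f (p t')) ≤ dist (f x) (f (p t)) + dist (f (p t)) (f (p t')) :=
            dist_triangle _ _ _
        _ ≤ K * (t * dist x y) + K * ((t' - t) * dist x y) := by gcongr
        _ = _ := by ring
  have := hsub (right_mem_Icc.2 zero_le_one)
  simpa [hs, hp] using this

lemma ibp {e g : E3 → ℝ} {K K' : ℝ≥0} (he : LipschitzWith K e) (hg : LipschitzWith K' g)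
    (hgs : HasCompactSupport g) (i : Fin 3) :
    ∫ x, pd i e x * g x = - ∫ x, e x * pd i g x := by
  have h := he.integral_lineDeriv_mul_eq (μ := volume) hg hgs (bs i)
  have h1 : ∫ x, pd i e x * g x = ∫ x, lineDeriv ℝ e x (bs i) * g x := by
    apply integral_congr_ae
    filter_upwards [he.ae_differentiableAt] with x hx
    rw [hx.lineDeriv_eq_fderiv]; rfl
  rw [h1, h, ← integral_neg]
  apply integral_congr_ae
  filter_upwards [hg.ae_differentiableAt] with x hx
  rw [hx.lineDeriv_eq_fderiv, map_neg]
  simp only [pd]; ring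

lemma meas_pd (i : Fin 3) (f : E3 → ℝ) : Measurable (pd i f) := measurable_fderiv_apply_const ℝ f _

lemma pd_lip {f : E3 → ℝ} {K : ℝ≥0} (hf : LipschitzWith K f) (i : Fin 3) (x : E3) :
    |pd i f x| ≤ K := (pd_le i f x).trans (norm_fderiv_le_of_lipschitz ℝ hf)

lemma tv {c : ℝ} (hc : 0 < c) {K : Set E3} (hK : IsCompact K) (hKc : Convex ℝ K) {xc : E3}
    (hxc : closedBall xc c ⊆ K) {e : E3 → ℝ} {Ke : ℝ≥0} (he : LipschitzWith Ke e) {N : ℝ}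
    (heN : ∀ x, |e x| ≤ N) {F : E3 → ℝ} (hF : ContDiff ℝ 1 F) (i : Fin 3) {α β : ℝ}
    (hα : ∀ x ∈ K, |F x| ≤ α) (hβ : ∀ x ∈ K, |pd i F x| ≤ β) :
    |∫ x in K, pd i e x * F x| ≤ N * volume.real K * (3 * α / c + β) := by
  have hN : 0 ≤ N := (abs_nonneg _).trans (heN 0)
  have hxcK : xc ∈ K := hxc (mem_closedBall_self hc.le)
  have hα0 : 0 ≤ α := (abs_nonneg _).trans (hα xc hxcK)
  have hβ0 : 0 ≤ β := (abs_nonneg _).trans (hβ xc hxcK)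
  have hKne : (Kᶜ).Nonempty := by
    by_contra hcon
    rw [not_nonempty_iff_eq_empty, compl_empty_iff] at hcon
    exact noncompact_univ E3 (hcon ▸ hK)
  have hFd : Differentiable ℝ F := hF.differentiable (by norm_num)
  have hv : volume K ≠ ⊤ := hK.measure_lt_top.ne
  obtain ⟨A, hA⟩ := hK.exists_bound_of_continuousOn
    ((hF.continuous_fderiv (by norm_num)).continuousOn (s := K))
  have hA0 : 0 ≤ A := (norm_nonneg _).trans (hA xc hxcK)
  set ψ : ℕ → E3 → ℝ := fun n x => min 1 (n * infDist x Kᶜ) with hψ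
  have hψlip : ∀ n : ℕ, LipschitzWith (n : ℝ≥0) (ψ n) := by
    intro n
    have h1 : LipschitzWith ((n : ℝ≥0) * 1) (fun x : E3 => (n : ℝ) * infDist x Kᶜ) := by
      apply LipschitzWith.of_dist_le_mul
      intro x y
      have := (lipschitz_infDist_pt (Kᶜ)).dist_le_mul x y
      rw [Real.dist_eq, ← mul_sub, abs_mul, ← Real.dist_eq]
      simp only [NNReal.coe_one, one_mul, mul_one, NNReal.coe_natCast, Nat.abs_cast] at *
      gcongr
    rw [mul_one] at h1
    exact h1.const_min 1
  have hψ0 : ∀ n x, 0 ≤ ψ n x := fun n x => le_min zero_le_one (by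
    have := infDist_nonneg (x := x) (s := Kᶜ); positivity)
  have hψ1 : ∀ n x, ψ n x ≤ 1 := fun n x => min_le_left _ _
  have hψz : ∀ n, ∀ x ∈ closure Kᶜ, ψ n x = 0 := by
    intro n x hx
    have := (mem_closure_iff_infDist_zero hKne).1 hx
    simp [hψ, this]
  set g : ℕ → E3 → ℝ := fun n x => F x * ψ n x with hg
  have hgz : ∀ n, ∀ x ∉ K, g n x = 0 := fun n x hx => by
    simp only [hg]; rw [hψz n x (subset_closure hx), mul_zero]
  have hglip : ∀ n, ∃ K', LipschitzWith K' (g n) := by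
    intro n
    refine ⟨A.toNNReal + α.toNNReal * n, ?_⟩
    apply glue_lip (fun b : Bool => if b then K else closure Kᶜ)
    · intro b; cases b
      · simp
      · simpa using hK.isClosed
    · intro x
      by_cases hx : x ∈ K
      · exact ⟨true, by simpa using hx⟩
      · exact ⟨false, subset_closure (mem_compl hx)⟩
    · intro b
      apply LipschitzOnWith.of_dist_le_mul
      intro x hx y hy
      cases b
      · simp only [Bool.false_eq_true, if_false] at hx hy
        simp only [hg, hψz n x hx, hψz n y hy, mul_zero, dist_self]
        positivity
      · simp only [if_true] at hx hy
        have h1 := hKc.norm_image_sub_le_of_norm_fderiv_le (f := F) (𝕜 := ℝ)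
          (fun z _ => hFd z) hA hy hx
        have h2 := (hψlip n).dist_le_mul x y
        rw [Real.dist_eq] at h2 ⊢
        rw [← dist_eq_norm x y, Real.norm_eq_abs] at h1
        simp only [NNReal.coe_add, NNReal.coe_mul, NNReal.coe_natCast, Real.coe_toNNReal _ hA0,
          Real.coe_toNNReal _ hα0] at h2 ⊢
        calc |g n x - g n y| = |(F x - F y) * ψ n x + F y * (ψ n x - ψ n y)| := by
              simp only [hg]; congr 1; ring
          _ ≤ |F x - F y| * ψ n x + |F y| * |ψ n x - ψ n y| := by
              refine (abs_add_le _ _).trans ?_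
              rw [abs_mul, abs_mul, abs_of_nonneg (hψ0 n x)]
          _ ≤ (A * dist x y) * 1 + α * (n * dist x y) := by
              gcongr
              · exact hψ0 n x
              · exact hψ1 n x
              · exact hα y hy
          _ = _ := by ring
  have hgs : ∀ n, HasCompactSupport (g n) := fun n => HasCompactSupport.intro hK (hgz n)
  -- layers
  set lay : ℕ → Set E3 := fun n => {x ∈ K | infDist x Kᶜ < 1 / n} with hlay
  have hlaym : ∀ n, MeasurableSet (lay n) := fun n =>
    hK.measurableSet.inter (measurableSet_lt (continuous_infDist_pt _).measurable measurable_const)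
  have hlayv : ∀ n : ℕ, 1 / c ≤ n → n * volume.real (lay n) ≤ 3 / c * volume.real K := by
    intro n hn
    have hn0 : (0 : ℝ) < n := lt_of_lt_of_le (by positivity) hn
    set t : ℝ := 1 / (n * c) with ht
    have ht0 : 0 ≤ t := by positivity
    have ht1 : t ≤ 1 := by
      rw [ht, div_le_one (by positivity)]
      rwa [div_le_iff₀ hc] at hn
    set K' := AffineMap.homothety xc (1 - t) '' K with hK'
    have hK'K : K' ⊆ K := by
      rintro _ ⟨y, hy, rfl⟩
      rw [AffineMap.homothety_apply, vsub_eq_sub, vadd_eq_add, add_comm]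
      exact hKc.add_smul_sub_mem hxcK hy ⟨by linarith, by linarith⟩
    have hsub : lay n ⊆ K \ K' := by
      rintro x ⟨hx, hxd⟩
      refine ⟨hx, ?_⟩
      rintro ⟨k, hk, rfl⟩
      apply absurd hxd
      rw [not_lt]
      apply (le_infDist hKne).2
      intro z hz
      by_contra hcon
      push Not at hcon
      apply hz
      have hz' : z = (1 - t) • k + t • (xc + t⁻¹ • (z - AffineMap.homothety xc (1 - t) k)) := by
        have htne : t ≠ 0 := by positivity
        rw [AffineMap.homothety_apply, vsub_eq_sub, vadd_eq_add, smul_add, smul_smul,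
          mul_inv_cancel₀ htne]
        module
      rw [hz']
      refine hKc hk (hxc ?_) (by linarith) ht0 (by ring)
      rw [mem_closedBall, dist_eq_norm, add_sub_cancel_left, norm_smul, Real.norm_eq_abs,
        abs_inv, abs_of_nonneg ht0, ← dist_eq_norm, dist_comm]
      have : t⁻¹ = n * c := by rw [ht]; simp
      rw [this]
      calc n * c * dist _ z ≤ n * c * (1 / n) := by gcongr
        _ = c := by field_simp
    have h1 : volume.real (lay n) ≤ volume.real (K \ K') :=
      measureReal_mono hsub ((measure_mono sdiff_subset).trans_lt hv.lt_top).ne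
    have hK'm : MeasurableSet K' := by
      have : IsCompact K' := hK.image (AffineMap.homothety_continuous xc (1 - t))
      exact this.measurableSet
    rw [measureReal_sdiff hK'K hK'm hv] at h1
    have h2 : volume.real K' = (1 - t) ^ 3 * volume.real K := by
      rw [measureReal_def, hK', Measure.addHaar_image_homothety, ENNReal.toReal_mul,
        measureReal_def, ENNReal.toReal_ofReal (by positivity)]
      simp [abs_of_nonneg (sub_nonneg.2 ht1)]
    have hv0 : 0 ≤ volume.real K := measureReal_nonneg
    have h3 : volume.real (lay n) ≤ 3 * t * volume.real K := by
      rw [h2] at h1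
      have : 1 - (1 - t) ^ 3 ≤ 3 * t := by nlinarith [mul_nonneg ht0 (sub_nonneg.2 ht1), sq_nonneg t]
      nlinarith
    calc n * volume.real (lay n) ≤ n * (3 * t * volume.real K) := by gcongr
      _ = 3 / c * volume.real K := by rw [ht]; field_simp
  have hbd : ∀ n : ℕ, 1 ≤ n → ∀ᵐ x, ‖e x * pd i (g n) x‖ ≤
      N * (β * K.indicator 1 x + α * n * (lay n).indicator 1 x) := by
    intro n hn
    have hn0 : (0 : ℝ) < n := by exact_mod_cast hn
    have hfr : ∀ᵐ x, x ∉ frontier K := measure_eq_zero_iff_ae_notMem.1 (hKc.addHaar_frontier volume)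
    filter_upwards [(hψlip n).ae_differentiableAt, hfr] with x hx hxf
    rw [Real.norm_eq_abs, abs_mul]
    apply mul_le_mul (heN x) _ (abs_nonneg _) hN
    by_cases hxK : x ∈ K
    · rw [indicator_of_mem hxK, Pi.one_apply, mul_one]
      have h1 : pd i (g n) x = F x * pd i (ψ n) x + ψ n x * pd i F x := by
        simp only [pd, hg]
        rw [fderiv_fun_mul (hFd x) hx]
        simp
      have h2 : |pd i (g n) x| ≤ α * |pd i (ψ n) x| + β := by
        rw [h1]
        refine (abs_add_le _ _).trans ?_
        rw [abs_mul, abs_mul, abs_of_nonneg (hψ0 n x)]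
        gcongr
        · exact hα x hxK
        · exact (mul_le_of_le_one_left (abs_nonneg _) (hψ1 n x)).trans (hβ x hxK)
      refine h2.trans ?_
      rw [add_comm]
      by_cases hxl : x ∈ lay n
      · rw [indicator_of_mem hxl, Pi.one_apply, mul_one]
        gcongr
        have := pd_lip (hψlip n) i x
        simpa using this
      · have h3 : ψ n x = 1 := by
          have : 1 / (n : ℝ) ≤ infDist x Kᶜ := by
            by_contra hcon
            exact hxl ⟨hxK, not_le.1 hcon⟩
          simp only [hψ]
          rw [min_eq_left]
          rwa [div_le_iff₀' hn0] at this
        have h4 : IsLocalMax (ψ n) x := Filter.Eventually.of_forall fun y => by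
          rw [h3]; exact hψ1 n y
        simp [pd, h4.fderiv_eq_zero, indicator_of_notMem hxl]
    · have : g n =ᶠ[nhds x] fun _ => 0 := by
        filter_upwards [hK.isClosed.isOpen_compl.mem_nhds hxK] with y hy using hgz n y hy
      rw [pd, this.fderiv_eq]
      have hl : x ∉ lay n := fun h => hxK h.1
      simp [indicator_of_notMem hxK, indicator_of_notMem hl]
  have hbound : ∀ n : ℕ, 1 ≤ n → 1 / c ≤ n →
      |∫ x in K, pd i e x * g n x| ≤ N * volume.real K * (3 * α / c + β) := by
    intro n hn1 hn2
    rw [setIntegral_eq_integral_of_forall_compl_eq_zero (fun x hx => by rw [hgz n x hx, mul_zero])]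
    obtain ⟨K', hK'⟩ := hglip n
    rw [ibp he hK' (hgs n) i, abs_neg, ← Real.norm_eq_abs]
    have hlf : volume (lay n) ≠ ⊤ := ((measure_mono fun x hx => hx.1).trans_lt hv.lt_top).ne
    have i1 : Integrable (fun x => β * K.indicator (1 : E3 → ℝ) x) :=
      ((integrable_indicator_iff hK.measurableSet).2 (integrableOn_const hv)).const_mul _
    have i2 : Integrable (fun x => α * n * (lay n).indicator (1 : E3 → ℝ) x) :=
      ((integrable_indicator_iff (hlaym n)).2 (integrableOn_const hlf)).const_mul _
    refine (norm_integral_le_of_norm_le ((i1.add i2).const_mul N) (hbd n hn1)).trans ?_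
    simp only [Pi.add_apply]
    rw [integral_const_mul, integral_add i1 i2, integral_const_mul, integral_const_mul,
      integral_indicator_one hK.measurableSet, integral_indicator_one (hlaym n), mul_assoc N]
    apply mul_le_mul_of_nonneg_left _ hN
    have := mul_le_mul_of_nonneg_left (hlayv n hn2) hα0
    calc _ = β * volume.real K + α * (n * volume.real (lay n)) := by ring
      _ ≤ β * volume.real K + α * (3 / c * volume.real K) := by gcongr
      _ = _ := by ring
  have hlim : Filter.Tendsto (fun n : ℕ => ∫ x in K, pd i e x * g n x) Filter.atTop
      (nhds (∫ x in K, pd i e x * F x)) := by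
    apply tendsto_integral_of_dominated_convergence (fun _ => (Ke : ℝ) * α)
    · intro n
      exact ((meas_pd i e).mul (hF.continuous.mul (hψlip n).continuous).measurable).aestronglyMeasurable
    · exact integrableOn_const hv
    · intro n
      filter_upwards [ae_restrict_mem hK.measurableSet] with x hx
      rw [Real.norm_eq_abs, abs_mul]
      apply mul_le_mul (pd_lip he i x) _ (abs_nonneg _) Ke.2
      simp only [hg]
      rw [abs_mul, abs_of_nonneg (hψ0 n x)]
      exact (mul_le_of_le_one_right (abs_nonneg _) (hψ1 n x)).trans (hα x hx)
    · have hfr : ∀ᵐ x ∂(volume.restrict K), x ∉ frontier K :=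
        ae_restrict_of_ae (measure_eq_zero_iff_ae_notMem.1 (hKc.addHaar_frontier volume))
      filter_upwards [ae_restrict_mem hK.measurableSet, hfr] with x hx hxf
      have hpos : 0 < infDist x Kᶜ := by
        rw [← not_le]
        intro h0
        have : x ∈ closure Kᶜ :=
          (mem_closure_iff_infDist_zero hKne).2 (le_antisymm h0 infDist_nonneg)
        exact hxf ⟨subset_closure hx, by rwa [closure_compl] at this⟩
      apply Filter.Tendsto.congr' _ tendsto_const_nhds
      obtain ⟨m, hm⟩ := exists_nat_ge (1 / infDist x Kᶜ)
      filter_upwards [Filter.eventually_ge_atTop m] with n hn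
      have : ψ n x = 1 := by
        simp only [hψ]
        rw [min_eq_left]
        rw [div_le_iff₀ hpos] at hm
        refine hm.trans ?_
        gcongr
      simp only [hg]; rw [this, mul_one]
  obtain ⟨m, hm⟩ := exists_nat_ge (1 / c)
  apply le_of_tendsto (hlim.abs)
  filter_upwards [Filter.eventually_ge_atTop m, Filter.eventually_ge_atTop 1] with n hn hn1
  exact hbound n hn1 (hm.trans (by exact_mod_cast hn))

structure Mesh (c : ℝ) (Ω : Set E3) (T : Finset (Fin 4 → E3)) : Prop where
  op : IsOpen Ω
  bd : Bornology.IsBounded Ω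
  cv : Convex ℝ Ω
  pt : IsTetPartition Ω T 1 c

open Classical in
def lam (v : Fin 4 → E3) : Fin 4 → AF := if h : ∃ L, IsBary v L then h.choose else fun _ => 0

lemma lam_bary {v : Fin 4 → E3} (h : AffineIndependent ℝ v) : IsBary v (lam v) := by
  have h1 := exists_bary h
  rw [lam, dif_pos h1]
  exact h1.choose_spec

lemma Mesh.tet1 {c : ℝ} {Ω : Set E3} {T : Finset (Fin 4 → E3)} (h : Mesh c Ω T) {v : Fin 4 → E3}
    (hv : v ∈ T) : Tet1 c v (lam v) := by
  refine ⟨lam_bary (h.pt.1 v hv), h.pt.2.2.2.2.1 v hv, ?_⟩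
  simpa using h.pt.2.2.2.2.2 v hv

lemma ev_sum {ι : Type*} (s : Finset ι) (μ : ι → ℝ) (p : ι → E3) (h1 : ∑ i ∈ s, μ i = 1) (A : AF) :
    ev A (∑ i ∈ s, μ i • p i) = ∑ i ∈ s, μ i * ev A (p i) := by
  simp only [ev, map_sum, map_smul, smul_eq_mul, mul_add, Finset.sum_add_distrib]
  rw [← Finset.sum_mul, h1, one_mul]

lemma range_sub {v w : Fin 4 → E3} {L L' : Fin 4 → AF} (hv : IsBary v L) (hw : IsBary w L')
    (h : tet v = tet w) : range v ⊆ range w := by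
  rintro _ ⟨i, rfl⟩
  have hvi : v i ∈ tet w := h ▸ vert_mem v i
  have hμ := (hw.mem_tet _).1 hvi
  have key : ∑ j, ev (L' j) (v i) * (1 - ev (L i) (w j)) = 0 := by
    have h1 := ev_sum Finset.univ (fun j => ev (L' j) (v i)) w (hw.1 _) (L i)
    rw [hw.2.1, hv.2.2, if_pos rfl] at h1
    simp only [mul_sub, mul_one, Finset.sum_sub_distrib, hw.1]
    linarith
  have hwj : ∀ j, w j ∈ tet v := fun j => h ▸ vert_mem w j
  have hz := (Finset.sum_eq_zero_iff_of_nonneg (fun j _ => mul_nonneg (hμ j)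
    (by have := hv.le_one (hwj j) i; linarith))).1 key
  obtain ⟨j, hj⟩ : ∃ j, ev (L' j) (v i) ≠ 0 := by
    by_contra hcon
    push Not at hcon
    have := hw.1 (v i)
    simp [hcon] at this
  have h1 : ev (L i) (w j) = 1 := by
    rcases mul_eq_zero.1 (hz j (Finset.mem_univ j)) with h | h
    · exact absurd h hj
    · linarith
  refine ⟨j, ?_⟩
  have hnn := (hv.mem_tet _).1 (hwj j)
  have h0 : ∀ k, k ≠ i → ev (L k) (w j) = 0 := by
    intro k hk
    have hs := hv.1 (w j)
    rw [← Finset.add_sum_erase _ _ (Finset.mem_univ i), h1] at hs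
    have hs' : ∑ k ∈ Finset.univ.erase i, ev (L k) (w j) = 0 := by linarith
    exact (Finset.sum_eq_zero_iff_of_nonneg (fun k _ => hnn k)).1 hs' k
      (Finset.mem_erase.2 ⟨hk, Finset.mem_univ k⟩)
  rw [← hv.2.1 (w j), Finset.sum_eq_single i (fun k _ hk => by rw [h0 k hk, zero_smul]) (by simp),
    h1, one_smul]

lemma IsBary.inj {v : Fin 4 → E3} {L : Fin 4 → AF} (h : IsBary v L) : Function.Injective v := by
  intro i j hij
  by_contra hne
  have h1 := h.2.2 i i
  rw [hij, h.2.2 i j, if_neg hne] at h1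
  simp at h1

open Classical in
lemma ipol_eq_mu {r : ℕ} {v : Fin 4 → E3} {L : Fin 4 → AF} (hv : IsBary v L) (z : E3 → ℝ)
    {x : E3} {P0 P : Finset E3} {μ : E3 → ℝ} (hP : ∀ i, v i ∈ P) (hP0 : ∀ p ∈ P0, p ∈ range v)
    (h1 : ∑ p ∈ P0, μ p = 1) (hx : ∑ p ∈ P0, μ p • p = x) :
    ipol r v L z x = ∑ q ∈ Fintype.piFinset (fun _ : Fin r => P),
      cf r z q * ∏ i, (if q i ∈ P0 then μ (q i) else 0) := by
  have hL : ∀ i, ev (L i) x = if v i ∈ P0 then μ (v i) else 0 := by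
    intro i
    rw [← hx, ev_sum P0 μ (fun p => p) h1]
    have : ∀ p ∈ P0, μ p * ev (L i) p = if p = v i then μ (v i) else 0 := by
      intro p hp
      obtain ⟨j, rfl⟩ := hP0 p hp
      rw [hv.2.2]
      by_cases hij : i = j
      · simp [hij]
      · rw [if_neg hij, if_neg (fun h => hij (hv.inj h).symm), mul_zero]
    rw [Finset.sum_congr rfl this, Finset.sum_ite_eq']
  rw [ipol]
  apply Finset.sum_of_injOn (fun s : Fin r → Fin 4 => fun i => v (s i))
  · intro s _ t _ h
    funext i
    exact hv.inj (congrFun h i)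
  · intro s _
    simp [hP]
  · intro q _ hq
    obtain ⟨i, hi⟩ : ∃ i, q i ∉ range v := by
      by_contra hcon
      push Not at hcon
      choose s hs using hcon
      exact hq ⟨s, by simp, funext hs⟩
    rw [Finset.prod_eq_zero (Finset.mem_univ i), mul_zero]
    rw [if_neg]
    exact fun h => hi (hP0 _ h)
  · intro s _
    simp only [hL]

lemma Mesh.ipol_agree {c : ℝ} {Ω : Set E3} {T : Finset (Fin 4 → E3)} (h : Mesh c Ω T) (r : ℕ)
    (z : E3 → ℝ) {v w : Fin 4 → E3} (hv : v ∈ T) (hw : w ∈ T) {x : E3} (hxv : x ∈ tet v)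
    (hxw : x ∈ tet w) : ipol r v (lam v) z x = ipol r w (lam w) z x := by
  classical
  have bv := (h.tet1 hv).1
  have bw := (h.tet1 hw).1
  have hx : x ∈ convexHull ℝ (range v ∩ range w) := by
    by_cases hvw : tet v = tet w
    · have : range v = range w :=
        (range_sub bv bw hvw).antisymm (range_sub bw bv hvw.symm)
      rw [this, inter_self]
      exact hxw
    · rcases h.pt.2.2.2.1 v hv w hw hvw with h0 | h0
      · have : x ∈ tet v ∩ tet w := ⟨hxv, hxw⟩
        rw [h0] at this
        exact this.elim
      · rw [← h0]
        exact ⟨hxv, hxw⟩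
  have hfin : (range v ∩ range w).Finite := (finite_range v).inter_of_left _
  rw [← hfin.coe_toFinset, Finset.mem_convexHull'] at hx
  obtain ⟨μ, -, h1, h2⟩ := hx
  have hP : ∀ p ∈ hfin.toFinset, p ∈ range v ∧ p ∈ range w := by
    intro p hp
    simpa using hp
  rw [ipol_eq_mu (P := Finset.univ.image v ∪ Finset.univ.image w) bv z (by simp)
    (fun p hp => (hP p hp).1) h1 h2,
    ipol_eq_mu (P := Finset.univ.image v ∪ Finset.univ.image w) bw z (by simp)
    (fun p hp => (hP p hp).2) h1 h2]

def PW (r : ℕ) (Ω : Set E3) (T : Finset (Fin 4 → E3)) (f : E3 → ℝ) : Prop :=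
  (∀ x ∉ Ω, f x = 0) ∧ ∀ v ∈ T, ∃ p, Pol3 r p ∧ ∀ x ∈ tet v, f x = p x

lemma Mesh.cover {c : ℝ} {Ω : Set E3} {T : Finset (Fin 4 → E3)} (h : Mesh c Ω T) {x : E3}
    (hx : x ∈ closure Ω) : ∃ v ∈ T, x ∈ tet v := by
  rw [← h.pt.2.1] at hx
  simpa using hx

lemma Mesh.sub {c : ℝ} {Ω : Set E3} {T : Finset (Fin 4 → E3)} (h : Mesh c Ω T) {v : Fin 4 → E3}
    (hv : v ∈ T) : tet v ⊆ closure Ω := by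
  rw [← h.pt.2.1]
  exact subset_biUnion_of_mem (u := fun v => tet v) hv

lemma Mesh.lip {c : ℝ} {Ω : Set E3} {T : Finset (Fin 4 → E3)} (h : Mesh c Ω T) {r : ℕ}
    {f : E3 → ℝ} (hf : PW r Ω T f) : ∃ K, LipschitzWith K f := by
  have h1 : ∀ v : T, ∃ K, LipschitzOnWith K f (tet v.1) := by
    intro v
    obtain ⟨p, hp, hfp⟩ := hf.2 v.1 v.2
    obtain ⟨K, hK⟩ := (hp.contDiff 1).locallyLipschitz.locallyLipschitzOn
      |>.exists_lipschitzOnWith_of_compact (tet_compact v.1)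
    refine ⟨K, fun x hx y hy => ?_⟩
    rw [hfp x hx, hfp y hy]
    exact hK hx hy
  choose K hK using h1
  refine ⟨∑ v, K v, ?_⟩
  apply glue_lip (fun o : Option T => o.elim Ωᶜ (fun v => tet v.1))
  · rintro (_ | v)
    · exact h.op.isClosed_compl
    · exact (tet_compact v.1).isClosed
  · intro x
    by_cases hx : x ∈ Ω
    · obtain ⟨v, hv, hxv⟩ := h.cover (subset_closure hx)
      exact ⟨some ⟨v, hv⟩, hxv⟩
    · exact ⟨none, hx⟩
  · rintro (_ | v)
    · intro x hx y hy
      rw [hf.1 x hx, hf.1 y hy]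
      simp
    · exact (hK v).weaken (Finset.single_le_sum (f := K) (fun _ _ => zero_le) (Finset.mem_univ v))

lemma Mesh.memSh0 {c : ℝ} {Ω : Set E3} {T : Finset (Fin 4 → E3)} (h : Mesh c Ω T) {r : ℕ}
    {f : E3 → ℝ} (hf : PW r Ω T f) : MemSh0 Ω T r f := by
  obtain ⟨K, hK⟩ := h.lip hf
  refine ⟨⟨hK.continuous.continuousOn, ?_⟩, ?_⟩
  · intro v hv
    obtain ⟨p, hp, hfp⟩ := hf.2 v hv
    obtain ⟨P, hP, hPe⟩ := mv_of_pol3 hp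
    exact ⟨P, hP, fun x hx => by rw [hfp x hx, hPe]⟩
  · intro x hx
    apply hf.1
    rw [h.op.frontier_eq] at hx
    exact hx.2

open Classical in
def gI (r : ℕ) (T : Finset (Fin 4 → E3)) (z : E3 → ℝ) (x : E3) : ℝ :=
  if h : ∃ v ∈ T, x ∈ tet v then ipol r h.choose (lam h.choose) z x else 0

lemma Mesh.gI_eq {c : ℝ} {Ω : Set E3} {T : Finset (Fin 4 → E3)} (h : Mesh c Ω T) (r : ℕ)
    (z : E3 → ℝ) {v : Fin 4 → E3} (hv : v ∈ T) {x : E3} (hx : x ∈ tet v) :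
    gI r T z x = ipol r v (lam v) z x := by
  have h1 : ∃ v ∈ T, x ∈ tet v := ⟨v, hv, hx⟩
  rw [gI, dif_pos h1]
  exact h.ipol_agree r z h1.choose_spec.1 hv h1.choose_spec.2 hx

lemma Mesh.gI_pw {c : ℝ} {Ω : Set E3} {T : Finset (Fin 4 → E3)} (h : Mesh c Ω T) {r : ℕ}
    (hr : 1 ≤ r) {z : E3 → ℝ} (hz : ∀ x ∈ frontier Ω, z x = 0) : PW r Ω T (gI r T z) := by
  refine ⟨fun x hx => ?_, fun v hv => ⟨_, ipol_pol r v (lam v) z, fun x hxv => h.gI_eq r z hv hxv⟩⟩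
  by_cases hxc : x ∈ closure Ω
  swap
  · rw [gI, dif_neg]
    rintro ⟨v, hv, hxv⟩
    exact hxc (h.sub hv hxv)
  obtain ⟨v, hv, hxv⟩ := h.cover hxc
  rw [h.gI_eq r z hv hxv]
  obtain ⟨f, hf⟩ := geometric_hahn_banach_open_point h.cv h.op hx
  have hfc : ∀ y ∈ closure Ω, f y ≤ f x := fun y hy =>
    closure_minimal (fun y hy => (hf y hy).le) (isClosed_le f.continuous continuous_const) hy
  have b := (h.tet1 hv).1
  have hnn := (b.mem_tet x).1 hxv
  have hvc : ∀ i, v i ∈ closure Ω := fun i => h.sub hv (vert_mem v i)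
  have key : ∀ i, ev (lam v i) x ≠ 0 → f (v i) = f x := by
    have h1 : ∑ i, ev (lam v i) x * (f x - f (v i)) = 0 := by
      simp only [mul_sub, Finset.sum_sub_distrib]
      rw [← Finset.sum_mul, b.1, one_mul]
      have h2 := congrArg f (b.2.1 x)
      simp only [map_sum, map_smul, smul_eq_mul] at h2
      rw [h2, sub_self]
    intro i hi
    have := (Finset.sum_eq_zero_iff_of_nonneg (fun i _ => mul_nonneg (hnn i)
      (sub_nonneg.2 (hfc _ (hvc i))))).1 h1 i (Finset.mem_univ i)
    rcases mul_eq_zero.1 this with h | h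
    · exact absurd h hi
    · linarith
  rw [ipol]
  apply Finset.sum_eq_zero
  intro s _
  by_cases hs : ∀ i, ev (lam v (s i)) x ≠ 0
  swap
  · push Not at hs
    obtain ⟨i, hi⟩ := hs
    rw [Finset.prod_eq_zero (Finset.mem_univ i) hi, mul_zero]
  rw [cf, Finset.sum_eq_zero, mul_zero, zero_mul]
  intro S _
  rcases S.eq_empty_or_nonempty with rfl | hS
  · simp; left; omega
  rw [hz, mul_zero]
  have hcard : (S.card : ℝ) ≠ 0 := by simpa using hS.ne_empty
  have hmem : ((S.card : ℝ)⁻¹ • ∑ i ∈ S, v (s i)) ∈ closure Ω := by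
    rw [Finset.smul_sum]
    apply h.cv.closure.sum_mem (fun _ _ => by positivity)
    · simp [hcard]
    · exact fun i _ => hvc _
  rw [h.op.frontier_eq]
  refine ⟨hmem, fun hcon => ?_⟩
  have h2 := hf _ hcon
  rw [map_smul, map_sum, Finset.sum_congr rfl (fun i _ => key (s i) (hs i))] at h2
  simp [hcard] at h2

lemma tet_ae_int (v : Fin 4 → E3) : ∀ᵐ x ∂volume.restrict (tet v), x ∈ interior (tet v) := by
  rw [ae_restrict_iff' (tet_compact v).measurableSet]
  have := (tet_convex v).addHaar_frontier volume
  have h2 : ∀ᵐ x ∂(volume : Measure E3), x ∉ frontier (tet v) := measure_eq_zero_iff_ae_notMem.1 this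
  filter_upwards [h2] with x hx hxv
  by_contra h
  exact hx ⟨subset_closure hxv, h⟩

lemma fderiv_eq_tet {v : Fin 4 → E3} {f p : E3 → ℝ} (h : ∀ x ∈ tet v, f x = p x) {x : E3}
    (hx : x ∈ interior (tet v)) : fderiv ℝ f x = fderiv ℝ p x := by
  apply Filter.EventuallyEq.fderiv_eq
  filter_upwards [isOpen_interior.mem_nhds hx] with y hy
  exact h y (interior_subset hy)

lemma Mesh.sum_le {c : ℝ} {Ω : Set E3} {T : Finset (Fin 4 → E3)} (h : Mesh c Ω T) {G H : E3 → ℝ}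
    (hG : IntegrableOn G (closure Ω)) (hH : IntegrableOn H (closure Ω))
    (hle : ∀ v ∈ T, |∫ x in tet v, G x| ≤ ∫ x in tet v, H x) :
    |∫ x in Ω, G x| ≤ ∫ x in Ω, H x := by
  classical
  obtain ⟨T', hT', hb⟩ := exists_subset_bijOn (T : Set (Fin 4 → E3)) tet
  have hfin : Finite T' := (T.finite_toSet.subset hT').to_subtype
  have := Fintype.ofFinite T'
  have hun : closure Ω = ⋃ v : T', tet v.1 := by
    rw [← h.pt.2.1]
    ext x
    simp only [mem_iUnion, exists_prop]
    constructor
    · rintro ⟨v, hv, hx⟩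
      have : tet v ∈ tet '' (T : Set (Fin 4 → E3)) := ⟨v, hv, rfl⟩
      rw [← hb.image_eq] at this
      obtain ⟨w, hw, hwv⟩ := this
      exact ⟨⟨w, hw⟩, hwv ▸ hx⟩
    · rintro ⟨v, hx⟩
      exact ⟨v.1, hT' v.2, hx⟩
  have hdis : Pairwise (Function.onFun (AEDisjoint volume) (fun v : T' => tet v.1)) := by
    intro v w hvw
    have hne : tet v.1 ≠ tet w.1 := fun h => hvw (Subtype.ext (hb.injOn v.2 w.2 h))
    have hi := h.pt.2.2.1 v.1 (hT' v.2) w.1 (hT' w.2) hne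
    have : tet v.1 ∩ tet w.1 ⊆ frontier (tet v.1) ∪ frontier (tet w.1) := by
      rintro x ⟨h1, h2⟩
      by_contra hcon
      simp only [mem_union, not_or] at hcon
      have : x ∈ interior (tet v.1) ∩ interior (tet w.1) :=
        ⟨by_contra fun h => hcon.1 ⟨subset_closure h1, h⟩,
          by_contra fun h => hcon.2 ⟨subset_closure h2, h⟩⟩
      rw [hi] at this
      exact this
    exact measure_mono_null this (measure_union_null ((tet_convex v.1).addHaar_frontier volume)
      ((tet_convex w.1).addHaar_frontier volume))
  have hae : (Ω : Set E3) =ᵐ[volume] closure Ω :=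
    (closure_ae_eq_of_null_frontier (h.cv.addHaar_frontier volume)).symm
  have hsum : ∀ F : E3 → ℝ, IntegrableOn F (closure Ω) →
      ∫ x in Ω, F x = ∑ v : T', ∫ x in tet v.1, F x := by
    intro F hF
    have h1 := integral_iUnion_ae (s := fun v : T' => tet v.1) (f := F) (μ := volume)
      (fun v => (tet_compact v.1).measurableSet.nullMeasurableSet) hdis (hun ▸ hF)
    rw [setIntegral_congr_set hae, hun, h1, tsum_fintype]
  rw [hsum G hG, hsum H hH]
  refine (Finset.abs_sum_le_sum_abs _ _).trans (Finset.sum_le_sum ?_)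
  intro v _
  have hm : v.1 ∈ T := Finset.mem_coe.1 (hT' v.2)
  exact hle v.1 hm

def al (k : ℝ) (x : E3) : ℝ := (‖x‖ ^ 2 + k ^ 2)⁻¹
def wq (k R : ℝ) (x : E3) : ℝ := √(al k x) * (R ^ 2 * al R x) ^ 2

lemma al_pos {k : ℝ} (hk : 1 ≤ k) (x : E3) : 0 < al k x := by unfold al; positivity

lemma al_le {k : ℝ} (hk : 1 ≤ k) (x : E3) : al k x ≤ (k ^ 2)⁻¹ := by
  unfold al; gcongr; nlinarith [norm_nonneg x]

lemma al_mul {k : ℝ} (hk : 1 ≤ k) (x : E3) : ‖x‖ ^ 2 * al k x = 1 - k ^ 2 * al k x := by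
  unfold al; field_simp; ring

lemma al_nrm {k : ℝ} (hk : 1 ≤ k) (x : E3) : ‖x‖ * al k x ≤ 1 / (2 * k) := by
  have : 0 < k := by linarith
  unfold al
  rw [← div_eq_mul_inv, div_le_div_iff₀ (by positivity) (by positivity)]
  nlinarith [sq_nonneg (‖x‖ - k)]

lemma al_comp {k : ℝ} (hk : 1 ≤ k) {x y : E3} (h : dist x y ≤ 1) : al k x ≤ 3 * al k y := by
  have h1 : ‖y‖ ≤ ‖x‖ + 1 := by
    have := norm_sub_norm_le y x
    rw [dist_comm, dist_eq_norm] at h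
    linarith
  unfold al
  rw [← div_eq_mul_inv, inv_eq_one_div, div_le_div_iff₀ (by positivity) (by positivity)]
  nlinarith [norm_nonneg x, norm_nonneg y, sq_nonneg (‖x‖ - 1)]

lemma wq_pos {k R : ℝ} (hk : 1 ≤ k) (hR : 1 ≤ R) (x : E3) : 0 < wq k R x := by
  have := al_pos hk x
  have := al_pos hR x
  unfold wq; positivity

lemma wq_le {k R : ℝ} (hk : 1 ≤ k) (hR : 1 ≤ R) (x : E3) : wq k R x ≤ 1 := by
  have h1 := al_le hk x
  have h2 := al_le hR x
  have h3 : (k ^ 2)⁻¹ ≤ 1 := inv_le_one_of_one_le₀ (by nlinarith)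
  have h4 : √(al k x) ≤ 1 := Real.sqrt_le_one.2 (by linarith)
  have h5 : R ^ 2 * al R x ≤ 1 := by
    calc _ ≤ R ^ 2 * (R ^ 2)⁻¹ := by gcongr
      _ = 1 := mul_inv_cancel₀ (by positivity)
  have h6 : 0 ≤ R ^ 2 * al R x := by have := al_pos hR x; positivity
  unfold wq
  exact mul_le_one₀ h4 (by positivity) (pow_le_one₀ h6 h5)

lemma wq_comp {k R : ℝ} (hk : 1 ≤ k) (hR : 1 ≤ R) {x y : E3} (h : dist x y ≤ 1) :
    wq k R x ≤ 18 * wq k R y := by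
  have h1 := al_comp hk h
  have h2 := al_comp hR h
  have h3 : √(al k x) ≤ 2 * √(al k y) := by
    rw [show (2 : ℝ) * √(al k y) = √(4 * al k y) by
      rw [Real.sqrt_mul (by norm_num), show (4 : ℝ) = 2 ^ 2 by norm_num, Real.sqrt_sq (by norm_num)]]
    apply Real.sqrt_le_sqrt
    have := al_pos hk y
    linarith
  have := al_pos hR x
  have := al_pos hR y
  unfold wq
  calc _ ≤ (2 * √(al k y)) * (R ^ 2 * (3 * al R y)) ^ 2 := by gcongr
    _ = _ := by ring

lemma hasFDerivAt_al {k : ℝ} (hk : 1 ≤ k) (x : E3) :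
    HasFDerivAt (al k) (-(2 * al k x ^ 2) • innerSL ℝ x) x := by
  have h1 : HasFDerivAt (fun x : E3 => ‖x‖ ^ 2 + k ^ 2) ((2 : ℝ) • innerSL ℝ x) x := by
    refine HasFDerivAt.congr_fderiv ((hasStrictFDerivAt_norm_sq x).hasFDerivAt.add_const (k ^ 2)) ?_
    rw [two_smul, two_smul]
  have h2 := (hasDerivAt_inv (x := ‖x‖ ^ 2 + k ^ 2) (by positivity)).comp_hasFDerivAt x h1
  refine HasFDerivAt.congr_fderiv (f := al k) h2 ?_
  rw [smul_smul]
  congr 1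
  unfold al
  field_simp

lemma hasFDerivAt_wq {k R : ℝ} (hk : 1 ≤ k) (hR : 1 ≤ R) (x : E3) :
    HasFDerivAt (wq k R) (-(wq k R x * (al k x + 4 * al R x)) • innerSL ℝ x) x := by
  have h0 := al_pos hk x
  have h1 := (hasFDerivAt_al hk x).sqrt h0.ne'
  have h2 := ((hasFDerivAt_al hR x).const_mul (R ^ 2)).pow 2
  have h3 := h1.mul h2
  refine HasFDerivAt.congr_fderiv (f := wq k R) h3 ?_
  have hs : √(al k x) ≠ 0 := (Real.sqrt_pos.2 h0).ne'
  have hs2 : al k x = √(al k x) ^ 2 := (Real.sq_sqrt h0.le).symm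
  simp only [smul_smul, ← add_smul]
  congr 1
  unfold wq
  set t := √(al k x)
  rw [hs2]
  field_simp
  simp
  ring

lemma pd_wq {k R : ℝ} (hk : 1 ≤ k) (hR : 1 ≤ R) (i : Fin 3) :
    pd i (wq k R) = fun x => -(wq k R x * (al k x + 4 * al R x)) * x i := by
  funext x
  rw [pd, (hasFDerivAt_wq hk hR x).fderiv]
  simp [bs, EuclideanSpace.inner_single_right]

lemma hasFDerivAt_pd_wq {k R : ℝ} (hk : 1 ≤ k) (hR : 1 ≤ R) (i : Fin 3) (x : E3) :
    HasFDerivAt (pd i (wq k R)) (wq k R x • ((((al k x + 4 * al R x) ^ 2 + 2 * al k x ^ 2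
      + 8 * al R x ^ 2) * x i) • innerSL ℝ x - (al k x + 4 * al R x) •
      (EuclideanSpace.proj i : E3 →L[ℝ] ℝ))) x := by
  rw [pd_wq hk hR i]
  have h1 := ((hasFDerivAt_wq hk hR x).mul ((hasFDerivAt_al hk x).add
    ((hasFDerivAt_al hR x).const_mul 4))).neg.mul
    (EuclideanSpace.proj i : E3 →L[ℝ] ℝ).hasFDerivAt
  refine HasFDerivAt.congr_fderiv h1 ?_
  ext y
  simp
  ring

lemma lap_wq {k R : ℝ} (hk : 1 ≤ k) (hR : 1 ≤ R) (x : E3) :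
    ∑ i, pd i (pd i (wq k R)) x ≤ wq k R x * (-3 * k ^ 2 * al k x ^ 2 + 20 * al R x) := by
  have hx : ‖x‖ ^ 2 = x 0 ^ 2 + x 1 ^ 2 + x 2 ^ 2 := by
    rw [EuclideanSpace.norm_sq_eq, Fin.sum_univ_three]; simp
  have e : ∑ i, pd i (pd i (wq k R)) x = wq k R x * (‖x‖ ^ 2 * ((al k x + 4 * al R x) ^ 2
      + 2 * al k x ^ 2 + 8 * al R x ^ 2) - 3 * (al k x + 4 * al R x)) := by
    rw [Fin.sum_univ_three, hx]
    unfold pd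
    have := fun i => (hasFDerivAt_pd_wq hk hR i x).fderiv
    unfold pd at this
    rw [this, this, this]
    simp [bs, EuclideanSpace.inner_single_right]
    ring
  rw [e]
  apply mul_le_mul_of_nonneg_left _ (wq_pos hk hR x).le
  have h1 := al_mul hk x
  have h2 := al_mul hR x
  have h3 := al_pos hk x
  have h4 := al_pos hR x
  have h5 : ‖x‖ ^ 2 * al k x * al R x ≤ al R x := by rw [h1]; nlinarith [sq_nonneg k, mul_pos h3 h4]
  have h6 : ‖x‖ ^ 2 * al R x * al R x ≤ al R x := by rw [h2]; nlinarith [sq_nonneg R, mul_pos h4 h4]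
  have h7 : ‖x‖ ^ 2 * al k x * al k x = al k x - k ^ 2 * al k x ^ 2 := by rw [h1]; ring
  nlinarith

lemma innerSL_norm_le (x : E3) : ‖innerSL ℝ x‖ ≤ ‖x‖ := by simp

lemma fderiv_wq_le {k R : ℝ} (hk : 1 ≤ k) (hR : k ≤ R) (x : E3) :
    ‖fderiv ℝ (wq k R) x‖ ≤ 3 * wq k R x / k := by
  have hR1 : 1 ≤ R := hk.trans hR
  rw [(hasFDerivAt_wq hk hR1 x).fderiv, norm_smul, innerSL_apply_norm]
  have h0 := wq_pos hk hR1 x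
  have h3 := al_pos hk x
  have h4 := al_pos hR1 x
  rw [norm_neg, Real.norm_of_nonneg (by positivity)]
  have h1 := al_nrm hk x
  have h2 := al_nrm hR1 x
  have h5 : 1 / (2 * R) ≤ 1 / (2 * k) := by gcongr
  have h6 : (3 : ℝ) / k = 6 * (1 / (2 * k)) := by field_simp; norm_num
  have h7 : 0 < 1 / (2 * k) := by positivity
  calc _ = wq k R x * (‖x‖ * al k x + 4 * (‖x‖ * al R x)) := by ring
    _ ≤ wq k R x * (3 / k) := by gcongr; linarith
    _ = _ := by ring

lemma fderiv_pd_wq_le {k R : ℝ} (hk : 1 ≤ k) (hR : 1 ≤ R) (i : Fin 3) (x : E3) :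
    ‖fderiv ℝ (pd i (wq k R)) x‖ ≤ 36 * (wq k R x * (al k x + al R x)) := by
  rw [(hasFDerivAt_pd_wq hk hR i x).fderiv, norm_smul]
  have h0 := wq_pos hk hR x
  have h3 := al_pos hk x
  have h4 := al_pos hR x
  have hxi : |x i| ≤ ‖x‖ := by simpa using PiLp.norm_apply_le x i
  have hp : ‖(EuclideanSpace.proj i : E3 →L[ℝ] ℝ)‖ ≤ 1 := by
    apply ContinuousLinearMap.opNorm_le_bound _ zero_le_one
    intro y
    simpa using PiLp.norm_apply_le y i
  have h1 := al_mul hk x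
  have h2 := al_mul hR x
  have h5 : ‖x‖ ^ 2 * al k x * al R x ≤ al R x := by rw [h1]; nlinarith [sq_nonneg k, mul_pos h3 h4]
  have h6 : ‖x‖ ^ 2 * al R x * al R x ≤ al R x := by rw [h2]; nlinarith [sq_nonneg R, mul_pos h4 h4]
  have h7 : ‖x‖ ^ 2 * al k x * al k x ≤ al k x := by rw [h1]; nlinarith [sq_nonneg k, mul_pos h3 h3]
  rw [Real.norm_of_nonneg h0.le]
  calc _ ≤ wq k R x * (((al k x + 4 * al R x) ^ 2 + 2 * al k x ^ 2
      + 8 * al R x ^ 2) * ‖x‖ * ‖x‖ + (al k x + 4 * al R x) * 1) := by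
        gcongr
        refine (norm_sub_le _ _).trans ?_
        rw [norm_smul, norm_smul, innerSL_apply_norm, norm_mul, Real.norm_eq_abs (x i),
          Real.norm_of_nonneg (by positivity), Real.norm_of_nonneg (by positivity)]
        gcongr
    _ ≤ wq k R x * (36 * (al k x + al R x)) := by
        gcongr
        nlinarith
    _ = _ := by ring

lemma wq_contDiff {k R : ℝ} (hk : 1 ≤ k) (hR : 1 ≤ R) : ContDiff ℝ 2 (wq k R) := by
  have h : ∀ k : ℝ, 1 ≤ k → ContDiff ℝ 2 (al k) := fun k hk =>
    ContDiff.inv ((contDiff_norm_sq ℝ).add contDiff_const) (fun x => by positivity)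
  exact ((h k hk).sqrt (fun x => (al_pos hk x).ne')).mul ((contDiff_const.mul (h R hR)).pow 2)

lemma Tet1.mvt {c : ℝ} {v : Fin 4 → E3} {L : Fin 4 → AF} (h : Tet1 c v L) {f : E3 → ℝ} {B : ℝ}
    (hf : Differentiable ℝ f) (hB : ∀ x ∈ tet v, ‖fderiv ℝ f x‖ ≤ B) {x y : E3} (hx : x ∈ tet v)
    (hy : y ∈ tet v) : |f x - f y| ≤ B := by
  have := Convex.norm_image_sub_le_of_norm_fderiv_le (f := f) (𝕜 := ℝ) (fun x _ => hf x) hB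
    (tet_convex v) hy hx
  rw [← dist_eq_norm x y] at this
  have h0 : 0 ≤ B := (norm_nonneg _).trans (hB x hx)
  exact this.trans (mul_le_of_le_one_right h0 (h.dist_le hx hy))

lemma ipol_congr {r : ℕ} (hr : 1 ≤ r) {v : Fin 4 → E3} {L : Fin 4 → AF} (h : IsBary v L)
    {z w : E3 → ℝ} (hzw : ∀ x ∈ tet v, z x = w x) {x : E3} (hx : x ∈ tet v) :
    ipol r v L z x = ipol r v L w x := by
  have h1 := ipol_le hr h (z := fun x => z x + (-1) * w x) (B := 0)
    (fun x hx => by rw [hzw x hx]; simp) hx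
  rw [ipol_add r v L z (fun x => (-1) * w x), ipol_smul] at h1
  simp only [mul_zero, abs_nonpos_iff] at h1
  linarith

lemma superapprox {r : ℕ} (hr : 1 ≤ r) {c : ℝ} (hc : 0 < c) {v : Fin 4 → E3} {L : Fin 4 → AF}
    (h : Tet1 c v L) {p q : E3 → ℝ} (hp : Pol3 r p) (hq : Differentiable ℝ q) {x0 : E3}
    (hx0 : x0 ∈ tet v) {Lq Q D B : ℝ} (h1 : ∀ x ∈ tet v, ‖fderiv ℝ q x‖ ≤ Lq)
    (h2 : ∀ x ∈ tet v, ‖fderiv ℝ q x - fderiv ℝ q x0‖ ≤ Q)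
    (h3 : ∀ x ∈ tet v, ‖fderiv ℝ p x‖ ≤ D) (h4 : ∀ x ∈ tet v, |p x| ≤ B) {x : E3}
    (hx : x ∈ tet v) :
    ‖fderiv ℝ (fun y => q y * p y) x - fderiv ℝ (ipol r v L (fun y => q y * p y)) x‖
      ≤ (2 + Ci r c) * (Lq * D + Q * B) := by
  have hpd := hp.diff
  have hCi := Ci_nonneg r hc
  have hLq : 0 ≤ Lq := (norm_nonneg _).trans (h1 x hx)
  have hQ : 0 ≤ Q := (norm_nonneg _).trans (h2 x hx)
  have hD : 0 ≤ D := (norm_nonneg _).trans (h3 x hx)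
  have hB : 0 ≤ B := (abs_nonneg _).trans (h4 x hx)
  set f1 : E3 → ℝ := fun y => (q y - q x0) * (p y - p x0) with hf1
  set l : E3 → ℝ := fun y => fderiv ℝ q x0 y + (q x0 - fderiv ℝ q x0 x0) with hl
  have hlp : Pol3 r l := Pol3.lin hr (fderiv ℝ q x0, q x0 - fderiv ℝ q x0 x0)
  set t : E3 → ℝ := fun y => q y - l y with ht
  set g : E3 → ℝ := fun y => p x0 * l y + (q x0 * p y + (-(q x0 * p x0))) with hg
  have hgp : Pol3 r g := (hlp.smul (p x0)).add ((hp.smul (q x0)).add (Pol3.const hr _))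
  have hgd := hgp.diff
  have hfl : ∀ y, HasFDerivAt l (fderiv ℝ q x0) y := fun y =>
    (fderiv ℝ q x0).hasFDerivAt.add_const _
  have hft : ∀ y, HasFDerivAt t (fderiv ℝ q y - fderiv ℝ q x0) y := fun y =>
    (hq y).hasFDerivAt.sub (hfl y)
  have htd : Differentiable ℝ t := fun y => (hft y).differentiableAt
  have hff : ∀ y, HasFDerivAt f1 ((q y - q x0) • fderiv ℝ p y + (p y - p x0) • fderiv ℝ q y) y :=
    fun y => ((hq y).hasFDerivAt.sub_const _).mul ((hpd y).hasFDerivAt.sub_const _)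
  have hfd : Differentiable ℝ f1 := fun y => (hff y).differentiableAt
  have hdec : (fun y => q y * p y) = fun y => f1 y + (p x0 * t y + g y) := by
    funext y
    simp only [hf1, ht, hg]
    ring
  have hqx : ∀ y ∈ tet v, |q y - q x0| ≤ Lq := fun y hy => h.mvt hq h1 hy hx0
  have hpx : ∀ y ∈ tet v, |p y - p x0| ≤ D := fun y hy => h.mvt hpd h3 hy hx0
  have bt : ∀ y ∈ tet v, |t y| ≤ Q := by
    intro y hy
    have := h.mvt htd (fun x hx => by rw [(hft x).fderiv]; exact h2 x hx) hy hx0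
    simpa [ht, hl] using this
  have bf : ∀ y ∈ tet v, |f1 y| ≤ Lq * D := by
    intro y hy
    rw [hf1, abs_mul]
    exact mul_le_mul (hqx y hy) (hpx y hy) (abs_nonneg _) hLq
  have b1 := fderiv_ipol_le hr hc h bf hx
  have b2 := fderiv_ipol_le hr hc h bt hx
  have hid : ∀ z, Differentiable ℝ (ipol r v L z) := fun z => (ipol_pol r v L z).diff
  have hI : ipol r v L (fun y => q y * p y) =
      fun y => ipol r v L f1 y + (p x0 * ipol r v L t y + g y) := by
    rw [hdec]
    funext y
    rw [ipol_add r v L f1 (fun y => p x0 * t y + g y),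
      ipol_add r v L (fun y => p x0 * t y) g, ipol_smul, ipol_poly hr h.1 hgp]
  have d1 : HasFDerivAt (fun y => f1 y + (p x0 * t y + g y)) _ x :=
    (hff x).add (((hft x).const_mul (p x0)).add (hgd x).hasFDerivAt)
  have d2 : HasFDerivAt (fun y => ipol r v L f1 y + (p x0 * ipol r v L t y + g y)) _ x :=
    (hid f1 x).hasFDerivAt.add (((hid t x).hasFDerivAt.const_mul (p x0)).add (hgd x).hasFDerivAt)
  rw [hI, hdec, d1.fderiv, d2.fderiv]
  have e : (q x - q x0) • fderiv ℝ p x + (p x - p x0) • fderiv ℝ q x +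
      (p x0 • (fderiv ℝ q x - fderiv ℝ q x0) + fderiv ℝ g x) -
      (fderiv ℝ (ipol r v L f1) x + (p x0 • fderiv ℝ (ipol r v L t) x + fderiv ℝ g x)) =
      ((q x - q x0) • fderiv ℝ p x + (p x - p x0) • fderiv ℝ q x - fderiv ℝ (ipol r v L f1) x) +
      p x0 • ((fderiv ℝ q x - fderiv ℝ q x0) - fderiv ℝ (ipol r v L t) x) := by
    module
  rw [e]
  have n1 : ‖(q x - q x0) • fderiv ℝ p x + (p x - p x0) • fderiv ℝ q x‖ ≤ Lq * D + D * Lq := by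
    refine (norm_add_le _ _).trans ?_
    rw [norm_smul, norm_smul]
    exact add_le_add (mul_le_mul (hqx x hx) (h3 x hx) (norm_nonneg _) hLq)
      (mul_le_mul (hpx x hx) (h1 x hx) (norm_nonneg _) hD)
  have n2 : ‖p x0 • ((fderiv ℝ q x - fderiv ℝ q x0) - fderiv ℝ (ipol r v L t) x)‖
      ≤ B * (Q + Ci r c * Q) := by
    rw [norm_smul]
    exact mul_le_mul (h4 x0 hx0) ((norm_sub_le _ _).trans (add_le_add (h2 x hx) b2))
      (norm_nonneg _) hB
  calc _ ≤ (Lq * D + D * Lq) + Ci r c * (Lq * D) + B * (Q + Ci r c * Q) :=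
        (norm_add_le _ _).trans (add_le_add ((norm_sub_le _ _).trans (add_le_add n1 b1)) n2)
    _ ≤ _ := by nlinarith [mul_nonneg hQ hB]

lemma dual_norm (f : E3 →L[ℝ] ℝ) : ‖f‖ ^ 2 ≤ ∑ i, f (bs i) ^ 2 := by
  have h0 : 0 ≤ ∑ i, f (bs i) ^ 2 := Finset.sum_nonneg fun i _ => sq_nonneg _
  have : ‖f‖ ≤ √(∑ i, f (bs i) ^ 2) := by
    apply ContinuousLinearMap.opNorm_le_bound _ (Real.sqrt_nonneg _)
    intro y
    have hy : f y = ∑ i, f (bs i) * y i := by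
      conv_lhs => rw [← (EuclideanSpace.basisFun (Fin 3) ℝ).sum_repr y]
      simp [bs, mul_comm]
    rw [hy, EuclideanSpace.norm_eq, ← Real.sqrt_mul h0]
    apply Real.abs_le_sqrt
    simpa using Finset.sum_mul_sq_le_sq_mul_sq Finset.univ (fun i => f (bs i)) (fun i => y i)
  calc _ ≤ √(∑ i, f (bs i) ^ 2) ^ 2 := by gcongr
    _ = _ := Real.sq_sqrt h0

def CW (r : ℕ) (c : ℝ) : ℝ := 3 * (2 + Ci r c) * 3888 * C2 r c * (162 * (1 + Ci r c))

lemma C2_nonneg (r : ℕ) {c : ℝ} (hc : 0 < c) : 0 ≤ C2 r c := by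
  have := Ci_nonneg r hc; unfold C2; positivity

lemma CW_nonneg (r : ℕ) {c : ℝ} (hc : 0 < c) : 0 ≤ CW r c := by
  have := Ci_nonneg r hc; have := C2_nonneg r hc; unfold CW; positivity

lemma al_cont (k : ℝ) (hk : 1 ≤ k) : Continuous (al k) := by
  unfold al
  exact Continuous.inv₀ (by fun_prop) (fun x => by positivity)

lemma we_arith {k R q0 a0 b0 D B V Ci0 C20 I1 I2 I3 J1 J2 : ℝ} (hkp : 0 < k) (hRp : 0 < R)
    (q00 : 0 < q0) (a00 : 0 < a0) (b00 : 0 < b0) (hD0 : 0 ≤ D) (hB0 : 0 ≤ B) (hV0 : 0 ≤ V)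
    (hCi : 0 ≤ Ci0) (hC2 : 0 ≤ C20) (p1 : 0 ≤ I1) (p2 : 0 ≤ I2) (p3 : 0 ≤ I3)
    (hb0 : b0 ≤ (R ^ 2)⁻¹) (hDB : D ≤ Ci0 * B) (hVD : V * D ^ 2 ≤ C20 * J1)
    (hVB : V * B ^ 2 ≤ C20 * J2) (i1 : q0 * J1 ≤ 18 * I1) (i2 : q0 * J2 ≤ 18 * I2)
    (i3 : q0 * a0 ^ 2 * J2 ≤ 162 * I3) :
    3 * (D * ((2 + Ci0) * (54 * q0 / k * D + 3888 * (q0 * (a0 + b0)) * B))) * V ≤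
      3 * (2 + Ci0) * 3888 * C20 * (162 * (1 + Ci0)) *
        (k⁻¹ * (I1 + k ^ 2 * I3) + (R ^ 2)⁻¹ * I2) := by
  have y1 : a0 * D * B ≤ k⁻¹ * (D ^ 2 + k ^ 2 * (a0 ^ 2 * B ^ 2)) := by
    rw [inv_mul_eq_div, le_div_iff₀ hkp]
    nlinarith [sq_nonneg (D - k * a0 * B), sq_nonneg D, sq_nonneg (k * a0 * B)]
  have y2 : b0 * D * B ≤ (R ^ 2)⁻¹ * (Ci0 * B ^ 2) := by
    calc _ ≤ (R ^ 2)⁻¹ * (Ci0 * B) * B := by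
          gcongr
      _ = _ := by ring
  have y3 : 3 * (D * ((2 + Ci0) * (54 * q0 / k * D + 3888 * (q0 * (a0 + b0)) * B))) * V ≤ 3 * (2 + Ci0) * 3888 * (q0 * V * (k⁻¹ * (2 * D ^ 2 +
      k ^ 2 * (a0 ^ 2 * B ^ 2)) + (R ^ 2)⁻¹ * (Ci0 * B ^ 2))) := by
    have : 3 * (D * ((2 + Ci0) * (54 * q0 / k * D + 3888 * (q0 * (a0 + b0)) * B))) * V = 3 * (2 + Ci0) * (q0 * V * (54 * (k⁻¹ * D ^ 2) +
        3888 * (a0 * D * B + b0 * D * B))) := by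
      field_simp
    rw [this, mul_assoc (3 * (2 + Ci0)) 3888]
    apply mul_le_mul_of_nonneg_left _ (by positivity)
    rw [mul_left_comm 3888]
    apply mul_le_mul_of_nonneg_left _ (by positivity)
    have : 0 ≤ k⁻¹ * D ^ 2 := by positivity
    nlinarith
  refine y3.trans ?_
  have z1 : q0 * V * D ^ 2 ≤ C20 * (18 * I1) := by
    calc _ = q0 * (V * D ^ 2) := by ring
      _ ≤ q0 * (C20 * J1) := by gcongr
      _ = C20 * (q0 * J1) := by ring
      _ ≤ _ := by gcongr
  have z2 : q0 * V * B ^ 2 ≤ C20 * (18 * I2) := by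
    calc _ = q0 * (V * B ^ 2) := by ring
      _ ≤ q0 * (C20 * J2) := by gcongr
      _ = C20 * (q0 * J2) := by ring
      _ ≤ _ := by gcongr
  have z3 : q0 * V * (a0 ^ 2 * B ^ 2) ≤ C20 * (162 * I3) := by
    calc _ = q0 * a0 ^ 2 * (V * B ^ 2) := by ring
      _ ≤ q0 * a0 ^ 2 * (C20 * J2) := by gcongr
      _ = C20 * (q0 * a0 ^ 2 * J2) := by ring
      _ ≤ _ := by gcongr
  calc _ = 3 * (2 + Ci0) * 3888 * (k⁻¹ * (2 * (q0 * V * D ^ 2) +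
      k ^ 2 * (q0 * V * (a0 ^ 2 * B ^ 2))) + (R ^ 2)⁻¹ * (Ci0 * (q0 * V * B ^ 2))) := by
        ring
    _ ≤ 3 * (2 + Ci0) * 3888 * (k⁻¹ * (2 * (C20 * (18 * I1)) +
      k ^ 2 * (C20 * (162 * I3))) + (R ^ 2)⁻¹ * (Ci0 * (C20 * (18 * I2)))) := by gcongr
    _ = 3 * (2 + Ci0) * 3888 * C20 * (k⁻¹ * (36 * I1 + k ^ 2 * (162 * I3)) +
      (R ^ 2)⁻¹ * (18 * Ci0 * I2)) := by ring
    _ ≤ 3 * (2 + Ci0) * 3888 * C20 * (k⁻¹ * (162 * (1 + Ci0) * I1 +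
      k ^ 2 * (162 * (1 + Ci0) * I3)) + (R ^ 2)⁻¹ * (162 * (1 + Ci0) * I2)) := by
        have t1 : 36 * I1 ≤ 162 * (1 + Ci0) * I1 := by
          have := mul_nonneg hCi p1; clear * - this p1; linarith
        have t2 : 162 * I3 ≤ 162 * (1 + Ci0) * I3 := by
          have := mul_nonneg hCi p3; clear * - this p3; linarith
        have t3 : 18 * Ci0 * I2 ≤ 162 * (1 + Ci0) * I2 := by
          have := mul_nonneg hCi p2; clear * - this p2; linarith
        gcongr
    _ = _ := by ring

set_option maxHeartbeats 1000000 in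
lemma we_local {r : ℕ} (hr : 1 ≤ r) {c : ℝ} (hc : 0 < c) {v : Fin 4 → E3} {L : Fin 4 → AF}
    (h : Tet1 c v L) {p : E3 → ℝ} (hp : Pol3 r p) {k R : ℝ} (hk : 1 ≤ k) (hR : k ≤ R) :
    |∫ x in tet v, ∑ i, pd i p x * (pd i (fun y => wq k R y * p y) x -
      pd i (ipol r v L (fun y => wq k R y * p y)) x)| ≤
    ∫ x in tet v, CW r c * (k⁻¹ * (wq k R x * ∑ i, pd i p x ^ 2 +
      k ^ 2 * (wq k R x * al k x ^ 2 * p x ^ 2)) + (R ^ 2)⁻¹ * (wq k R x * p x ^ 2)) := by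
  have hR1 : 1 ≤ R := hk.trans hR
  have hCi := Ci_nonneg r hc
  have hC2 := C2_nonneg r hc
  have hx0 := vert_mem v 0
  set x0 := v 0
  set q := wq k R with hq
  have hqp : ∀ x, 0 < q x := wq_pos hk hR1
  have hqc : Continuous q := (wq_contDiff hk hR1).continuous
  have hac := al_cont k hk
  have hap := al_pos hk
  have hbp := al_pos hR1
  have hqd : Differentiable ℝ q := (wq_contDiff hk hR1).differentiable (by norm_num)
  have hpc : Continuous p := hp.diff.continuous
  have hpdc : ∀ i, Continuous (pd i p) := fun i => (hp.pd i).diff.continuous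
  have hfc : Continuous (fderiv ℝ p) := (hp.contDiff 1).continuous_fderiv (by norm_num)
  obtain ⟨x1, hx1, hm1⟩ := (tet_compact v).exists_isMaxOn ⟨x0, hx0⟩ hfc.norm.continuousOn
  obtain ⟨x2, hx2, hm2⟩ := (tet_compact v).exists_isMaxOn ⟨x0, hx0⟩ hpc.abs.continuousOn
  set D := ‖fderiv ℝ p x1‖ with hD
  set B := |p x2| with hB
  have hD0 : 0 ≤ D := norm_nonneg _
  have hB0 : 0 ≤ B := abs_nonneg _
  have b3 : ∀ x ∈ tet v, ‖fderiv ℝ p x‖ ≤ D := fun x hx => hm1 hx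
  have b4 : ∀ x ∈ tet v, |p x| ≤ B := fun x hx => hm2 hx
  have hDB : D ≤ Ci r c * B := inv_est hr hc h hp b4 hx1
  have hq0 : ∀ x ∈ tet v, q x ≤ 18 * q x0 := fun x hx => wq_comp hk hR1 (h.dist_le hx hx0)
  have hq0' : ∀ x ∈ tet v, q x0 ≤ 18 * q x := fun x hx => wq_comp hk hR1 (h.dist_le hx0 hx)
  have b1 : ∀ x ∈ tet v, ‖fderiv ℝ q x‖ ≤ 54 * q x0 / k := by
    intro x hx
    refine (fderiv_wq_le hk hR x).trans ?_
    have := hq0 x hx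
    apply div_le_div_of_nonneg_right _ (by linarith)
    linarith
  have b2 : ∀ x ∈ tet v, ‖fderiv ℝ q x - fderiv ℝ q x0‖ ≤
      3888 * (q x0 * (al k x0 + al R x0)) := by
    intro x hx
    set P := 1944 * (q x0 * (al k x0 + al R x0)) with hP
    have hPp : 0 ≤ P := by
      have := hqp x0; have := hap x0; have := hbp x0; positivity
    have hi : ∀ i, |pd i q x - pd i q x0| ≤ P := by
      intro i
      refine h.mvt (fun y => (hasFDerivAt_pd_wq hk hR1 i y).differentiableAt) ?_ hx hx0
      intro y hy
      refine (fderiv_pd_wq_le hk hR1 i y).trans ?_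
      have e1 := hq0 y hy
      have e2 := al_comp hk (h.dist_le hy hx0)
      have e3 := al_comp hR1 (h.dist_le hy hx0)
      have := hqp y; have := hap y; have := hbp y
      have := hqp x0; have := hap x0; have := hbp x0
      calc _ ≤ 36 * ((18 * q x0) * (3 * al k x0 + 3 * al R x0)) := by gcongr
        _ = P := by rw [hP]; ring
    have := dual_norm (fderiv ℝ q x - fderiv ℝ q x0)
    have h3 : ∑ i, (fderiv ℝ q x - fderiv ℝ q x0) (bs i) ^ 2 ≤ ∑ i : Fin 3, P ^ 2 := by
      apply Finset.sum_le_sum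
      intro i _
      rw [← sq_abs]
      gcongr
      exact hi i
    replace h3 := this.trans h3
    rw [Finset.sum_const, Finset.card_univ, Fintype.card_fin, nsmul_eq_mul] at h3
    push_cast at h3
    have h4 : ‖fderiv ℝ q x - fderiv ℝ q x0‖ ^ 2 ≤ (2 * P) ^ 2 := by nlinarith
    have h5 := abs_le_of_sq_le_sq h4 (by positivity)
    rw [abs_le] at h5
    calc _ ≤ 2 * P := h5.2
      _ = _ := by rw [hP]; ring
  set V := volume.real (tet v) with hV
  have hV0 : 0 ≤ V := measureReal_nonneg
  set E := (2 + Ci r c) * (54 * q x0 / k * D + 3888 * (q x0 * (al k x0 + al R x0)) * B) with hE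
  have hqpd : Differentiable ℝ (fun y => q y * p y) := hqd.mul hp.diff
  have step1 : |∫ x in tet v, ∑ i, pd i p x * (pd i (fun y => q y * p y) x -
      pd i (ipol r v L (fun y => q y * p y)) x)| ≤ 3 * (D * E) * V := by
    rw [← Real.norm_eq_abs]
    apply norm_setIntegral_le_of_norm_le_const (tet_compact v).measure_lt_top
    intro x hx
    have hs := superapprox hr hc h hp hqd hx0 b1 b2 b3 b4 hx
    rw [Real.norm_eq_abs]
    refine (Finset.abs_sum_le_sum_abs _ _).trans ?_
    have : ∀ i ∈ (Finset.univ : Finset (Fin 3)), |pd i p x * (pd i (fun y => q y * p y) x -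
      pd i (ipol r v L (fun y => q y * p y)) x)| ≤ D * E := by
      intro i _
      rw [abs_mul]
      apply mul_le_mul ((pd_le i p x).trans (b3 x hx)) _ (abs_nonneg _) hD0
      refine le_trans ?_ hs
      have := (fderiv ℝ (fun y => q y * p y) x -
        fderiv ℝ (ipol r v L (fun y => q y * p y)) x).le_opNorm (bs i)
      rwa [bs_norm, mul_one] at this
    refine (Finset.sum_le_sum this).trans ?_
    simp
  refine step1.trans ?_
  have hVD : V * D ^ 2 ≤ C2 r c * ∫ x in tet v, ∑ i, pd i p x ^ 2 := by
    have hsi : ∀ i ∈ (Finset.univ : Finset (Fin 3)), IntegrableOn (fun x => pd i p x ^ 2) (tet v) :=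
      fun i _ => ((hpdc i).pow 2).continuousOn.integrableOn_compact (tet_compact v)
    rw [integral_finsetSum _ hsi, Finset.mul_sum]
    calc V * D ^ 2 ≤ V * ∑ i, pd i p x1 ^ 2 := by
          gcongr
          exact dual_norm (fderiv ℝ p x1)
      _ = ∑ i, V * pd i p x1 ^ 2 := Finset.mul_sum _ _ _
      _ ≤ _ := Finset.sum_le_sum fun i _ => L2_inv hr hc h (hp.pd i) hx1
  have hVB : V * B ^ 2 ≤ C2 r c * ∫ x in tet v, p x ^ 2 := by
    rw [hB, sq_abs]
    exact L2_inv hr hc h hp hx2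
  have hint : ∀ f : E3 → ℝ, Continuous f → IntegrableOn f (tet v) := fun f hf =>
    hf.continuousOn.integrableOn_compact (tet_compact v)
  have hmono : ∀ f g : E3 → ℝ, Continuous f → Continuous g → (∀ x ∈ tet v, f x ≤ g x) →
      ∫ x in tet v, f x ≤ ∫ x in tet v, g x := fun f g hf hg hfg =>
    setIntegral_mono_on (hint f hf) (hint g hg) (tet_compact v).measurableSet hfg
  have i1 : q x0 * ∫ x in tet v, ∑ i, pd i p x ^ 2 ≤ 18 * ∫ x in tet v, q x * ∑ i, pd i p x ^ 2 := by
    rw [← integral_const_mul, ← integral_const_mul]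
    apply hmono _ _ (by fun_prop) (by fun_prop)
    intro x hx
    rw [← mul_assoc]
    exact mul_le_mul_of_nonneg_right (hq0' x hx) (Finset.sum_nonneg fun i _ => sq_nonneg _)
  have i2 : q x0 * ∫ x in tet v, p x ^ 2 ≤ 18 * ∫ x in tet v, q x * p x ^ 2 := by
    rw [← integral_const_mul, ← integral_const_mul]
    apply hmono _ _ (by fun_prop) (by fun_prop)
    intro x hx
    rw [← mul_assoc]
    exact mul_le_mul_of_nonneg_right (hq0' x hx) (sq_nonneg _)
  have i3 : q x0 * al k x0 ^ 2 * ∫ x in tet v, p x ^ 2 ≤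
      162 * ∫ x in tet v, q x * al k x ^ 2 * p x ^ 2 := by
    rw [← integral_const_mul, ← integral_const_mul]
    apply hmono _ _ (by fun_prop) (by fun_prop)
    intro x hx
    have e2 := al_comp hk (h.dist_le hx0 hx)
    have := hap x0
    have := hqp x
    calc _ ≤ ((18 * q x) * (3 * al k x) ^ 2) * p x ^ 2 := by
          gcongr
          exact hq0' x hx
      _ = _ := by ring
  set I1 := ∫ x in tet v, q x * ∑ i, pd i p x ^ 2 with hI1
  set I2 := ∫ x in tet v, q x * p x ^ 2 with hI2
  set I3 := ∫ x in tet v, q x * al k x ^ 2 * p x ^ 2 with hI3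
  have hrhs : ∫ x in tet v, CW r c * (k⁻¹ * (q x * ∑ i, pd i p x ^ 2 +
      k ^ 2 * (q x * al k x ^ 2 * p x ^ 2)) + (R ^ 2)⁻¹ * (q x * p x ^ 2)) =
      CW r c * (k⁻¹ * (I1 + k ^ 2 * I3) + (R ^ 2)⁻¹ * I2) := by
    rw [integral_const_mul, integral_add (hint _ (by fun_prop)) (hint _ (by fun_prop)),
      integral_const_mul, integral_add (hint _ (by fun_prop)) (hint _ (by fun_prop)),
      integral_const_mul, integral_const_mul]
  rw [hrhs]
  have p1 : 0 ≤ I1 := setIntegral_nonneg (tet_compact v).measurableSet fun x _ =>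
    mul_nonneg (hqp x).le (Finset.sum_nonneg fun i _ => sq_nonneg _)
  have p2 : 0 ≤ I2 := setIntegral_nonneg (tet_compact v).measurableSet fun x _ =>
    mul_nonneg (hqp x).le (sq_nonneg _)
  have p3 : 0 ≤ I3 := setIntegral_nonneg (tet_compact v).measurableSet fun x _ =>
    mul_nonneg (mul_nonneg (hqp x).le (sq_nonneg _)) (sq_nonneg _)
  clear_value I1 I2 I3
  have hkp : 0 < k := by linarith
  have hRp : 0 < R := by linarith
  rw [CW]
  exact we_arith hkp hRp (hqp x0) (hap x0) (hbp x0) hD0 hB0 hV0 hCi hC2 p1 p2 p3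
    (al_le hR1 x0) hDB hVD hVB i1 i2 i3

def BM (f : E3 → ℝ) : Prop := Measurable f ∧ ∃ B, ∀ x, |f x| ≤ B

lemma BM.add {f g : E3 → ℝ} (hf : BM f) (hg : BM g) : BM (fun x => f x + g x) := by
  obtain ⟨h1, B, hB⟩ := hf
  obtain ⟨h2, D, hD⟩ := hg
  exact ⟨h1.add h2, B + D, fun x => (abs_add_le _ _).trans (add_le_add (hB x) (hD x))⟩

lemma BM.mul {f g : E3 → ℝ} (hf : BM f) (hg : BM g) : BM (fun x => f x * g x) := by
  obtain ⟨h1, B, hB⟩ := hf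
  obtain ⟨h2, D, hD⟩ := hg
  refine ⟨h1.mul h2, B * D, fun x => ?_⟩
  rw [abs_mul]
  exact mul_le_mul (hB x) (hD x) (abs_nonneg _) ((abs_nonneg _).trans (hB x))

lemma BM.const (a : ℝ) : BM (fun _ => a) := ⟨measurable_const, |a|, fun _ => le_rfl⟩

lemma BM.smul {f : E3 → ℝ} (hf : BM f) (a : ℝ) : BM (fun x => a * f x) := (BM.const a).mul hf

lemma BM.sub {f g : E3 → ℝ} (hf : BM f) (hg : BM g) : BM (fun x => f x - g x) := by
  have := hf.add (hg.smul (-1))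
  convert this using 2
  ring

lemma BM.sq {f : E3 → ℝ} (hf : BM f) : BM (fun x => f x ^ 2) := by
  have := hf.mul hf
  convert this using 2
  ring

lemma BM.sum {f : Fin 3 → E3 → ℝ} (hf : ∀ i, BM (f i)) : BM (fun x => ∑ i, f i x) := by
  simp only [Fin.sum_univ_three]
  exact ((hf 0).add (hf 1)).add (hf 2)

lemma BM.pd {f : E3 → ℝ} {K : ℝ≥0} (hf : LipschitzWith K f) (i : Fin 3) : BM (pd i f) :=
  ⟨meas_pd i f, K, pd_lip hf i⟩

lemma BM.intOn {f : E3 → ℝ} (hf : BM f) {A : Set E3} (hA : volume A ≠ ⊤) : IntegrableOn f A := by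
  obtain ⟨h1, B, hB⟩ := hf
  exact Measure.integrableOn_of_bounded (M := B) hA h1.aestronglyMeasurable
    (Filter.Eventually.of_forall hB)

lemma Mesh.int {c : ℝ} {Ω : Set E3} {T : Finset (Fin 4 → E3)} (h : Mesh c Ω T) {f : E3 → ℝ}
    (hf : BM f) : IntegrableOn f (closure Ω) :=
  hf.intOn (h.bd.isCompact_closure.measure_lt_top.ne)

lemma Mesh.int' {c : ℝ} {Ω : Set E3} {T : Finset (Fin 4 → E3)} (h : Mesh c Ω T) {f : E3 → ℝ}
    (hf : BM f) : IntegrableOn f Ω := (h.int hf).mono_set subset_closure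

lemma Mesh.cs {c : ℝ} {Ω : Set E3} {T : Finset (Fin 4 → E3)} (h : Mesh c Ω T) {f : E3 → ℝ}
    (hf : ∀ x ∉ Ω, f x = 0) : HasCompactSupport f :=
  HasCompactSupport.of_support_subset_isCompact h.bd.isCompact_closure fun x hx => by
    by_contra hx'
    exact hx (hf x fun hh => hx' (subset_closure hh))

lemma Mesh.lbm {c : ℝ} {Ω : Set E3} {T : Finset (Fin 4 → E3)} (h : Mesh c Ω T) {f : E3 → ℝ}
    {K : ℝ≥0} (hl : LipschitzWith K f) (hf : ∀ x ∉ Ω, f x = 0) : BM f := by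
  obtain ⟨B, hB⟩ := (h.cs hf).exists_bound_of_continuous hl.continuous
  exact ⟨hl.continuous.measurable, B, hB⟩

lemma wq_bm {k R : ℝ} (hk : 1 ≤ k) (hR : 1 ≤ R) : BM (wq k R) :=
  ⟨(wq_contDiff hk hR).continuous.measurable, 1, fun x => by
    rw [abs_of_pos (wq_pos hk hR x)]; exact wq_le hk hR x⟩

lemma al_bm {k : ℝ} (hk : 1 ≤ k) : BM (al k) :=
  ⟨(al_cont k hk).measurable, (k ^ 2)⁻¹, fun x => by
    rw [abs_of_pos (al_pos hk x)]; exact al_le hk x⟩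

lemma wq_lip {k R : ℝ} (hk : 1 ≤ k) (hR : 1 ≤ R) (i : Fin 3) :
    LipschitzWith 72 (pd i (wq k R)) := by
  apply lipschitzWith_of_nnnorm_fderiv_le
    (fun x => (hasFDerivAt_pd_wq hk hR i x).differentiableAt)
  intro x
  rw [← NNReal.coe_le_coe, coe_nnnorm]
  refine (fderiv_pd_wq_le hk hR i x).trans ?_
  have h1 := wq_le hk hR x
  have h0 := wq_pos hk hR x
  have h3 := al_pos hk x
  have h4 := al_pos hR x
  have h5 : al k x ≤ 1 := (al_le hk x).trans (inv_le_one_of_one_le₀ (by nlinarith))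
  have h6 : al R x ≤ 1 := (al_le hR x).trans (inv_le_one_of_one_le₀ (by nlinarith))
  calc _ ≤ 36 * ((1:ℝ) * (1 + 1)) := by gcongr
    _ = _ := by norm_num

lemma wq_lip0 {k R : ℝ} (hk : 1 ≤ k) (hR : k ≤ R) : LipschitzWith 3 (wq k R) := by
  have hR1 := hk.trans hR
  apply lipschitzWith_of_nnnorm_fderiv_le
    ((wq_contDiff hk hR1).differentiable (by norm_num))
  intro x
  rw [← NNReal.coe_le_coe, coe_nnnorm]
  refine (fderiv_wq_le hk hR x).trans ?_
  rw [div_le_iff₀ (by linarith)]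
  have h1 := wq_le hk hR1 x
  have h0 := wq_pos hk hR1 x
  push_cast
  nlinarith

lemma lip_mul {f g : E3 → ℝ} {K K' : ℝ≥0} (hf : LipschitzWith K f) (hg : LipschitzWith K' g)
    (bf : BM f) (bg : BM g) : ∃ K'', LipschitzWith K'' (fun x => f x * g x) := by
  obtain ⟨_, B, hB⟩ := bf
  obtain ⟨_, D, hD⟩ := bg
  have hB0 : 0 ≤ B := (abs_nonneg _).trans (hB 0)
  have hD0 : 0 ≤ D := (abs_nonneg _).trans (hD 0)
  refine ⟨(B.toNNReal * K' + D.toNNReal * K), LipschitzWith.of_dist_le_mul fun x y => ?_⟩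
  have h1 := hf.dist_le_mul x y
  have h2 := hg.dist_le_mul x y
  rw [Real.dist_eq] at h1 h2 ⊢
  have : f x * g x - f y * g y = f x * (g x - g y) + g y * (f x - f y) := by ring
  rw [this]
  refine (abs_add_le _ _).trans ?_
  rw [abs_mul, abs_mul]
  push_cast
  rw [Real.coe_toNNReal _ hB0, Real.coe_toNNReal _ hD0]
  calc _ ≤ B * (K' * dist x y) + D * (K * dist x y) := by
        gcongr
        · exact hB x
        · exact hD y
    _ = _ := by ring

/-- the weighted product identity -/
lemma Mesh.prod_id {c : ℝ} {Ω : Set E3} {T : Finset (Fin 4 → E3)} (h : Mesh c Ω T) {w : E3 → ℝ}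
    {K : ℝ≥0} (hl : LipschitzWith K w) (hw : ∀ x ∉ Ω, w x = 0) {k R : ℝ} (hk : 1 ≤ k)
    (hR : k ≤ R) :
    (∫ x in Ω, wq k R x * ∑ i, pd i w x ^ 2) + 3 / 2 * (k ^ 2 * ∫ x in Ω, wq k R x * al k x ^ 2 * w x ^ 2)
      - 10 * ((R ^ 2)⁻¹ * ∫ x in Ω, wq k R x * w x ^ 2) ≤
    ∫ x in Ω, ∑ i, pd i w x * pd i (fun y => wq k R y * w y) x := by
  have hR1 := hk.trans hR
  have bw := h.lbm hl hw
  have bq := wq_bm hk hR1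
  have ba := al_bm hk
  obtain ⟨K2, hl2⟩ := lip_mul hl hl bw bw
  have bpw := BM.pd hl
  have bpq := BM.pd (wq_lip0 hk hR)
  have bppq := fun i => BM.pd (wq_lip hk hR1 i) i
  have e1 : ∫ x in Ω, ∑ i, pd i w x * pd i (fun y => wq k R y * w y) x =
      ∫ x in Ω, (wq k R x * ∑ i, pd i w x ^ 2 + ∑ i, pd i (wq k R) x * (w x * pd i w x)) := by
    apply integral_congr_ae
    filter_upwards [ae_restrict_of_ae hl.ae_differentiableAt] with x hx
    have hq := ((wq_contDiff hk hR1).differentiable (by norm_num)) x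
    rw [Finset.mul_sum, ← Finset.sum_add_distrib]
    refine Finset.sum_congr rfl fun i _ => ?_
    have : pd i (fun y => wq k R y * w y) x = wq k R x * pd i w x + w x * pd i (wq k R) x := by
      unfold pd
      have := (hq.hasFDerivAt.mul hx.hasFDerivAt).fderiv
      erw [this]
      simp
    rw [this]; ring
  have e2 : ∫ x in Ω, ∑ i, pd i (wq k R) x * (w x * pd i w x) =
      - (1 / 2) * ∫ x in Ω, (∑ i, pd i (pd i (wq k R)) x) * w x ^ 2 := by
    simp_rw [Finset.sum_mul]
    rw [integral_finsetSum _ fun i _ => h.int' ((bpq i).mul (bw.mul (bpw i))),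
      integral_finsetSum _ fun i _ => h.int' ((bppq i).mul bw.sq), Finset.mul_sum]
    refine Finset.sum_congr rfl fun i _ => ?_
    rw [setIntegral_eq_integral_of_forall_compl_eq_zero (fun x hx => by simp [hw x hx]),
      setIntegral_eq_integral_of_forall_compl_eq_zero (fun x hx => by simp [hw x hx])]
    have h1 := ibp (wq_lip hk hR1 i) hl2 (h.cs fun x hx => by simp [hw x hx]) i
    have h2 : ∫ x, pd i (pd i (wq k R)) x * w x ^ 2 = ∫ x, pd i (pd i (wq k R)) x * (w x * w x) := by
      congr 1; ext x; ring
    have h3 : ∫ x, pd i (wq k R) x * pd i (fun x => w x * w x) x =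
        2 * ∫ x, pd i (wq k R) x * (w x * pd i w x) := by
      rw [← integral_const_mul]
      apply integral_congr_ae
      filter_upwards [hl.ae_differentiableAt] with x hx
      have : pd i (fun y => w y * w y) x = 2 * (w x * pd i w x) := by
        unfold pd
        have := (hx.hasFDerivAt.mul hx.hasFDerivAt).fderiv
        erw [this]
        simp; ring
      rw [this]; ring
    rw [h2, h1, h3]; ring
  rw [e1, integral_add (h.int' (bq.mul (BM.sum fun i => (bpw i).sq)))
    (h.int' (BM.sum fun i => (bpq i).mul (bw.mul (bpw i)))), e2]
  have e3 : ∫ x in Ω, (∑ i, pd i (pd i (wq k R)) x) * w x ^ 2 ≤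
      ∫ x in Ω, ((-3) * (k ^ 2 * (wq k R x * al k x ^ 2 * w x ^ 2)) +
        20 * ((R ^ 2)⁻¹ * (wq k R x * w x ^ 2))) := by
    apply integral_mono (h.int' ((BM.sum bppq).mul bw.sq))
      (h.int' ((((bq.mul ba.sq).mul bw.sq).smul _).smul _ |>.add (((bq.mul bw.sq).smul _).smul _)))
    intro x
    have h1 := lap_wq hk hR1 x
    have h2 := al_le hR1 x
    have h3 := wq_pos hk hR1 x
    calc (∑ i, pd i (pd i (wq k R)) x) * w x ^ 2
        ≤ (wq k R x * (-3 * k ^ 2 * al k x ^ 2 + 20 * al R x)) * w x ^ 2 := by gcongr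
      _ ≤ (wq k R x * (-3 * k ^ 2 * al k x ^ 2 + 20 * (R ^ 2)⁻¹)) * w x ^ 2 := by gcongr
      _ = _ := by ring
  rw [integral_add (h.int' ((((bq.mul ba.sq).mul bw.sq).smul _).smul _))
    (h.int' (((bq.mul bw.sq).smul _).smul _))] at e3
  simp only [integral_const_mul] at e3
  linarith

lemma Mesh.we {r : ℕ} (hr : 1 ≤ r) {c : ℝ} (hc : 0 < c) {Ω : Set E3} {T : Finset (Fin 4 → E3)}
    (h : Mesh c Ω T) {w : E3 → ℝ} (hw : PW r Ω T w) {k R : ℝ} (hk : 1 ≤ k) (hkC : 2 * CW r c ≤ k)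
    (hR : k ≤ R) :
    (∫ x in Ω, wq k R x * ∑ i, pd i w x ^ 2) + k ^ 2 * ∫ x in Ω, wq k R x * al k x ^ 2 * w x ^ 2
    ≤ (20 + 2 * CW r c) * ((R ^ 2)⁻¹ * ∫ x in Ω, wq k R x * w x ^ 2) +
      2 * |∫ x in Ω, ∑ i, pd i w x * pd i (gI r T (fun y => wq k R y * w y)) x| := by
  have hR1 := hk.trans hR
  obtain ⟨K, hl⟩ := h.lip hw
  have bw := h.lbm hl hw.1
  have bq := wq_bm hk hR1
  have ba := al_bm hk
  have bpw := BM.pd hl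
  obtain ⟨K1, hl1⟩ := lip_mul (wq_lip0 hk hR) hl bq bw
  have hχ : PW r Ω T (gI r T (fun y => wq k R y * w y)) := h.gI_pw hr fun x hx => by
    rw [hw.1 x (h.op.frontier_eq ▸ hx).2, mul_zero]
  obtain ⟨K2, hl2⟩ := h.lip hχ
  have bp1 := BM.pd hl1
  have bp2 := BM.pd hl2
  have p1 := h.prod_id hl hw.1 hk hR
  have p2 := h.sum_le
    (G := fun x => ∑ i, pd i w x * (pd i (fun y => wq k R y * w y) x -
      pd i (gI r T (fun y => wq k R y * w y)) x))
    (H := fun x => CW r c * (k⁻¹ * (wq k R x * ∑ i, pd i w x ^ 2 +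
      k ^ 2 * (wq k R x * al k x ^ 2 * w x ^ 2)) + (R ^ 2)⁻¹ * (wq k R x * w x ^ 2)))
    (h.int (BM.sum fun i => (bpw i).mul ((bp1 i).sub (bp2 i))))
    (h.int (((((bq.mul (BM.sum fun i => (bpw i).sq)).add (((bq.mul ba.sq).mul bw.sq).smul _)).smul _
      |>.add ((bq.mul bw.sq).smul _)).smul _))) (by
    intro v hv
    obtain ⟨p, hp, hwp⟩ := hw.2 v hv
    have t1 := h.tet1 hv
    have := we_local hr hc t1 hp hk hR
    have hd : ∀ i, ∀ x ∈ interior (tet v), pd i w x = pd i p x := fun i x hx => by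
      unfold pd; rw [fderiv_eq_tet hwp hx]
    convert this using 1
    · congr 1
      apply integral_congr_ae
      filter_upwards [tet_ae_int v] with x hx
      refine Finset.sum_congr rfl fun i _ => ?_
      rw [hd i x hx]
      congr 2
      · unfold pd
        rw [fderiv_eq_tet (p := fun y => wq k R y * p y) (fun y hy => by rw [hwp y hy]) hx]
      · unfold pd
        rw [fderiv_eq_tet (p := ipol r v (lam v) (fun y => wq k R y * p y)) _ hx]
        intro y hy
        rw [h.gI_eq r _ hv hy]
        exact ipol_congr hr t1.1 (fun y hy => by rw [hwp y hy]) hy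
    · apply integral_congr_ae
      filter_upwards [tet_ae_int v] with x hx
      simp only [hd _ x hx, hwp x (interior_subset hx)])
  have e1 : ∫ x in Ω, ∑ i, pd i w x * (pd i (fun y => wq k R y * w y) x -
      pd i (gI r T (fun y => wq k R y * w y)) x) =
      (∫ x in Ω, ∑ i, pd i w x * pd i (fun y => wq k R y * w y) x) -
      ∫ x in Ω, ∑ i, pd i w x * pd i (gI r T (fun y => wq k R y * w y)) x := by
    rw [← integral_sub (h.int' (BM.sum fun i => (bpw i).mul (bp1 i)))
      (h.int' (BM.sum fun i => (bpw i).mul (bp2 i)))]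
    congr 1; ext x
    rw [← Finset.sum_sub_distrib]
    exact Finset.sum_congr rfl fun i _ => by ring
  rw [e1, integral_const_mul, integral_add
    (h.int' (((bq.mul (BM.sum fun i => (bpw i).sq)).add (((bq.mul ba.sq).mul bw.sq).smul _)).smul _))
    (h.int' ((bq.mul bw.sq).smul _)), integral_const_mul, integral_const_mul, integral_add
    (h.int' (bq.mul (BM.sum fun i => (bpw i).sq))) (h.int' (((bq.mul ba.sq).mul bw.sq).smul _)),
    integral_const_mul] at p2
  set A := ∫ x in Ω, wq k R x * ∑ i, pd i w x ^ 2 with hA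
  set D := ∫ x in Ω, wq k R x * al k x ^ 2 * w x ^ 2 with hD
  set E := (R ^ 2)⁻¹ * ∫ x in Ω, wq k R x * w x ^ 2 with hE
  set X := ∫ x in Ω, ∑ i, pd i w x * pd i (gI r T (fun y => wq k R y * w y)) x
  set Y := ∫ x in Ω, ∑ i, pd i w x * pd i (fun y => wq k R y * w y) x
  have hA0 : 0 ≤ A := integral_nonneg fun x => mul_nonneg (wq_pos hk hR1 x).le
    (Finset.sum_nonneg fun i _ => sq_nonneg _)
  have hD0 : 0 ≤ D := integral_nonneg fun x => by
    have := (wq_pos hk hR1 x).le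
    positivity
  have hk0 : 0 < k := by linarith
  have hC : CW r c * k⁻¹ ≤ 1 / 2 := by
    rw [← div_eq_mul_inv, div_le_iff₀ hk0]; linarith
  clear_value A D E X Y
  have q1 := (abs_le.1 p2).2
  have q2 := le_abs_self X
  have hkD : 0 ≤ A + k ^ 2 * D := by positivity
  have q3 := mul_le_mul_of_nonneg_right hC hkD
  have q4 : 0 ≤ k ^ 2 * D := by positivity
  nlinarith

def CD (r : ℕ) (c : ℝ) : ℝ := 972 * Ci r c * (3 / c + Ci r c + 1)

lemma CD_nonneg (r : ℕ) {c : ℝ} (hc : 0 < c) : 0 ≤ CD r c := by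
  have := Ci_nonneg r hc; unfold CD; positivity

lemma vol_q {c : ℝ} {v : Fin 4 → E3} {L : Fin 4 → AF}
    (h : Tet1 c v L) {k R : ℝ} (hk : 1 ≤ k) (hR : 1 ≤ R) :
    wq k R (v 0) * volume.real (tet v) ≤ 18 * ∫ x in tet v, wq k R x := by
  have hf : volume (tet v) ≠ ⊤ := (tet_compact v).measure_lt_top.ne
  have h1 : ∫ x in tet v, wq k R (v 0) ≤ ∫ x in tet v, 18 * wq k R x := by
    apply setIntegral_mono_on ((BM.const _).intOn hf) (((wq_bm hk hR).smul _).intOn hf)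
      (tet_compact v).measurableSet
    intro x hx
    exact wq_comp hk hR (h.dist_le (vert_mem v 0) hx)
  rw [integral_const_mul, setIntegral_const, smul_eq_mul] at h1
  linarith

lemma Mesh.data {r : ℕ} (hr : 1 ≤ r) {c : ℝ} (hc : 0 < c) {Ω : Set E3} {T : Finset (Fin 4 → E3)}
    (h : Mesh c Ω T) {w : E3 → ℝ} (hw : PW r Ω T w) {k R : ℝ} (hk : 1 ≤ k) (hR : k ≤ R)
    {B : ℝ} (hB : ∀ x, |w x| ≤ B) {u : E3 → ℝ} {K : ℝ≥0} (hu : LipschitzWith K u) {U : ℝ}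
    (hU : (∀ x, |u x| ≤ U) ∨ (∀ i, ∀ v ∈ T, ∀ x ∈ interior (tet v), |pd i u x| ≤ U)) :
    |∫ x in Ω, ∑ i, pd i u x * pd i (gI r T (fun y => wq k R y * w y)) x| ≤
      CD r c * U * B * ∫ x in Ω, wq k R x := by
  have hR1 := hk.trans hR
  have bq := wq_bm hk hR1
  have hCi := Ci_nonneg r hc
  have hB0 : 0 ≤ B := (abs_nonneg _).trans (hB 0)
  have hχ : PW r Ω T (gI r T (fun y => wq k R y * w y)) := h.gI_pw hr fun x hx => by
    rw [hw.1 x (h.op.frontier_eq ▸ hx).2, mul_zero]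
  obtain ⟨K2, hl2⟩ := h.lip hχ
  rw [← integral_const_mul]
  apply h.sum_le (h.int (BM.sum fun i => (BM.pd hu i).mul (BM.pd hl2 i))) (h.int (bq.smul _))
  intro v hv
  have t1 := h.tet1 hv
  have hf : volume (tet v) ≠ ⊤ := (tet_compact v).measure_lt_top.ne
  set χ := ipol r v (lam v) (fun y => wq k R y * w y) with hχd
  have hχp : Pol3 r χ := ipol_pol r v _ _
  set q0 := wq k R (v 0) with hq0d
  have hq0 : 0 < q0 := wq_pos hk hR1 _
  set α := Ci r c * (18 * q0 * B) with hα
  have hα0 : 0 ≤ α := by positivity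
  have b1 : ∀ x ∈ tet v, ‖fderiv ℝ χ x‖ ≤ α := fun x hx => by
    apply fderiv_ipol_le hr hc t1 _ hx
    intro y hy
    rw [abs_mul, abs_of_pos (wq_pos hk hR1 y)]
    have := wq_comp hk hR1 (t1.dist_le hy (vert_mem v 0))
    have := hB y
    gcongr
  have b2 : ∀ i, ∀ x ∈ tet v, |pd i χ x| ≤ α := fun i x hx => (pd_le i χ x).trans (b1 x hx)
  have b3 : ∀ i, ∀ x ∈ tet v, |pd i (pd i χ) x| ≤ Ci r c * α := fun i x hx =>
    (pd_le i _ x).trans (inv_est hr hc t1 (hχp.pd i) (b2 i) hx)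
  have e1 : ∫ x in tet v, ∑ i, pd i u x * pd i (gI r T (fun y => wq k R y * w y)) x =
      ∑ i, ∫ x in tet v, pd i u x * pd i χ x := by
    rw [integral_finsetSum _ fun i _ => ((BM.pd hu i).mul (BM.pd hl2 i)).intOn hf]
    refine Finset.sum_congr rfl fun i _ => integral_congr_ae ?_
    filter_upwards [tet_ae_int v] with x hx
    unfold pd
    rw [fderiv_eq_tet (fun y hy => h.gI_eq r _ hv hy) hx]
  have hU0 : 0 ≤ U := by
    rcases hU with hU | hU
    · exact (abs_nonneg _).trans (hU 0)
    · obtain ⟨x, hx⟩ := t1.2.2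
      exact (abs_nonneg _).trans (hU 0 v hv x
        (interior_mono hx (ball_subset_interior_closedBall (mem_ball_self hc))))
  have e2 : ∀ i, |∫ x in tet v, pd i u x * pd i χ x| ≤
      U * volume.real (tet v) * ((3 / c + Ci r c + 1) * α) := by
    intro i
    rcases hU with hU | hU
    · obtain ⟨xc, hxc⟩ := t1.2.2
      refine (tv hc (tet_compact v) (tet_convex v) hxc hu hU ((hχp.pd i).contDiff 1) i
        (b2 i) (b3 i)).trans ?_
      gcongr
      rw [add_mul, add_mul]
      have : 3 * α / c = 3 / c * α := by ring
      linarith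
    · have : ‖∫ x in tet v, pd i u x * pd i χ x‖ ≤ (U * α) * volume.real (tet v) := by
        apply norm_setIntegral_le_of_norm_le_const_ae
          (tet_compact v).measure_lt_top
        filter_upwards [tet_ae_int v] with x hx
        rw [norm_mul]
        exact mul_le_mul (hU i v hv x hx) (b2 i x (interior_subset hx)) (norm_nonneg _) hU0
      rw [Real.norm_eq_abs] at this
      refine this.trans ?_
      have h3 : α ≤ (3 / c + Ci r c + 1) * α := by
        have : 0 ≤ (3 / c + Ci r c) * α := by positivity
        linarith
      calc _ = U * volume.real (tet v) * α := by ring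
        _ ≤ _ := by gcongr
  rw [e1]
  refine (Finset.abs_sum_le_sum_abs _ _).trans ((Finset.sum_le_sum fun i _ => e2 i).trans ?_)
  rw [Finset.sum_const, Finset.card_univ, Fintype.card_fin, integral_const_mul]
  have := vol_q t1 hk hR1
  rw [nsmul_eq_mul]
  push_cast
  calc _ = 3 * U * ((3 / c + Ci r c + 1) * (Ci r c * 18 * B)) * (q0 * volume.real (tet v)) := by
        rw [hα]; ring
    _ ≤ 3 * U * ((3 / c + Ci r c + 1) * (Ci r c * 18 * B)) * (18 * ∫ x in tet v, wq k R x) := by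
        gcongr
    _ = _ := by unfold CD; ring

def Ph (y : E3) : ℝ := ‖y‖⁻¹ * ((1 + ‖y‖ ^ 2)⁻¹) ^ 2

lemma Ph_nonneg (y : E3) : 0 ≤ Ph y := by unfold Ph; positivity

lemma Ph_meas : Measurable Ph := by unfold Ph; fun_prop

lemma Ph_int : Integrable Ph := by
  have h := integrable_fun_norm_addHaar (volume : Measure E3)
    (f := fun t : ℝ => t⁻¹ * ((1 + t ^ 2)⁻¹) ^ 2)
  unfold Ph
  rw [h, finrank_euclideanSpace_fin]
  refine Integrable.mono' (g := fun t : ℝ => (1 + t ^ 2)⁻¹) integrable_inv_one_add_sq.integrableOn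
    (by fun_prop) ?_
  filter_upwards [ae_restrict_mem measurableSet_Ioi] with t ht
  have ht' : 0 < t := ht
  rw [Real.norm_eq_abs, abs_of_nonneg (by positivity), smul_eq_mul]
  have : t ^ (3 - 1) * (t⁻¹ * ((1 + t ^ 2)⁻¹) ^ 2) = (t * (1 + t ^ 2)⁻¹) * (1 + t ^ 2)⁻¹ := by
    norm_num; field_simp
  rw [this]
  have h2 : t * (1 + t ^ 2)⁻¹ ≤ 1 := by
    rw [← div_eq_mul_inv, div_le_one (by positivity)]; nlinarith
  calc _ ≤ 1 * (1 + t ^ 2)⁻¹ := by gcongr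
    _ = _ := one_mul _

lemma wq_Ph {k R : ℝ} (hk : 1 ≤ k) (hR : 1 ≤ R) {x : E3} (hx : x ≠ 0) :
    wq k R x ≤ R⁻¹ * Ph (R⁻¹ • x) := by
  have hR0 : 0 < R := by linarith
  have hx0 : 0 < ‖x‖ := norm_pos_iff.2 hx
  have h1 : √(al k x) ≤ ‖x‖⁻¹ := by
    rw [← Real.sqrt_sq (inv_nonneg.2 hx0.le)]
    apply Real.sqrt_le_sqrt
    unfold al
    rw [inv_pow]
    apply inv_anti₀ (by positivity)
    nlinarith
  have h2 : R ^ 2 * al R x = (1 + ‖R⁻¹ • x‖ ^ 2)⁻¹ := by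
    unfold al
    rw [norm_smul, norm_inv, Real.norm_eq_abs, abs_of_pos hR0]
    field_simp
    ring
  unfold wq Ph
  rw [h2]
  have h3 : R⁻¹ * (‖R⁻¹ • x‖⁻¹ * ((1 + ‖R⁻¹ • x‖ ^ 2)⁻¹) ^ 2) =
      ‖x‖⁻¹ * ((1 + ‖R⁻¹ • x‖ ^ 2)⁻¹) ^ 2 := by
    rw [norm_smul, norm_inv, Real.norm_eq_abs, abs_of_pos hR0]
    field_simp
  rw [h3]
  gcongr

lemma scale_int (f : E3 → ℝ) {R : ℝ} (hR : 0 < R) : ∫ x, f (R⁻¹ • x) = R ^ 3 * ∫ x, f x := by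
  rw [Measure.integral_comp_inv_smul, finrank_euclideanSpace_fin, abs_of_pos (by positivity),
    smul_eq_mul]

lemma scale_intg {f : E3 → ℝ} (hf : Integrable f) {R : ℝ} (hR : 0 < R) :
    Integrable (fun x => f (R⁻¹ • x)) := by
  rw [integrable_comp_smul_iff volume f (inv_ne_zero hR.ne')]
  exact hf

def Zp : ℝ := ∫ y, Ph y

lemma Zp_nonneg : 0 ≤ Zp := integral_nonneg Ph_nonneg

lemma ae_ne0 : ∀ᵐ x ∂(volume : Measure E3), x ≠ 0 := by
  rw [ae_iff]; simp

lemma Mesh.int_q {c : ℝ} {Ω : Set E3} {T : Finset (Fin 4 → E3)} (h : Mesh c Ω T) {k R : ℝ}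
    (hk : 1 ≤ k) (hR : 1 ≤ R) : ∫ x in Ω, wq k R x ≤ Zp * R ^ 2 := by
  have hR0 : 0 < R := by linarith
  have hi : Integrable (fun x => R⁻¹ * Ph (R⁻¹ • x)) := (scale_intg Ph_int hR0).const_mul _
  calc ∫ x in Ω, wq k R x ≤ ∫ x in Ω, R⁻¹ * Ph (R⁻¹ • x) := by
        apply integral_mono_ae (h.int' (wq_bm hk hR)) hi.integrableOn
        filter_upwards [ae_restrict_of_ae ae_ne0] with x hx
        exact wq_Ph hk hR hx
    _ ≤ ∫ x, R⁻¹ * Ph (R⁻¹ • x) := setIntegral_le_integral hi (Filter.Eventually.of_forall fun x =>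
        mul_nonneg (by positivity) (Ph_nonneg _))
    _ = _ := by
        rw [integral_const_mul, scale_int _ hR0]
        unfold Zp; field_simp

def Ps (n : ℕ) (y : E3) : ℝ := max 0 (Ph y - (ball (0:E3) n).indicator (fun _ => (n:ℝ)) y)

lemma Ps_bd (n : ℕ) (y : E3) : |Ps n y| ≤ Ph y := by
  unfold Ps
  have h0 : 0 ≤ (ball (0:E3) n).indicator (fun _ => (n:ℝ)) y :=
    indicator_nonneg (fun _ _ => by positivity) _
  rw [abs_of_nonneg (le_max_left _ _)]
  exact max_le (Ph_nonneg y) (by linarith)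

lemma Ps_meas (n : ℕ) : Measurable (Ps n) :=
  measurable_const.max (Ph_meas.sub (measurable_const.indicator measurableSet_ball))

lemma Ps_int (n : ℕ) : Integrable (Ps n) :=
  Ph_int.mono' (Ps_meas n).aestronglyMeasurable (Filter.Eventually.of_forall (Ps_bd n))

lemma Ps_lim {η : ℝ} (hη : 0 < η) : ∃ n : ℕ, 1 ≤ n ∧ ∫ y, Ps n y ≤ η := by
  have h := tendsto_integral_of_dominated_convergence (μ := volume) (F := Ps) (f := fun _ => 0) Ph
    (fun n => (Ps_meas n).aestronglyMeasurable) Ph_int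
    (fun n => Filter.Eventually.of_forall (Ps_bd n)) (Filter.Eventually.of_forall fun y => by
      apply tendsto_const_nhds.congr'
      obtain ⟨m, hm⟩ := exists_nat_gt (max (Ph y) ‖y‖)
      filter_upwards [Filter.eventually_ge_atTop m] with n hn
      have hn' : (m:ℝ) ≤ n := by exact_mod_cast hn
      have h1 := (le_max_left _ _).trans_lt hm
      have h2 := (le_max_right _ _).trans_lt hm
      unfold Ps
      rw [indicator_of_mem (by rw [mem_ball_zero_iff]; linarith), max_eq_left (by linarith)])
  simp only [integral_zero] at h
  obtain ⟨n, h1, h2⟩ := ((Filter.eventually_ge_atTop 1).and (h.eventually (gt_mem_nhds hη))).exists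
  exact ⟨n, h1, h2.le⟩

lemma Mesh.w_split {c : ℝ} {Ω : Set E3} {T : Finset (Fin 4 → E3)} (h : Mesh c Ω T) {k R : ℝ}
    (hk : 1 ≤ k) (hR : 1 ≤ R) {η : ℝ} {n : ℕ} (hn : ∫ y, Ps n y ≤ η) {w : E3 → ℝ} (bw : BM w)
    {B : ℝ} (hB : ∀ x, |w x| ≤ B) :
    (R ^ 2)⁻¹ * ∫ x in Ω, wq k R x * w x ^ 2 ≤
      η * B ^ 2 + n * (R ^ 3)⁻¹ * ∫ x in ball 0 (n * R), w x ^ 2 := by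
  have hR0 : 0 < R := by linarith
  have hB0 : 0 ≤ B := (abs_nonneg _).trans (hB 0)
  have hwB : ∀ x, w x ^ 2 ≤ B ^ 2 := fun x => by rw [← sq_abs]; gcongr; exact hB x
  have hi1 : Integrable (fun x => R⁻¹ * B ^ 2 * Ps n (R⁻¹ • x)) :=
    (scale_intg (Ps_int n) hR0).const_mul _
  have hi2 : Integrable ((ball (0:E3) (n * R)).indicator fun x => R⁻¹ * n * w x ^ 2) := by
    rw [integrable_indicator_iff measurableSet_ball]
    exact (bw.sq.smul _).intOn measure_ball_lt_top.ne
  have : ∫ x in Ω, wq k R x * w x ^ 2 ≤ ∫ x in Ω, (R⁻¹ * B ^ 2 * Ps n (R⁻¹ • x) +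
      (ball (0:E3) (n * R)).indicator (fun x => R⁻¹ * n * w x ^ 2) x) := by
    apply integral_mono_ae (h.int' ((wq_bm hk hR).mul bw.sq)) (hi1.add hi2).integrableOn
    filter_upwards [ae_restrict_of_ae ae_ne0] with x hx
    have h1 := wq_Ph hk hR hx
    have h2 : Ph (R⁻¹ • x) ≤ Ps n (R⁻¹ • x) +
        (ball (0:E3) n).indicator (fun _ => (n:ℝ)) (R⁻¹ • x) := by
      unfold Ps
      linarith [le_max_right 0 (Ph (R⁻¹ • x) - (ball (0:E3) n).indicator (fun _ => (n:ℝ)) (R⁻¹ • x))]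
    have h3 : (ball (0:E3) n).indicator (fun _ => (n:ℝ)) (R⁻¹ • x) * (R⁻¹ * w x ^ 2) =
        (ball (0:E3) (n * R)).indicator (fun x => R⁻¹ * n * w x ^ 2) x := by
      have : R⁻¹ • x ∈ ball (0:E3) n ↔ x ∈ ball (0:E3) (n * R) := by
        rw [mem_ball_zero_iff, mem_ball_zero_iff, norm_smul, norm_inv, Real.norm_eq_abs,
          abs_of_pos hR0, inv_mul_lt_iff₀ hR0, mul_comm]
      by_cases hb : x ∈ ball (0:E3) (n * R)
      · rw [indicator_of_mem hb, indicator_of_mem (this.2 hb)]; ring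
      · rw [indicator_of_notMem hb, indicator_of_notMem (fun hh => hb (this.1 hh))]; ring
    have h4 : 0 ≤ Ps n (R⁻¹ • x) := le_max_left _ _
    calc wq k R x * w x ^ 2 ≤ (R⁻¹ * (Ps n (R⁻¹ • x) +
        (ball (0:E3) n).indicator (fun _ => (n:ℝ)) (R⁻¹ • x))) * w x ^ 2 := by
          refine mul_le_mul_of_nonneg_right (h1.trans ?_) (sq_nonneg _)
          exact mul_le_mul_of_nonneg_left h2 (by positivity)
      _ = R⁻¹ * w x ^ 2 * Ps n (R⁻¹ • x) +
        (ball (0:E3) n).indicator (fun _ => (n:ℝ)) (R⁻¹ • x) * (R⁻¹ * w x ^ 2) := by ring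
      _ ≤ R⁻¹ * B ^ 2 * Ps n (R⁻¹ • x) +
        (ball (0:E3) n).indicator (fun _ => (n:ℝ)) (R⁻¹ • x) * (R⁻¹ * w x ^ 2) := by
          have := hwB x
          gcongr ?_ + _
          exact mul_le_mul_of_nonneg_right (mul_le_mul_of_nonneg_left this (by positivity)) h4
      _ = _ := by rw [h3]; rfl
  have h2 := this.trans (setIntegral_le_integral (hi1.add hi2) (Filter.Eventually.of_forall
    fun x => add_nonneg (mul_nonneg (by positivity) (le_max_left _ _))
      (indicator_nonneg (fun _ _ => by positivity) _)))
  rw [integral_add hi1 hi2] at h2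
  rw [integral_const_mul, scale_int _ hR0, integral_indicator measurableSet_ball,
    integral_const_mul] at h2
  calc _ ≤ (R ^ 2)⁻¹ * _ := mul_le_mul_of_nonneg_left h2 (by positivity)
    _ = (∫ y, Ps n y) * B ^ 2 + n * (R ^ 3)⁻¹ * ∫ x in ball 0 (n * R), w x ^ 2 := by
        field_simp
    _ ≤ _ := by gcongr

def kk (r : ℕ) (c : ℝ) : ℝ := max 1 (2 * CW r c)
def vb (c : ℝ) : ℝ := volume.real (closedBall (0:E3) c)
def CE (r : ℕ) (c : ℝ) : ℝ := 20 + 2 * CW r c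
def CP (r : ℕ) (c : ℝ) : ℝ := C2 r c / vb c * (162 * kk r c ^ 3) * CE r c

lemma kk1 (r : ℕ) (c : ℝ) : 1 ≤ kk r c := le_max_left _ _

lemma vb_pos {c : ℝ} (hc : 0 < c) : 0 < vb c :=
  ENNReal.toReal_pos (measure_closedBall_pos volume 0 hc).ne' measure_closedBall_lt_top.ne

lemma CP_nonneg (r : ℕ) {c : ℝ} (hc : 0 < c) : 0 ≤ CP r c := by
  have := C2_nonneg r hc
  have := vb_pos hc
  have := CW_nonneg r hc
  have := kk1 r c
  unfold CP CE
  positivity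

lemma Mesh.energy {r : ℕ} (hr : 1 ≤ r) {c : ℝ} (hc : 0 < c) {Ω : Set E3} {T : Finset (Fin 4 → E3)}
    (h : Mesh c Ω T) {w : E3 → ℝ} (hw : PW r Ω T w) {R : ℝ} (hR : kk r c ≤ R) :
    ∫ x in Ω, wq (kk r c) R x * ∑ i, pd i w x ^ 2 ≤
     CE r c * ((R ^ 2)⁻¹ * ∫ x in Ω, wq (kk r c) R x * w x ^ 2) +
      2 * |∫ x in Ω, ∑ i, pd i w x * pd i (gI r T (fun y => wq (kk r c) R y * w y)) x| := by
  have h1 := h.we hr hc hw (kk1 r c) (le_max_right _ _) hR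
  have : 0 ≤ kk r c ^ 2 * ∫ x in Ω, wq (kk r c) R x * al (kk r c) x ^ 2 * w x ^ 2 := by
    apply mul_nonneg (sq_nonneg _)
    apply integral_nonneg fun x => ?_
    have := (wq_pos (kk1 r c) ((kk1 r c).trans hR) x).le
    positivity
  unfold CE
  linarith

lemma Mesh.pe {r : ℕ} (hr : 1 ≤ r) {c : ℝ} (hc : 0 < c) {Ω : Set E3} {T : Finset (Fin 4 → E3)}
    (h : Mesh c Ω T) (h0 : (0:E3) ∈ Ω) {w : E3 → ℝ} (hw : PW r Ω T w) {R : ℝ} (hR : kk r c ≤ R) :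
    w 0 ^ 2 ≤ CP r c * ((R ^ 2)⁻¹ * (∫ x in Ω, wq (kk r c) R x * w x ^ 2) +
      |∫ x in Ω, ∑ i, pd i w x * pd i (gI r T (fun y => wq (kk r c) R y * w y)) x|) := by
  have h1 := h.we hr hc hw (kk1 r c) (le_max_right _ _) hR
  have hk := kk1 r c
  have hR1 := hk.trans hR
  set k := kk r c with hkd
  have hk0 : 0 < k := by linarith
  have hR0 : 0 < R := by linarith
  obtain ⟨K, hl⟩ := h.lip hw
  have bw := h.lbm hl hw.1
  obtain ⟨v, hv, h0v⟩ := h.cover (subset_closure h0)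
  have t1 := h.tet1 hv
  have hf : volume (tet v) ≠ ⊤ := (tet_compact v).measure_lt_top.ne
  obtain ⟨p, hp, hwp⟩ := hw.2 v hv
  have e1 := L2_inv hr hc t1 hp h0v
  have e2 : vb c ≤ volume.real (tet v) := by
    obtain ⟨x, hx⟩ := t1.2.2
    have : vb c = volume.real (closedBall x c) := by
      unfold vb Measure.real
      rw [Measure.addHaar_closedBall_center volume x c]
    rw [this]
    exact measureReal_mono hx hf
  have q0 : wq k R 0 = k⁻¹ := by
    unfold wq al
    simp only [norm_zero]
    rw [show (0:ℝ) ^ 2 + k ^ 2 = k ^ 2 by ring, show (0:ℝ) ^ 2 + R ^ 2 = R ^ 2 by ring,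
      mul_inv_cancel₀ (by positivity), ← inv_pow, Real.sqrt_sq (by positivity)]
    ring
  have a0 : al k 0 = (k ^ 2)⁻¹ := by unfold al; simp
  have e3 : ∫ y in tet v, p y ^ 2 ≤ ∫ y in tet v, 162 * k ^ 5 * (wq k R y * al k y ^ 2 * w y ^ 2) := by
    apply setIntegral_mono_on
      ((hp.diff.continuous.pow 2).continuousOn.integrableOn_compact (tet_compact v))
      (((((wq_bm hk hR1).mul (al_bm hk).sq).mul bw.sq).smul _).intOn hf)
      (tet_compact v).measurableSet
    intro x hx
    rw [hwp x hx]
    have d1 := wq_comp hk hR1 (t1.dist_le h0v hx)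
    have d2 := al_comp hk (t1.dist_le h0v hx)
    rw [q0] at d1
    rw [a0] at d2
    have : 1 ≤ 162 * k ^ 5 * (wq k R x * al k x ^ 2) := by
      have d3 : 1 ≤ 18 * wq k R x * k := by
        rwa [inv_eq_one_div, div_le_iff₀ hk0] at d1
      have d4 : 1 ≤ 3 * al k x * k ^ 2 := by
        rwa [inv_eq_one_div, div_le_iff₀ (by positivity)] at d2
      have d5 : 1 ≤ (3 * al k x * k ^ 2) ^ 2 := one_le_pow₀ d4
      calc (1:ℝ) ≤ (18 * wq k R x * k) * (3 * al k x * k ^ 2) ^ 2 := one_le_mul_of_one_le_of_one_le d3 d5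
        _ = _ := by ring
    show p x ^ 2 ≤ _
    nlinarith [sq_nonneg (p x)]
  have e4 : ∫ y in tet v, wq k R y * al k y ^ 2 * w y ^ 2 ≤
      ∫ x in Ω, wq k R x * al k x ^ 2 * w x ^ 2 := by
    have hae : (Ω : Set E3) =ᵐ[volume] closure Ω := by
      have h3 : volume (closure Ω \ Ω) = 0 := by
        have := h.cv.addHaar_frontier volume
        rwa [h.op.frontier_eq] at this
      exact (subset_closure.eventuallyLE).antisymm (ae_le_set.2 h3)
    rw [setIntegral_congr_set hae]
    apply setIntegral_mono_set (h.int (((wq_bm hk hR1).mul (al_bm hk).sq).mul bw.sq))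
      (Filter.Eventually.of_forall fun x => ?_) (h.sub hv).eventuallyLE
    have := (wq_pos hk hR1 x).le
    show 0 ≤ wq k R x * al k x ^ 2 * w x ^ 2
    positivity
  have hA0 : 0 ≤ ∫ x in Ω, wq k R x * ∑ i, pd i w x ^ 2 := integral_nonneg fun x =>
    mul_nonneg (wq_pos hk hR1 x).le (Finset.sum_nonneg fun i _ => sq_nonneg _)
  rw [integral_const_mul] at e3
  rw [hwp 0 h0v]
  have hvb := vb_pos hc
  have hC2 := C2_nonneg r hc
  set D := ∫ x in Ω, wq k R x * al k x ^ 2 * w x ^ 2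
  set A := ∫ x in Ω, wq k R x * ∑ i, pd i w x ^ 2
  set E := (R ^ 2)⁻¹ * ∫ x in Ω, wq k R x * w x ^ 2
  set X := |∫ x in Ω, ∑ i, pd i w x * pd i (gI r T (fun y => wq k R y * w y)) x|
  have hX : 0 ≤ X := abs_nonneg _
  have f1 : k ^ 2 * D ≤ CE r c * (E + X) := by
    have := CW_nonneg r hc
    unfold CE
    nlinarith
  have f2 : vb c * p 0 ^ 2 ≤ C2 r c * (162 * k ^ 5 * D) := by
    calc _ ≤ volume.real (tet v) * p 0 ^ 2 := by gcongr
      _ ≤ C2 r c * ∫ y in tet v, p y ^ 2 := e1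
      _ ≤ C2 r c * (162 * k ^ 5 * ∫ y in tet v, wq k R y * al k y ^ 2 * w y ^ 2) := by gcongr
      _ ≤ _ := by gcongr
  calc p 0 ^ 2 ≤ C2 r c * (162 * k ^ 5 * D) / vb c := by
        rw [le_div_iff₀ hvb]; linarith
    _ = C2 r c / vb c * (162 * k ^ 3) * (k ^ 2 * D) := by ring
    _ ≤ C2 r c / vb c * (162 * k ^ 3) * (CE r c * (E + X)) := by gcongr
    _ = _ := by unfold CP; rw [← hkd]; ring

lemma TI_line {f : E3 → ℝ} {K : ℝ≥0} (hf : LipschitzWith K f) (w y : E3) :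
    (f (y + w) - f y) ^ 2 ≤ ∫ t in (0:ℝ)..1, (lineDeriv ℝ f (y + t • w) w) ^ 2 := by
  set φ : ℝ → ℝ := fun t => f (y + t • w) with hφ
  have hl : LipschitzWith (K * ‖w‖₊) φ := by
    apply LipschitzWith.of_dist_le_mul fun s t => ?_
    refine (hf.dist_le_mul _ _).trans ?_
    rw [dist_add_left, dist_eq_norm, ← sub_smul, norm_smul, ← dist_eq_norm]
    push_cast
    apply le_of_eq; ring
  have hd : ∀ t, deriv φ t = lineDeriv ℝ f (y + t • w) w := by
    intro t
    unfold lineDeriv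
    have : (fun s : ℝ => f (y + t • w + s • w)) = fun s => φ (t + s) := by
      ext s; simp only [hφ, add_smul, add_assoc]
    rw [this, deriv_comp_const_add, add_zero]
  have hFTC := (hl.lipschitzOnWith (s := uIcc 0 1)).absolutelyContinuousOnInterval.integral_deriv_eq_sub
  simp only [hd] at hFTC
  have e : φ 1 - φ 0 = f (y + w) - f y := by simp [hφ]
  rw [e] at hFTC
  set a := f (y + w) - f y
  have hb : ∀ t, ‖lineDeriv ℝ f (y + t • w) w‖ ≤ K * ‖w‖ := fun t => by
    rw [← hd]; exact norm_deriv_le_of_lipschitz hl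
  have hm : Measurable fun t : ℝ => lineDeriv ℝ f (y + t • w) w := by
    simp only [← hd]; exact measurable_deriv φ
  have i1 : IntervalIntegrable (fun t : ℝ => lineDeriv ℝ f (y + t • w) w) volume 0 1 := by
    rw [intervalIntegrable_iff]
    exact Measure.integrableOn_of_bounded (by simp) hm.aestronglyMeasurable
      (Filter.Eventually.of_forall hb)
  have i2 : IntervalIntegrable (fun t : ℝ => lineDeriv ℝ f (y + t • w) w ^ 2) volume 0 1 := by
    rw [intervalIntegrable_iff]
    refine Measure.integrableOn_of_bounded (M := (K * ‖w‖) ^ 2) (by simp)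
      (hm.pow_const 2).aestronglyMeasurable (Filter.Eventually.of_forall fun t => ?_)
    rw [norm_pow]
    have := hb t
    gcongr
  have := intervalIntegral.integral_mono_on (μ := volume) (a := 0) (b := 1) (by norm_num)
    ((i1.const_mul (2 * a)).sub (intervalIntegrable_const (c := a ^ 2))) i2
    (fun t _ => by nlinarith [sq_nonneg (lineDeriv ℝ f (y + t • w) w - a)])
  rw [intervalIntegral.integral_sub (i1.const_mul _) intervalIntegrable_const,
    intervalIntegral.integral_const_mul, hFTC] at this
  simp at this
  nlinarith

lemma TI {f : E3 → ℝ} {K : ℝ≥0} (hf : LipschitzWith K f) {w : E3} {a b : ℝ}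
    (hab : a + ‖w‖ ≤ b) :
    ∫ y in ball (0:E3) a, (f (y + w) - f y) ^ 2 ≤
      ‖w‖ ^ 2 * ∫ x in ball (0:E3) b, ∑ i, pd i f x ^ 2 := by
  have hmH : Measurable fun x => lineDeriv ℝ f x w := measurable_lineDeriv hf.continuous
  have hH : ∀ x, ‖lineDeriv ℝ f x w‖ ≤ K * ‖w‖ := fun x => norm_lineDeriv_le_of_lipschitz ℝ hf
  have bH : BM fun x => lineDeriv ℝ f x w := ⟨hmH, _, hH⟩
  set H : E3 → ℝ := fun x => lineDeriv ℝ f x w ^ 2 with hHd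
  have bH2 : BM H := bH.sq
  obtain ⟨mH, B, hB⟩ := id bH2
  have hfin : volume (ball (0:E3) a) ≠ ⊤ := measure_ball_lt_top.ne
  have hI : Integrable (Function.uncurry fun (y : E3) (t : ℝ) => H (y + t • w))
      ((volume.restrict (ball 0 a)).prod (volume.restrict (Ioc 0 1))) := by
    have : IsFiniteMeasure (volume.restrict (ball (0:E3) a)) := ⟨by simpa using hfin.lt_top⟩
    refine Integrable.of_bound (C := B) (Measurable.aestronglyMeasurable ?_)
      (Filter.Eventually.of_forall fun x => hB _)
    exact mH.comp (by fun_prop)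
  have s1 : ∫ y in ball (0:E3) a, (f (y + w) - f y) ^ 2 ≤
      ∫ y in ball (0:E3) a, ∫ t in Ioc (0:ℝ) 1, H (y + t • w) := by
    apply integral_mono _ hI.integral_prod_left
    · intro y
      have := TI_line hf w y
      rwa [intervalIntegral.integral_of_le (by norm_num)] at this
    · refine BM.intOn ⟨?_, (K * ‖w‖) ^ 2, fun x => ?_⟩ hfin
      · have := hf.continuous.measurable
        fun_prop
      · rw [abs_pow]
        have := hf.dist_le_mul (x + w) x
        rw [Real.dist_eq, dist_self_add_left] at this
        gcongr
  refine s1.trans ?_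
  rw [integral_integral_swap hI]
  have s2 : ∀ t ∈ Ioc (0:ℝ) 1, ∫ y in ball (0:E3) a, H (y + t • w) ≤
      ∫ x in ball (0:E3) b, H x := by
    intro t ht
    have : ∫ y in ball (0:E3) a, H (y + t • w) = ∫ x in ball (t • w) a, H x := by
      have hp := (measurePreserving_add_right volume (t • w)).setIntegral_preimage_emb
        (MeasurableEquiv.addRight (t • w)).measurableEmbedding H (ball (t • w) a)
      rw [← hp]
      congr 2
      ext y; simp [dist_eq_norm]
    rw [this]
    apply setIntegral_mono_set (bH2.intOn measure_ball_lt_top.ne)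
      (Filter.Eventually.of_forall fun x => sq_nonneg _)
    apply LE.le.eventuallyLE
    apply ball_subset_ball'
    rw [dist_zero_right, norm_smul, Real.norm_eq_abs, abs_of_pos ht.1]
    nlinarith [norm_nonneg w, ht.2]
  have s3 : ∫ t in Ioc (0:ℝ) 1, ∫ y in ball (0:E3) a, H (y + t • w) ≤ ∫ x in ball (0:E3) b, H x := by
    calc _ ≤ ∫ t in Ioc (0:ℝ) 1, ∫ x in ball (0:E3) b, H x := by
          apply setIntegral_mono_on hI.integral_prod_right (by simp) measurableSet_Ioc s2
      _ = _ := by simp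
  refine s3.trans ?_
  rw [← integral_const_mul]
  apply integral_mono_ae (bH2.intOn measure_ball_lt_top.ne)
    (((BM.sum fun i => (BM.pd hf i).sq).smul _).intOn measure_ball_lt_top.ne)
  filter_upwards [ae_restrict_of_ae hf.ae_differentiableAt] with x hx
  simp only [hHd]
  rw [hx.lineDeriv_eq_fderiv]
  have h1 := (fderiv ℝ f x).le_opNorm w
  have h2 := dual_norm (fderiv ℝ f x)
  rw [← sq_abs, ← Real.norm_eq_abs]
  calc _ ≤ (‖fderiv ℝ f x‖ * ‖w‖) ^ 2 := by gcongr
    _ = ‖w‖ ^ 2 * ‖fderiv ℝ f x‖ ^ 2 := by ring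
    _ ≤ _ := by gcongr; exact h2

section

structure Sol (r : ℕ) (c : ℝ) (Ω : Set E3) (T : Finset (Fin 4 → E3)) (u v : E3 → ℝ) (U M : ℝ) :
    Prop where
  mesh : Mesh c Ω T
  z0 : (0:E3) ∈ Ω
  ul : ∃ K, LipschitzWith K u
  uz : ∀ x ∉ Ω, u x = 0
  uU : ∀ x, |u x| ≤ U
  vp : PW r Ω T v
  vM : ∀ x, |v x| ≤ M
  orth : ∀ χ, PW r Ω T χ → ∫ x in Ω, ∑ i, pd i (fun y => u y - v y) x * pd i χ x = 0

lemma pd_sub_ae {f g : E3 → ℝ} {K K' : ℝ≥0} (hf : LipschitzWith K f) (hg : LipschitzWith K' g) :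
    ∀ᵐ x ∂(volume : Measure E3), ∀ i, pd i (fun y => f y - g y) x = pd i f x - pd i g x := by
  filter_upwards [hf.ae_differentiableAt, hg.ae_differentiableAt] with x h1 h2 i
  have : HasFDerivAt (fun y => f y - g y) _ x := h1.hasFDerivAt.sub h2.hasFDerivAt
  unfold pd
  rw [this.fderiv]; rfl

variable {r : ℕ} {c : ℝ} {Ω : Set E3} {T : Finset (Fin 4 → E3)} {u v : E3 → ℝ} {U M : ℝ}

lemma Sol.U0 (S : Sol r c Ω T u v U M) : 0 ≤ U := (abs_nonneg _).trans (S.uU 0)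
lemma Sol.M0 (S : Sol r c Ω T u v U M) : 0 ≤ M := (abs_nonneg _).trans (S.vM 0)

lemma Sol.swap (S : Sol r c Ω T u v U M) {χ : E3 → ℝ} (hχ : PW r Ω T χ) :
    ∫ x in Ω, ∑ i, pd i v x * pd i χ x = ∫ x in Ω, ∑ i, pd i u x * pd i χ x := by
  obtain ⟨K1, h1⟩ := S.ul
  obtain ⟨K2, h2⟩ := S.mesh.lip S.vp
  obtain ⟨K3, h3⟩ := S.mesh.lip hχ
  have h := S.orth χ hχ
  have e : ∫ x in Ω, ∑ i, pd i (fun y => u y - v y) x * pd i χ x =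
      (∫ x in Ω, ∑ i, pd i u x * pd i χ x) - ∫ x in Ω, ∑ i, pd i v x * pd i χ x := by
    rw [← integral_sub (S.mesh.int' (BM.sum fun i => (BM.pd h1 i).mul (BM.pd h3 i)))
      (S.mesh.int' (BM.sum fun i => (BM.pd h2 i).mul (BM.pd h3 i)))]
    apply integral_congr_ae
    filter_upwards [ae_restrict_of_ae (pd_sub_ae h1 h2)] with x hx
    rw [← Finset.sum_sub_distrib]
    exact Finset.sum_congr rfl fun i _ => by rw [hx i]; ring
  rw [e] at h
  linarith

lemma Mesh.test (h : Mesh c Ω T) (hr : 1 ≤ r) {w : E3 → ℝ} (hw : PW r Ω T w) (q : E3 → ℝ) :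
    PW r Ω T (gI r T (fun y => q y * w y)) := h.gI_pw hr fun x hx => by
  rw [hw.1 x (h.op.frontier_eq ▸ hx).2, mul_zero]

lemma Sol.dataV (S : Sol r c Ω T u v U M) (hr : 1 ≤ r) (hc : 0 < c) {w : E3 → ℝ}
    (hw : PW r Ω T w) {B R : ℝ} (hB : ∀ x, |w x| ≤ B) (hR : kk r c ≤ R) :
    |∫ x in Ω, ∑ i, pd i v x * pd i (gI r T (fun y => wq (kk r c) R y * w y)) x| ≤
      CD r c * Zp * U * B * R ^ 2 := by
  rw [S.swap (S.mesh.test hr hw _)]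
  obtain ⟨K1, h1⟩ := S.ul
  refine (S.mesh.data hr hc hw (kk1 r c) hR hB h1 (Or.inl S.uU)).trans ?_
  have := S.mesh.int_q (kk1 r c) ((kk1 r c).trans hR)
  have := S.U0
  have hB0 : 0 ≤ B := (abs_nonneg _).trans (hB 0)
  have := CD_nonneg r hc
  calc _ ≤ CD r c * U * B * (Zp * R ^ 2) := by gcongr
    _ = _ := by ring

lemma Mesh.pd_out (h : Mesh c Ω T) {f : E3 → ℝ} (hf : ∀ x ∉ Ω, f x = 0) :
    ∀ᵐ x ∂(volume : Measure E3), x ∉ Ω → ∀ i, pd i f x = 0 := by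
  have h2 : ∀ᵐ x ∂(volume : Measure E3), x ∉ frontier Ω :=
    measure_eq_zero_iff_ae_notMem.1 (h.cv.addHaar_frontier volume)
  filter_upwards [h2] with x hx hxΩ i
  have hxc : x ∈ (closure Ω)ᶜ := fun hh => hx (by rw [h.op.frontier_eq]; exact ⟨hh, hxΩ⟩)
  have : f =ᶠ[nhds x] fun _ => 0 := by
    filter_upwards [isClosed_closure.isOpen_compl.mem_nhds hxc] with y hy
    exact hf y fun hh => hy (subset_closure hh)
  unfold pd
  rw [this.fderiv_eq]; simp

lemma dyad (J : ℕ) {A m : ℝ} (hA : 0 < A) (hm : 0 < m) :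
    ∑ j ∈ Finset.range J, (if m ≤ 2 ^ j * A then (2 ^ j * A)⁻¹ else 0) ≤ 2 / m := by
  set G : ℕ → ℝ := fun j => min (2 / m) (2 / (2 ^ j * A)) with hG
  have h1 : ∀ j, (if m ≤ 2 ^ j * A then (2 ^ j * A)⁻¹ else 0) ≤ G j - G (j + 1) := by
    intro j
    have e : 2 / (2 ^ (j + 1) * A) = (2 ^ j * A)⁻¹ := by rw [pow_succ]; field_simp
    split_ifs with h
    · have h2 : (2:ℝ) / (2 ^ j * A) ≤ 2 / m := by gcongr
      have h3 : G j = 2 / (2 ^ j * A) := min_eq_right h2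
      have h4 : G (j + 1) ≤ (2 ^ j * A)⁻¹ := (min_le_right _ _).trans e.le
      have : 2 / (2 ^ j * A) = 2 * (2 ^ j * A)⁻¹ := by ring
      linarith
    · rw [sub_nonneg]
      simp only [hG]
      apply min_le_min le_rfl
      apply div_le_div_of_nonneg_left (by norm_num) (by positivity)
      rw [pow_succ]
      have : 0 < 2 ^ j * A := by positivity
      linarith
  refine (Finset.sum_le_sum fun j _ => h1 j).trans ?_
  rw [Finset.sum_range_sub']
  have h5 : 0 ≤ G J := le_min (by positivity) (by positivity)
  have h6 : G 0 ≤ 2 / m := min_le_left _ _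
  linarith

lemma wq_low {k R R0 : ℝ} (hk : 1 ≤ k) (hkR : k ≤ R0) (hR : R0 ≤ R) {x : E3} (hx : ‖x‖ ≤ R) :
    2 / max ‖x‖ R0 ≤ 16 * wq k R x := by
  have hR0 : 0 < R0 := by linarith
  have hRp : 0 < R := by linarith
  set m := max ‖x‖ R0
  have hm : 0 < m := lt_max_of_lt_right hR0
  have h1 : (2 * m)⁻¹ ≤ √(al k x) := by
    apply Real.le_sqrt_of_sq_le
    unfold al
    rw [inv_pow]
    apply inv_anti₀ (by positivity)
    have a1 : ‖x‖ ≤ m := le_max_left _ _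
    have a2 : k ≤ m := hkR.trans (le_max_right _ _)
    have := norm_nonneg x
    nlinarith
  have h2 : 1 / 2 ≤ R ^ 2 * al R x := by
    unfold al
    rw [← div_eq_mul_inv, le_div_iff₀ (by positivity)]
    have := norm_nonneg x
    nlinarith
  have h3 : (2 * m)⁻¹ * (1 / 2) ^ 2 ≤ wq k R x := by
    unfold wq; gcongr
  calc 2 / m = 16 * ((2 * m)⁻¹ * (1 / 2) ^ 2) := by field_simp; norm_num
    _ ≤ _ := by gcongr

lemma pigeon (h : Mesh c Ω T) {f : E3 → ℝ} {K : ℝ≥0} (hf : LipschitzWith K f)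
    (hz : ∀ x ∉ Ω, f x = 0) {k R0 : ℝ} (hk : 1 ≤ k) (hkR : k ≤ R0) {J : ℕ} (hJ : 1 ≤ J) :
    ∃ j < J, (2 ^ j * R0)⁻¹ * ∫ x in ball (0:E3) (2 ^ j * R0), ∑ i, pd i f x ^ 2 ≤
      16 / J * ∫ x in Ω, wq k (2 ^ J * R0) x * ∑ i, pd i f x ^ 2 := by
  have hR0 : 0 < R0 := by linarith
  have hRR : R0 ≤ 2 ^ J * R0 := le_mul_of_one_le_left hR0.le (one_le_pow₀ (by norm_num))
  set G : E3 → ℝ := fun x => ∑ i, pd i f x ^ 2 with hG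
  have bG : BM G := BM.sum fun i => (BM.pd hf i).sq
  have hG0 : ∀ x, 0 ≤ G x := fun x => Finset.sum_nonneg fun i _ => sq_nonneg _
  have bq : BM (wq k (2 ^ J * R0)) := wq_bm hk (by linarith)
  set I := ∫ x in Ω, wq k (2 ^ J * R0) x * G x with hI
  have key : ∑ j ∈ Finset.range J, (2 ^ j * R0)⁻¹ * ∫ x in ball (0:E3) (2 ^ j * R0), G x ≤
      ∑ j ∈ Finset.range J, 16 / J * I := by
    rw [Finset.sum_const, Finset.card_range, nsmul_eq_mul]
    have hJ0 : (J:ℝ) ≠ 0 := by positivity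
    rw [show (J:ℝ) * (16 / J * I) = 16 * I by field_simp]
    have e : ∀ j, (2 ^ j * R0)⁻¹ * ∫ x in ball (0:E3) (2 ^ j * R0), G x =
        ∫ x in Ω, (ball (0:E3) (2 ^ j * R0)).indicator (fun x => (2 ^ j * R0)⁻¹ * G x) x := by
      intro j
      rw [setIntegral_indicator measurableSet_ball, integral_const_mul]
      congr 1
      rw [inter_comm, ← setIntegral_indicator h.op.measurableSet]
      apply integral_congr_ae
      filter_upwards [ae_restrict_of_ae (h.pd_out hz)] with x hx
      by_cases hxo : x ∈ Ω
      · rw [indicator_of_mem hxo]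
      · rw [indicator_of_notMem hxo, hG]
        simp [hx hxo]
    simp_rw [e]
    have bi : ∀ j : ℕ, BM ((ball (0:E3) (2 ^ j * R0)).indicator (fun x => (2 ^ j * R0)⁻¹ * G x)) := by
      intro j
      obtain ⟨m, B, hB⟩ := bG.smul (2 ^ j * R0)⁻¹
      refine ⟨m.indicator measurableSet_ball, B, fun x => ?_⟩
      by_cases hx : x ∈ ball (0:E3) (2 ^ j * R0)
      · rw [indicator_of_mem hx]; exact hB x
      · rw [indicator_of_notMem hx, abs_zero]; exact (abs_nonneg _).trans (hB 0)
    rw [← integral_finsetSum _ fun j _ => h.int' (bi j), hI, ← integral_const_mul]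
    apply integral_mono (integrable_finsetSum _ fun j _ => h.int' (bi j))
      (h.int' ((bq.mul bG).smul _))
    intro x
    have hm : 0 < max ‖x‖ R0 := lt_max_of_lt_right hR0
    have d := dyad J hR0 hm
    have e2 : ∀ j ∈ Finset.range J, (ball (0:E3) (2 ^ j * R0)).indicator (fun x => (2 ^ j * R0)⁻¹ * G x) x ≤
        (if max ‖x‖ R0 ≤ 2 ^ j * R0 then (2 ^ j * R0)⁻¹ else 0) * G x := by
      intro j hj
      by_cases hx : x ∈ ball (0:E3) (2 ^ j * R0)
      · rw [indicator_of_mem hx, if_pos]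
        rw [mem_ball_zero_iff] at hx
        exact max_le hx.le (le_mul_of_one_le_left hR0.le (one_le_pow₀ (by norm_num)))
      · rw [indicator_of_notMem hx]
        apply mul_nonneg _ (hG0 x)
        split_ifs
        · positivity
        · rfl
    refine (Finset.sum_le_sum e2).trans ?_
    rw [← Finset.sum_mul]
    show _ ≤ 16 * (wq k (2 ^ J * R0) x * G x)
    rw [← mul_assoc]
    apply mul_le_mul_of_nonneg_right _ (hG0 x)
    by_cases hx : ‖x‖ ≤ 2 ^ J * R0
    · exact d.trans (wq_low hk hkR hRR hx)
    · rw [Finset.sum_eq_zero]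
      · have := wq_pos hk (show 1 ≤ 2 ^ J * R0 by linarith) x
        positivity
      · intro j hj
        rw [if_neg]
        intro hh
        apply hx
        refine ((le_max_left _ _).trans hh).trans ?_
        gcongr
        · norm_num
        · exact (Finset.mem_range.1 hj).le
  obtain ⟨j, hj, hle⟩ := Finset.exists_le_of_sum_le (Finset.nonempty_range_iff.2 (by omega)) key
  exact ⟨j, Finset.mem_range.1 hj, hle⟩

lemma Sol.E_le (S : Sol r c Ω T u v U M) {k R : ℝ} (hk : 1 ≤ k) (hR : 1 ≤ R) :
    (R ^ 2)⁻¹ * ∫ x in Ω, wq k R x * v x ^ 2 ≤ Zp * M ^ 2 := by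
  obtain ⟨K2, h2⟩ := S.mesh.lip S.vp
  have bv := S.mesh.lbm h2 S.vp.1
  have h1 : ∫ x in Ω, wq k R x * v x ^ 2 ≤ ∫ x in Ω, wq k R x * M ^ 2 := by
    apply integral_mono (S.mesh.int' ((wq_bm hk hR).mul bv.sq))
      (S.mesh.int' ((wq_bm hk hR).mul (BM.const _)))
    intro x
    have := wq_pos hk hR x
    have h3 : v x ^ 2 ≤ M ^ 2 := by rw [← sq_abs]; gcongr; exact S.vM x
    exact mul_le_mul_of_nonneg_left h3 this.le
  rw [integral_mul_const] at h1
  have h3 := S.mesh.int_q hk hR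
  have hR0 : 0 < R := by linarith
  calc _ ≤ (R ^ 2)⁻¹ * ((Zp * R ^ 2) * M ^ 2) := by
        gcongr; exact h1.trans (by gcongr)
    _ = _ := by field_simp

lemma Sol.ball_small (hr : 1 ≤ r) (hc : 0 < c) {ε : ℝ} (hε : 0 < ε) {R0 : ℝ} (hR0 : kk r c ≤ R0) :
    ∃ R1 C : ℝ, 0 ≤ C ∧ ∀ (Ω : Set E3) (T : Finset (Fin 4 → E3)) (u v : E3 → ℝ) (U M : ℝ),
      Sol r c Ω T u v U M → ∃ R, R0 ≤ R ∧ R ≤ R1 ∧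
        R⁻¹ * ∫ x in ball (0:E3) R, ∑ i, pd i v x ^ 2 ≤ ε * M ^ 2 + C * (U * M) := by
  have hk := kk1 r c
  have hCW := CW_nonneg r hc
  have hCE : 0 ≤ CE r c := by unfold CE; positivity
  have hZ := Zp_nonneg
  have hCD := CD_nonneg r hc
  have hR0p : 0 < R0 := by linarith
  obtain ⟨J, hJ⟩ := exists_nat_gt (16 * CE r c * Zp / ε)
  have hJ0 : 0 < (J:ℝ) := lt_of_le_of_lt (by positivity) hJ
  have hJ1 : 1 ≤ J := by exact_mod_cast hJ0
  refine ⟨2 ^ J * R0, 16 / J * (2 * CD r c * Zp * (2 ^ J * R0) ^ 2), by positivity, ?_⟩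
  intro Ω T u v U M S
  obtain ⟨K2, h2⟩ := S.mesh.lip S.vp
  obtain ⟨j, hj, hle⟩ := pigeon S.mesh h2 S.vp.1 hk hR0 hJ1
  have hRR : R0 ≤ 2 ^ J * R0 := le_mul_of_one_le_left hR0p.le (one_le_pow₀ (by norm_num))
  refine ⟨2 ^ j * R0, le_mul_of_one_le_left hR0p.le (one_le_pow₀ (by norm_num)),
    by gcongr; norm_num, hle.trans ?_⟩
  have h3 := S.mesh.energy hr hc S.vp (hR0.trans hRR)
  have h4 := S.dataV hr hc S.vp S.vM (hR0.trans hRR)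
  have h5 := S.E_le hk (hk.trans (hR0.trans hRR))
  calc _ ≤ 16 / J * (CE r c * (Zp * M ^ 2) + 2 * (CD r c * Zp * U * M * (2 ^ J * R0) ^ 2)) := by
        gcongr
        refine h3.trans ?_
        gcongr
    _ = (16 * CE r c * Zp / J) * M ^ 2 +
        16 / J * (2 * CD r c * Zp * (2 ^ J * R0) ^ 2) * (U * M) := by ring
    _ ≤ _ := by
        gcongr
        rw [div_lt_iff₀ hε] at hJ
        rw [div_le_iff₀ hJ0]
        linarith

end

lemma Sol.strip (r : ℕ) (hr : 1 ≤ r) {c : ℝ} (hc : 0 < c) {ε : ℝ} (hε : 0 < ε) (L0 : ℝ) :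
    ∃ C : ℝ, 0 ≤ C ∧ ∀ (Ω : Set E3) (T : Finset (Fin 4 → E3)) (u v : E3 → ℝ) (U M : ℝ),
      Sol r c Ω T u v U M → ∀ (n : E3) (ρ : ℝ), ‖n‖ = 1 → 0 ≤ ρ → ρ ≤ L0 →
        (∀ x, ρ ≤ ⟪n, x⟫ → v x = 0) → v 0 ^ 2 ≤ ε * M ^ 2 + C * (U * M) := by
  have hk := kk1 r c
  have hP := CP_nonneg r hc
  have hZ := Zp_nonneg
  have hCD := CD_nonneg r hc
  set P := CP r c
  obtain ⟨m, hm1, hm⟩ := Ps_lim (show 0 < ε / (2 * (P + 1)) by positivity)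
  have hm1' : (1:ℝ) ≤ m := by exact_mod_cast hm1
  have hm0 : (0:ℝ) < m := by linarith
  obtain ⟨R1, C, hC, H⟩ := Sol.ball_small (r := r) hr hc
    (show 0 < ε / (2 * (P + 1) * (16 * m ^ 4)) by positivity)
    (R0 := max (4 * m * kk r c) (4 * L0)) ((le_max_left _ _).trans' (by nlinarith))
  refine ⟨P * (16 * m ^ 4 * C + CD r c * Zp * R1 ^ 2), by positivity, ?_⟩
  intro Ω T u v U M S n ρ hn hρ hρL hv
  obtain ⟨R, hR0, hR1, hG⟩ := H Ω T u v U M S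
  have hU := S.U0
  have hM := S.M0
  obtain ⟨K, hK⟩ := S.mesh.lip S.vp
  have bv := S.mesh.lbm hK S.vp.1
  have hRk := (le_max_left _ _).trans hR0
  have hRL := (le_max_right _ _).trans hR0
  set Q := R / (4 * m) with hQ
  have hQk : kk r c ≤ Q := by rw [hQ, le_div_iff₀ (by positivity)]; linarith
  have hQ1 : 1 ≤ Q := hk.trans hQk
  have hQ0 : 0 < Q := by linarith
  have hRQ : R = 4 * (m * Q) := by rw [hQ]; field_simp
  have hQR1 : Q ≤ R1 := by nlinarith
  have h1 := S.mesh.pe hr hc S.z0 S.vp hQk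
  have h2 := S.dataV hr hc S.vp S.vM hQk
  have h3 := S.mesh.w_split hk hQ1 hm bv S.vM
  have h4 := TI hK (w := (m * Q + ρ) • n) (a := m * Q) (b := R) (by
    rw [norm_smul, hn, Real.norm_of_nonneg (by positivity)]; linarith)
  have h5 : ∫ y in ball (0:E3) (m * Q), (v (y + (m * Q + ρ) • n) - v y) ^ 2 =
      ∫ y in ball (0:E3) (m * Q), v y ^ 2 := by
    apply setIntegral_congr_fun measurableSet_ball
    intro y hy
    rw [mem_ball_zero_iff] at hy
    have : v (y + (m * Q + ρ) • n) = 0 := by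
      apply hv
      rw [inner_add_right, real_inner_smul_right, real_inner_self_eq_norm_sq, hn]
      have := abs_le.1 (abs_real_inner_le_norm n y)
      rw [hn] at this
      linarith [this.1]
    simp only [this]; ring
  rw [h5, norm_smul, hn, Real.norm_of_nonneg (by positivity)] at h4
  set I := ∫ x in ball (0:E3) R, ∑ i, pd i v x ^ 2
  have hI : 0 ≤ I := setIntegral_nonneg measurableSet_ball fun x _ =>
    Finset.sum_nonneg fun i _ => sq_nonneg _
  have h6 : m * (Q ^ 3)⁻¹ * ∫ x in ball (0:E3) (m * Q), v x ^ 2 ≤ 16 * m ^ 4 * (R⁻¹ * I) := by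
    calc _ ≤ m * (Q ^ 3)⁻¹ * ((2 * (m * Q)) ^ 2 * I) := by
          gcongr
          refine h4.trans (mul_le_mul_of_nonneg_right ?_ hI)
          rw [mul_one]
          exact pow_le_pow_left₀ (by positivity) (by linarith) 2
      _ = _ := by rw [hRQ]; field_simp; ring
  have h7 : m * (Q ^ 3)⁻¹ * ∫ x in ball (0:E3) (m * Q), v x ^ 2 ≤
      ε / (2 * (P + 1)) * M ^ 2 + 16 * m ^ 4 * C * (U * M) := by
    refine h6.trans ?_
    calc _ ≤ 16 * m ^ 4 * (ε / (2 * (P + 1) * (16 * m ^ 4)) * M ^ 2 + C * (U * M)) := by gcongr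
      _ = _ := by field_simp
  calc _ ≤ P * ((ε / (2 * (P + 1)) * M ^ 2 + (ε / (2 * (P + 1)) * M ^ 2 + 16 * m ^ 4 * C * (U * M)))
        + CD r c * Zp * U * M * R1 ^ 2) := by
        refine h1.trans ?_
        gcongr
        · exact h3.trans (by gcongr)
        · exact h2.trans (by gcongr)
    _ = (P / (P + 1)) * (ε * M ^ 2) + P * (16 * m ^ 4 * C + CD r c * Zp * R1 ^ 2) * (U * M) := by
        field_simp; ring
    _ ≤ _ := by
        refine add_le_add_left ?_ _
        apply mul_le_of_le_one_left (by positivity)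
        rw [div_le_one (by positivity)]; linarith

lemma pairP {f : E3 → ℝ} {K : ℝ≥0} (hf : LipschitzWith K f) (bf : BM f) {b : ℝ} (hb : 0 < b) :
    ∫ x in ball (0:E3) b, ∫ z in ball (0:E3) b, (f x - f z) ^ 2 ≤
      volume.real (ball (0:E3) (2 * b)) * ((2 * b) ^ 2 *
        ∫ x in ball (0:E3) (3 * b), ∑ i, pd i f x ^ 2) := by
  obtain ⟨fm, B, hB⟩ := id bf
  have fin : ∀ s, volume (ball (0:E3) s) ≠ ⊤ := fun s => measure_ball_lt_top.ne
  haveI : ∀ s, IsFiniteMeasure (volume.restrict (ball (0:E3) s)) := fun s =>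
    ⟨by rw [Measure.restrict_apply_univ]; exact measure_ball_lt_top⟩
  have hcont : Continuous fun p : E3 × E3 => (f (p.1 + p.2) - f p.1) ^ 2 := by
    have := hf.continuous; fun_prop
  have hbd : ∀ x y, |(f x - f y) ^ 2| ≤ (2 * B) ^ 2 := by
    intro x y
    rw [abs_pow]
    have h1 := abs_sub (f x) (f y)
    have := hB x; have := hB y
    gcongr; linarith
  have hint : Integrable (fun p : E3 × E3 => (f (p.1 + p.2) - f p.1) ^ 2)
      ((volume.restrict (ball (0:E3) b)).prod (volume.restrict (ball (0:E3) (2 * b)))) :=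
    Integrable.of_bound hcont.aestronglyMeasurable ((2 * B) ^ 2)
      (Filter.Eventually.of_forall fun p => hbd _ _)
  have h1 : ∀ x ∈ ball (0:E3) b, ∫ z in ball (0:E3) b, (f x - f z) ^ 2 ≤
      ∫ w in ball (0:E3) (2 * b), (f (x + w) - f x) ^ 2 := by
    intro x hx
    rw [← integral_indicator measurableSet_ball, ← integral_indicator measurableSet_ball,
      ← integral_add_left_eq_self _ x]
    have bm : BM fun w => (f (x + w) - f x) ^ 2 :=
      ⟨by have := hf.continuous; exact (by fun_prop : Continuous _).measurable, _, fun w => hbd _ _⟩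
    have bm2 : BM fun z => (f x - f z) ^ 2 :=
      ⟨by have := hf.continuous; exact (by fun_prop : Continuous _).measurable, _, fun w => hbd _ _⟩
    apply integral_mono
    · exact ((bm2.intOn (fin b)).integrable_indicator measurableSet_ball).comp_add_left x
    · exact (bm.intOn (fin _)).integrable_indicator measurableSet_ball
    · intro w
      by_cases hw : x + w ∈ ball (0:E3) b
      · have : w ∈ ball (0:E3) (2 * b) := by
          rw [mem_ball_zero_iff] at *
          have := norm_sub_le (x + w) x
          rw [add_sub_cancel_left] at this
          linarith
        simp only [indicator_of_mem hw, indicator_of_mem this]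
        apply le_of_eq; ring
      · simp only [indicator_of_notMem hw]
        exact indicator_nonneg (fun _ _ => sq_nonneg _) _
  set I := ∫ x in ball (0:E3) (3 * b), ∑ i, pd i f x ^ 2
  have hI : 0 ≤ I := setIntegral_nonneg measurableSet_ball fun x _ =>
    Finset.sum_nonneg fun i _ => sq_nonneg _
  calc _ ≤ ∫ x in ball (0:E3) b, ∫ w in ball (0:E3) (2 * b), (f (x + w) - f x) ^ 2 := by
        apply setIntegral_mono_on _ hint.integral_prod_left measurableSet_ball h1
        have hc2 : Continuous fun p : E3 × E3 => (f p.1 - f p.2) ^ 2 := by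
          have := hf.continuous; fun_prop
        have : Integrable (fun p : E3 × E3 => (f p.1 - f p.2) ^ 2)
          ((volume.restrict (ball (0:E3) b)).prod (volume.restrict (ball (0:E3) b))) :=
          Integrable.of_bound hc2.aestronglyMeasurable ((2 * B) ^ 2)
            (Filter.Eventually.of_forall fun p => hbd _ _)
        exact this.integral_prod_left
    _ = ∫ w in ball (0:E3) (2 * b), ∫ x in ball (0:E3) b, (f (x + w) - f x) ^ 2 :=
        integral_integral_swap hint
    _ ≤ ∫ w in ball (0:E3) (2 * b), (2 * b) ^ 2 * I := by
        apply setIntegral_mono_on hint.integral_prod_right (integrable_const _) measurableSet_ball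
        intro w hw
        rw [mem_ball_zero_iff] at hw
        refine (TI hf (b := 3 * b) (by linarith)).trans ?_
        gcongr
    _ = _ := by rw [setIntegral_const, smul_eq_mul]

lemma meanP {f : E3 → ℝ} {K : ℝ≥0} (hf : LipschitzWith K f) (bf : BM f) {b : ℝ} (hb : 0 < b)
    {W : E3 → ℝ} (bW : BM W) (W0 : ∀ x, 0 ≤ W x) (W1 : ∀ x, W x ≤ 1) (Wz : ∀ x ∉ ball (0:E3) b, W x = 0)
    {a : ℝ} (ha : a * ∫ x, W x = ∫ x, f x * W x) :
    (∫ x, W x) * ∫ x in ball (0:E3) b, (f x - a) ^ 2 ≤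
      volume.real (ball (0:E3) (2 * b)) * ((2 * b) ^ 2 *
        ∫ x in ball (0:E3) (3 * b), ∑ i, pd i f x ^ 2) := by
  refine le_trans ?_ (pairP hf bf hb)
  have fin : ∀ s, volume (ball (0:E3) s) ≠ ⊤ := fun s => measure_ball_lt_top.ne
  haveI : ∀ s, IsFiniteMeasure (volume.restrict (ball (0:E3) s)) := fun s =>
    ⟨by rw [Measure.restrict_apply_univ]; exact measure_ball_lt_top⟩
  have toB : ∀ g : E3 → ℝ, ∫ x in ball (0:E3) b, g x * W x = ∫ x, g x * W x := fun g =>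
    setIntegral_eq_integral_of_forall_compl_eq_zero fun x hx => by rw [Wz x hx, mul_zero]
  have toB1 : ∫ x in ball (0:E3) b, W x = ∫ x, W x :=
    setIntegral_eq_integral_of_forall_compl_eq_zero fun x hx => Wz x hx
  rw [← integral_const_mul]
  have hcont : Continuous fun p : E3 × E3 => (f p.1 - f p.2) ^ 2 := by
    have := hf.continuous; fun_prop
  obtain ⟨fm, B, hB⟩ := id bf
  have hint : Integrable (fun p : E3 × E3 => (f p.1 - f p.2) ^ 2)
      ((volume.restrict (ball (0:E3) b)).prod (volume.restrict (ball (0:E3) b))) := by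
    apply Integrable.of_bound hcont.aestronglyMeasurable ((2 * B) ^ 2)
    refine Filter.Eventually.of_forall fun p => ?_
    rw [Real.norm_eq_abs, abs_pow]
    have h1 := abs_sub (f p.1) (f p.2)
    have := hB p.1; have := hB p.2
    gcongr; linarith
  apply setIntegral_mono_on (((bf.sub (BM.const a)).sq.smul _).intOn (fin b))
    hint.integral_prod_left measurableSet_ball
  intro x _
  have e1 : ∫ z in ball (0:E3) b, ((f x - a) ^ 2 * W z + 2 * (f x - a) * (a * W z - f z * W z)) =
      (∫ x, W x) * (f x - a) ^ 2 := by
    rw [integral_add ((bW.smul _).intOn (fin b))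
      ((((bW.smul a).sub (bf.mul bW)).smul _).intOn (fin b)), integral_const_mul, integral_const_mul,
      integral_sub ((bW.smul a).intOn (fin b)) ((bf.mul bW).intOn (fin b)), integral_const_mul,
      toB f, toB1, ha]
    ring
  rw [← e1]
  apply integral_mono ((((bW.smul _)).add (((bW.smul a).sub (bf.mul bW)).smul _)).intOn (fin b))
    ((((BM.const (f x)).sub bf).sq).intOn (fin b))
  intro z
  have h0 := W0 z
  have h1 := W1 z
  show (f x - a) ^ 2 * W z + 2 * (f x - a) * (a * W z - f z * W z) ≤ (f x - f z) ^ 2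
  nlinarith [mul_nonneg h0 (sq_nonneg (f z - a)), mul_nonneg (sub_nonneg.2 h1) (sq_nonneg (f x - f z))]

section

variable {r : ℕ} {c : ℝ} {Ω : Set E3} {T : Finset (Fin 4 → E3)} {u v : E3 → ℝ} {U M : ℝ}

lemma clamp_lip (a b : ℝ) : |max 0 (min 1 a) - max 0 (min 1 b)| ≤ |a - b| := by
  grind

lemma Mesh.cut (h : Mesh c Ω T) (hr : 1 ≤ r) (hc : 0 < c) {ρ : ℝ} (hρ : 2 ≤ ρ)
    (hb : ball (0:E3) ρ ⊆ Ω) : ∃ φ, PW r Ω T φ ∧ (∀ x, |φ x| ≤ C1 r) ∧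
      (∀ x, ‖x‖ ≤ ρ / 2 - 1 → φ x = 1) ∧
      ∀ i, ∀ v ∈ T, ∀ x ∈ interior (tet v), |pd i φ x| ≤ Ci r c * (2 / ρ) := by
  have hρ0 : 0 < ρ := by linarith
  set ψ : E3 → ℝ := fun x => max 0 (min 1 (2 - 2 / ρ * ‖x‖)) with hψ
  have hψ0 : ∀ x, 0 ≤ ψ x := fun x => le_max_left _ _
  have hψ1 : ∀ x, ψ x ≤ 1 := fun x => max_le zero_le_one (min_le_left _ _)
  have hψz : ∀ x ∉ Ω, ψ x = 0 := by
    intro x hx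
    have : ρ ≤ ‖x‖ := by
      by_contra hh
      exact hx (hb (mem_ball_zero_iff.2 (not_le.1 hh)))
    have h2 : 2 / ρ * ρ ≤ 2 / ρ * ‖x‖ := by gcongr
    rw [div_mul_cancel₀ _ hρ0.ne'] at h2
    exact max_eq_left ((min_le_right _ _).trans (by linarith))
  have hψo : ∀ x, ‖x‖ ≤ ρ / 2 → ψ x = 1 := by
    intro x hx
    have h2 : 2 / ρ * ‖x‖ ≤ 2 / ρ * (ρ / 2) := by gcongr
    rw [show 2 / ρ * (ρ / 2) = 1 by field_simp] at h2
    simp only [hψ]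
    rw [min_eq_left (by linarith)]; norm_num
  have hψl : ∀ x y, |ψ x - ψ y| ≤ 2 / ρ * dist x y := by
    intro x y
    refine (clamp_lip _ _).trans ?_
    rw [show 2 - 2 / ρ * ‖x‖ - (2 - 2 / ρ * ‖y‖) = 2 / ρ * (‖y‖ - ‖x‖) by ring, abs_mul,
      abs_of_pos (by positivity : 0 < 2 / ρ)]
    gcongr
    rw [dist_comm, dist_eq_norm]
    exact abs_norm_sub_norm_le y x
  have hp : PW r Ω T (gI r T ψ) := h.gI_pw hr fun x hx => hψz x (h.op.frontier_eq ▸ hx).2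
  refine ⟨gI r T ψ, hp, fun x => ?_, fun x hx => ?_, fun i v hv x hx => ?_⟩
  · by_cases hxo : x ∈ Ω
    · obtain ⟨v, hv, hxv⟩ := h.cover (subset_closure hxo)
      rw [h.gI_eq r ψ hv hxv]
      have := ipol_le hr (h.tet1 hv).1 (z := ψ) (B := 1) (fun y _ => by
        rw [abs_of_nonneg (hψ0 y)]; exact hψ1 y) hxv
      linarith
    · rw [hp.1 x hxo, abs_zero]; exact C1_nonneg r
  · have hxo : x ∈ Ω := hb (mem_ball_zero_iff.2 (by linarith))
    obtain ⟨v, hv, hxv⟩ := h.cover (subset_closure hxo)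
    rw [h.gI_eq r ψ hv hxv, ipol_congr hr (h.tet1 hv).1 (w := fun _ => 1) _ hxv,
      ipol_poly hr (h.tet1 hv).1 (Pol3.const hr 1)]
    intro y hy
    apply hψo
    have h1 := (h.tet1 hv).dist_le hxv hy
    have h2 := norm_sub_norm_le y x
    rw [← dist_eq_norm, dist_comm] at h2
    linarith
  · refine (pd_le i _ x).trans ?_
    have e : gI r T ψ = fun y => gI r T ψ y := rfl
    have hxv := interior_subset hx
    rw [fderiv_eq_tet (p := fun y => ipol r v (lam v) (fun y => ψ y + (-ψ x)) y + ψ x) _ hx,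
      fderiv_add_const]
    · apply fderiv_ipol_le hr hc (h.tet1 hv) _ hxv
      intro y hy
      rw [← sub_eq_add_neg]
      refine (hψl y x).trans ?_
      have h1 := (h.tet1 hv).dist_le hy hxv
      exact mul_le_of_le_one_right (by positivity) h1
    · intro y hy
      rw [h.gI_eq r ψ hv hy, ipol_add r v (lam v) ψ (fun _ => -ψ x),
        ipol_poly hr (h.tet1 hv).1 (Pol3.const hr _)]
      ring

lemma PW.sub_smul {f g : E3 → ℝ} (hf : PW r Ω T f) (hg : PW r Ω T g) (a : ℝ) :
    PW r Ω T (fun x => f x - a * g x) := by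
  refine ⟨fun x hx => by simp [hf.1 x hx, hg.1 x hx], fun v hv => ?_⟩
  obtain ⟨p, hp, hp'⟩ := hf.2 v hv
  obtain ⟨q, hq, hq'⟩ := hg.2 v hv
  exact ⟨_, hp.sub (hq.smul a), fun x hx => by simp only [hp' x hx, hq' x hx]⟩

lemma pd_smul_ae {f : E3 → ℝ} {K : ℝ≥0} (hf : LipschitzWith K f) (a : ℝ) :
    ∀ᵐ x ∂(volume : Measure E3), ∀ i, pd i (fun y => a * f y) x = a * pd i f x := by
  filter_upwards [hf.ae_differentiableAt] with x h1 i
  have : HasFDerivAt (fun y => a * f y) _ x := h1.hasFDerivAt.const_mul a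
  unfold pd
  rw [this.fderiv]; rfl

structure IsW (W : E3 → ℝ) : Prop where
  m : Measurable W
  nn : ∀ x, 0 ≤ W x
  le : ∀ x, W x ≤ 1
  z : ∀ x ∉ ball (0:E3) 1, W x = 0
  pos : 0 < ∫ x, W x

/-- weighted mean at scale `R` -/
def mn (W v : E3 → ℝ) (R : ℝ) : ℝ := (∫ x, v x * W (R⁻¹ • x)) / (R ^ 3 * ∫ x, W x)

lemma IsW.bm {W : E3 → ℝ} (h : IsW W) : BM W :=
  ⟨h.m, 1, fun x => by rw [abs_of_nonneg (h.nn x)]; exact h.le x⟩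

lemma IsW.z' {W : E3 → ℝ} (h : IsW W) {R : ℝ} (hR : 0 < R) {x : E3} (hx : R ≤ ‖x‖) :
    W (R⁻¹ • x) = 0 := h.z _ (by
  rw [mem_ball_zero_iff, norm_smul, norm_inv, Real.norm_of_nonneg hR.le, not_lt, inv_mul_eq_div,
    le_div_iff₀ hR]; linarith)

lemma IsW.intg {W : E3 → ℝ} (h : IsW W) {R : ℝ} (hR : 0 < R) {f : E3 → ℝ} (bf : BM f) :
    Integrable (fun x => f x * W (R⁻¹ • x)) := by
  have b : BM (fun x => f x * W (R⁻¹ • x)) := bf.mul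
    ⟨h.m.comp (measurable_const_smul _), 1, fun x => by
      rw [abs_of_nonneg (h.nn _)]; exact h.le _⟩
  have := b.intOn (A := ball 0 R) measure_ball_lt_top.ne
  apply this.integrable_of_forall_notMem_eq_zero
  intro x hx
  rw [h.z' hR (by simpa using hx), mul_zero]

lemma IsW.intg1 {W : E3 → ℝ} (h : IsW W) {R : ℝ} (hR : 0 < R) :
    Integrable (fun x => W (R⁻¹ • x)) := by
  simpa using h.intg hR (BM.const 1)

lemma mn_le {W : E3 → ℝ} (hW : IsW W) {v : E3 → ℝ} (bv : BM v) (hv : ∀ x, |v x| ≤ M) {R : ℝ}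
    (hR : 0 < R) : |mn W v R| ≤ M := by
  have hI := hW.pos
  rw [mn, abs_div, abs_of_pos (by positivity : 0 < R ^ 3 * ∫ x, W x), div_le_iff₀ (by positivity),
    ← scale_int W hR, ← integral_const_mul]
  refine abs_integral_le_integral_abs.trans (integral_mono (hW.intg hR bv).abs
    ((hW.intg1 hR).const_mul _) fun x => ?_)
  show |v x * W (R⁻¹ • x)| ≤ M * W (R⁻¹ • x)
  rw [abs_mul, abs_of_nonneg (hW.nn _)]
  exact mul_le_mul_of_nonneg_right (hv x) (hW.nn _)

lemma Sol.step (S : Sol r c Ω T u v U M) (hr : 1 ≤ r) (hc : 0 < c) {η ρ Q a : ℝ} {m : ℕ}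
    (hm : ∫ y, Ps m y ≤ η) (hQk : kk r c ≤ Q) (hρ : 2 * (m * Q + 1) ≤ ρ) (hb : ball (0:E3) ρ ⊆ Ω)
    (ha : |a| ≤ M) :
    (v 0 - a) ^ 2 ≤ CP r c * (η * ((1 + C1 r) * M) ^ 2 +
      m * (Q ^ 3)⁻¹ * (∫ x in ball 0 (m * Q), (v x - a) ^ 2) +
      CD r c * Zp * (1 + C1 r) * Q ^ 2 * (U * M + 2 * Ci r c / ρ * M ^ 2)) := by
  have hk := kk1 r c
  have hP := CP_nonneg r hc
  have hZ := Zp_nonneg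
  have hCD := CD_nonneg r hc
  have hU := S.U0
  have hM := S.M0
  have hC1 := C1_nonneg r
  have hCi := Ci_nonneg r hc
  have hQ0 : 0 < Q := by linarith
  have hmQ : 0 ≤ m * Q := by positivity
  have hρ0 : 0 < ρ := by linarith
  obtain ⟨φ, hφ, φ1, φ2, φ3⟩ := S.mesh.cut hr hc (by linarith) hb
  obtain ⟨K1, l1⟩ := S.mesh.lip S.vp
  obtain ⟨K2, l2⟩ := S.mesh.lip hφ
  have hw := S.vp.sub_smul hφ a
  set w : E3 → ℝ := fun x => v x - a * φ x with hwdef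
  obtain ⟨K3, l3⟩ := S.mesh.lip hw
  have hB : ∀ x, |w x| ≤ (1 + C1 r) * M := by
    intro x
    have h1 := abs_sub (v x) (a * φ x)
    have h2 := S.vM x
    have h3 : |a * φ x| ≤ M * C1 r := by rw [abs_mul]; gcongr; exact φ1 x
    simp only [hwdef]; linarith
  have hw0 : ∀ x, ‖x‖ ≤ m * Q → w x = v x - a := by
    intro x hx
    simp only [hwdef]; rw [φ2 x (by linarith), mul_one]
  have h1 := S.mesh.pe hr hc S.z0 hw hQk
  rw [hw0 0 (by simpa using hmQ)] at h1
  have h2 := S.dataV hr hc hw hB hQk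
  have h3 := S.mesh.data hr hc hw hk hQk hB l2 (Or.inr φ3)
  have h4 := S.mesh.w_split hk (hk.trans hQk) hm (S.mesh.lbm l3 hw.1) hB
  have h5 : ∫ x in ball 0 (m * Q), w x ^ 2 = ∫ x in ball 0 (m * Q), (v x - a) ^ 2 := by
    apply setIntegral_congr_fun measurableSet_ball
    intro x hx
    rw [mem_ball_zero_iff] at hx
    simp only [hw0 x hx.le]
  rw [h5] at h4
  have h6 := S.mesh.int_q hk (hk.trans hQk)
  have hχ := S.mesh.test hr hw (wq (kk r c) Q)
  set χ := gI r T (fun y => wq (kk r c) Q y * w y)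
  obtain ⟨K4, l4⟩ := S.mesh.lip hχ
  have e : ∫ x in Ω, ∑ i, pd i w x * pd i χ x = (∫ x in Ω, ∑ i, pd i v x * pd i χ x) -
      a * ∫ x in Ω, ∑ i, pd i φ x * pd i χ x := by
    rw [← integral_const_mul,
      ← integral_sub (S.mesh.int' (BM.sum fun i => (BM.pd l1 i).mul (BM.pd l4 i)))
      (S.mesh.int' ((BM.sum fun i => (BM.pd l2 i).mul (BM.pd l4 i)).smul a))]
    apply integral_congr_ae
    obtain ⟨K5, l5⟩ : ∃ K, LipschitzWith K fun y => a * φ y := by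
      exact ⟨_, (lipschitzWith_smul a).comp l2⟩
    filter_upwards [ae_restrict_of_ae (pd_sub_ae l1 l5), ae_restrict_of_ae (pd_smul_ae l2 a)]
      with x hx hx2
    rw [Finset.mul_sum, ← Finset.sum_sub_distrib]
    exact Finset.sum_congr rfl fun i _ => by rw [hx i, hx2 i]; ring
  have h7 : |∫ x in Ω, ∑ i, pd i w x * pd i χ x| ≤
      CD r c * Zp * (1 + C1 r) * Q ^ 2 * (U * M + 2 * Ci r c / ρ * M ^ 2) := by
    rw [e]
    refine (abs_sub _ _).trans ?_
    rw [abs_mul]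
    calc _ ≤ CD r c * Zp * U * ((1 + C1 r) * M) * Q ^ 2 +
          M * (CD r c * (Ci r c * (2 / ρ)) * ((1 + C1 r) * M) * (Zp * Q ^ 2)) := by
          gcongr
          exact h3.trans (by gcongr)
      _ = _ := by ring
  refine h1.trans ?_
  gcongr

lemma int_arith {P ε A D ρ C U M Ci C1 J G X : ℝ} (hP : 0 ≤ P) (hε : 0 < ε) (hA : 0 ≤ A) (hD : 0 ≤ D)
    (hρ : 0 < ρ) (hC : 0 ≤ C) (hU : 0 ≤ U) (hM : 0 ≤ M) (hCi : 0 ≤ Ci) (hC1 : 0 ≤ C1)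
    (h3 : J ≤ A * G) (hG : G ≤ ε / (3 * (P + 1)) / (A + 1) * M ^ 2 + C * (U * M))
    (hρ2 : D * (2 * Ci) / (ε / (3 * (P + 1))) ≤ ρ)
    (h1 : X ≤ P * (ε / (3 * (P + 1)) / (1 + C1) ^ 2 * ((1 + C1) * M) ^ 2 + J +
      D * (U * M + 2 * Ci / ρ * M ^ 2))) : X ≤ ε * M ^ 2 + P * (A * C + D) * (U * M) := by
  obtain ⟨e1, he1⟩ : ∃ e1, e1 = ε / (3 * (P + 1)) := ⟨_, rfl⟩
  have hp : 0 < e1 := by rw [he1]; positivity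
  have hE : 3 * (P * e1) ≤ ε := by
    rw [he1, mul_div_assoc', mul_div_assoc', div_le_iff₀ (by positivity)]; nlinarith
  rw [← he1] at hG hρ2 h1
  have h4 : J ≤ e1 * M ^ 2 + A * C * (U * M) := by
    have : A * (e1 / (A + 1) * M ^ 2) ≤ e1 * M ^ 2 := by
      rw [← mul_assoc]
      gcongr
      rw [mul_div_assoc', div_le_iff₀ (by positivity)]; nlinarith
    nlinarith [mul_le_mul_of_nonneg_left hG hA]
  have h5 : D * (2 * Ci / ρ * M ^ 2) ≤ e1 * M ^ 2 := by
    rw [← mul_assoc]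
    gcongr
    rw [div_le_iff₀ hp] at hρ2
    rw [mul_div_assoc', div_le_iff₀ hρ]; linarith
  have h6 : e1 / (1 + C1) ^ 2 * ((1 + C1) * M) ^ 2 = e1 * M ^ 2 := by field_simp
  rw [h6] at h1
  calc X ≤ _ := h1
    _ ≤ P * (e1 * M ^ 2 + (e1 * M ^ 2 + A * C * (U * M)) + (D * (U * M) + e1 * M ^ 2)) := by
        rw [mul_add D]; gcongr
    _ = 3 * (P * e1) * M ^ 2 + P * (A * C + D) * (U * M) := by ring
    _ ≤ _ := by gcongr

lemma meanQ {f : E3 → ℝ} {K : ℝ≥0} (l : LipschitzWith K f) (bf : BM f) {W : E3 → ℝ} (hW : IsW W)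
    {m Q : ℝ} (hm : 1 ≤ m) (hQ0 : 0 < Q) :
    m * (Q ^ 3)⁻¹ * (∫ x in ball 0 (m * Q), (f x - mn W f Q) ^ 2) ≤
      96 * m ^ 7 * volume.real (ball (0:E3) 1) / (∫ x, W x) *
        ((3 * (m * Q))⁻¹ * ∫ x in ball (0:E3) (3 * (m * Q)), ∑ i, pd i f x ^ 2) := by
  have hm0 : 0 < m := by linarith
  have hI := hW.pos
  have h2 := meanP l bf (b := m * Q) (by positivity) (W := fun x => W (Q⁻¹ • x)) (a := mn W f Q)
    ⟨hW.m.comp (measurable_const_smul _), 1, fun x => by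
      rw [abs_of_nonneg (hW.nn _)]; exact hW.le _⟩ (fun x => hW.nn _) (fun x => hW.le _)
    (fun x hx => hW.z' hQ0 (by rw [mem_ball_zero_iff, not_lt] at hx; nlinarith))
    (by rw [scale_int W hQ0, mn, div_mul_cancel₀ _ (by positivity)])
  rw [scale_int W hQ0, Measure.real, Measure.addHaar_ball volume _ (by positivity),
    finrank_euclideanSpace_fin, ENNReal.toReal_mul, ENNReal.toReal_ofReal (by positivity)] at h2
  change _ ≤ (2 * (m * Q)) ^ 3 * volume.real (ball (0:E3) 1) * _ at h2
  generalize (∫ x in ball 0 (m * Q), (f x - mn W f Q) ^ 2) = J at *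
  generalize (∫ x in ball (0:E3) (3 * (m * Q)), ∑ i, pd i f x ^ 2) = I at *
  generalize volume.real (ball (0:E3) 1) = V at *
  generalize (∫ x, W x) = IW at *
  calc _ = m * (Q ^ 3)⁻¹ * ((Q ^ 3 * IW)⁻¹ * (Q ^ 3 * IW * J)) := by field_simp
    _ ≤ m * (Q ^ 3)⁻¹ * ((Q ^ 3 * IW)⁻¹ * ((2 * (m * Q)) ^ 3 * V * ((2 * (m * Q)) ^ 2 * I))) := by
        gcongr
    _ = _ := by field_simp; ring

lemma Sol.interior (r : ℕ) (hr : 1 ≤ r) {c : ℝ} (hc : 0 < c) {W : E3 → ℝ} (hW : IsW W) {ε : ℝ}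
    (hε : 0 < ε) (R0 : ℝ) :
    ∃ L0 C R1 : ℝ, 0 ≤ C ∧ ∀ (Ω : Set E3) (T : Finset (Fin 4 → E3)) (u v : E3 → ℝ) (U M : ℝ),
      Sol r c Ω T u v U M → ∀ ρ, L0 ≤ ρ → ball (0:E3) ρ ⊆ Ω → ∃ Q, R0 ≤ Q ∧ Q ≤ R1 ∧
        (v 0 - mn W v Q) ^ 2 ≤ ε * M ^ 2 + C * (U * M) := by
  have hk := kk1 r c
  have hP := CP_nonneg r hc
  have hZ := Zp_nonneg
  have hCD := CD_nonneg r hc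
  have hC1 := C1_nonneg r
  have hCi := Ci_nonneg r hc
  have hI := hW.pos
  set IW := ∫ x, W x
  set P := CP r c
  set V := volume.real (ball (0:E3) 1)
  have hV : 0 ≤ V := measureReal_nonneg
  set ε1 := ε / (3 * (P + 1)) with hε1
  have hε1p : 0 < ε1 := by positivity
  obtain ⟨m, hm1, hm⟩ := Ps_lim (show 0 < ε1 / (1 + C1 r) ^ 2 by positivity)
  have hm1' : (1:ℝ) ≤ m := by exact_mod_cast hm1
  have hm0 : (0:ℝ) < m := by linarith
  set A := 96 * m ^ 7 * V / IW with hA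
  have hA0 : 0 ≤ A := by positivity
  obtain ⟨R1, C, hC, H⟩ := Sol.ball_small (r := r) hr hc
    (show 0 < ε1 / (A + 1) by positivity)
    (R0 := max (3 * m * kk r c) (3 * m * R0)) ((le_max_left _ _).trans' (by nlinarith))
  set D := CD r c * Zp * (1 + C1 r) * R1 ^ 2 with hD
  have hD0 : 0 ≤ D := by positivity
  refine ⟨max (2 * (R1 + 1)) (D * (2 * Ci r c) / ε1), P * (A * C + D), R1, by positivity, ?_⟩
  intro Ω T u v U M S ρ hρ hb
  obtain ⟨R, hR0, hR1, hG⟩ := H Ω T u v U M S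
  have hU := S.U0
  have hM := S.M0
  have hρ1 := (le_max_left _ _).trans hρ
  have hρ2 := (le_max_right _ _).trans hρ
  have hRk := (le_max_left _ _).trans hR0
  have hRR := (le_max_right _ _).trans hR0
  set Q := R / (3 * m) with hQ
  have hQk : kk r c ≤ Q := by rw [hQ, le_div_iff₀ (by positivity)]; linarith
  have hQR0 : R0 ≤ Q := by rw [hQ, le_div_iff₀ (by positivity)]; linarith
  have hQ1 : 1 ≤ Q := hk.trans hQk
  have hQ0 : 0 < Q := by linarith
  have hRQ : R = 3 * (m * Q) := by rw [hQ]; field_simp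
  have hmQ : 0 < m * Q := by positivity
  have hQR1 : Q ≤ R1 := by nlinarith
  have hρ0 : 0 < ρ := by linarith
  obtain ⟨K, l⟩ := S.mesh.lip S.vp
  have bv := S.mesh.lbm l S.vp.1
  refine ⟨Q, hQR0, hQR1, ?_⟩
  have h1 := S.step hr hc (a := mn W v Q) hm hQk (by linarith) hb (mn_le hW bv S.vM hQ0)
  set a := mn W v Q with ha
  have h3 := meanQ l bv hW (m := m) (Q := Q) hm1' hQ0
  rw [← hRQ] at h3
  have hDQ : CD r c * Zp * (1 + C1 r) * Q ^ 2 ≤ D :=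
    mul_le_mul_of_nonneg_left (pow_le_pow_left₀ hQ0.le hQR1 2) (by positivity)
  have hX : 0 ≤ U * M + 2 * Ci r c / ρ * M ^ 2 := by positivity
  exact int_arith hP hε hA0 hD0 hρ0 hC hU hM hCi hC1 h3 hG hρ2 (h1.trans
    (mul_le_mul_of_nonneg_left (add_le_add le_rfl (mul_le_mul_of_nonneg_right hDQ hX)) hP))

lemma norm_fd1 {F : Type*} [NormedAddCommGroup F] [NormedSpace ℝ F] (g : E3 → F) (x : E3) :
    ‖fderiv ℝ g x‖ = ‖iteratedFDeriv ℝ 1 g x‖ := by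
  rw [← norm_iteratedFDeriv_fderiv, norm_iteratedFDeriv_zero]

lemma quad_expand (B : E3 →L[ℝ] E3 →L[ℝ] ℝ) (y : E3) :
    B y y = ∑ i, ∑ j, B (bs i) (bs j) * (y i * y j) := by
  have hy : y = ∑ i, y i • bs i := by
    ext k; fin_cases k <;> simp [bs, Fin.sum_univ_three]
  conv_lhs => rw [hy]
  simp only [map_sum, map_smul, _root_.sum_apply, _root_.smul_apply, smul_eq_mul, Finset.mul_sum]
  rw [Finset.sum_comm]
  refine Finset.sum_congr rfl fun i _ => Finset.sum_congr rfl fun j _ => ?_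
  ring

lemma tay (hr : 2 ≤ r) {w : Fin 4 → E3} {L : Fin 4 → AF} (h : Tet1 c w L) {z : E3 → ℝ}
    (hz : ContDiff ℝ 3 z) {Λ : ℝ} (hΛ : ∀ x, ‖iteratedFDeriv ℝ 3 z x‖ ≤ Λ) :
    ∃ P, Pol3 r P ∧ ∀ x ∈ tet w, |z x - P x| ≤ Λ ∧ ‖fderiv ℝ (fun y => z y - P y) x‖ ≤ Λ ∧
      ‖fderiv ℝ (fderiv ℝ (fun y => z y - P y)) x‖ ≤ Λ := by
  have z1 : ContDiff ℝ 2 (fderiv ℝ z) := hz.fderiv_right (by norm_num)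
  have z2 : ContDiff ℝ 1 (fderiv ℝ (fderiv ℝ z)) := z1.fderiv_right (by norm_num)
  have dz : Differentiable ℝ z := hz.differentiable (by norm_num)
  have dz1 : Differentiable ℝ (fderiv ℝ z) := z1.differentiable (by norm_num)
  have dz2 : Differentiable ℝ (fderiv ℝ (fderiv ℝ z)) := z2.differentiable (by norm_num)
  set x0 := w 0
  have hx0 : x0 ∈ tet w := vert_mem w 0
  set D := fderiv ℝ z x0
  set D2 := fderiv ℝ (fderiv ℝ z) x0
  have hs : ∀ a b, D2 a b = D2 b a :=
    (hz.contDiffAt.isSymmSndFDerivAt (by simp; norm_num)).eq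
  set P : E3 → ℝ := fun x => z x0 + D (x - x0) + 1 / 2 * D2 (x - x0) (x - x0) with hP
  have dP : ∀ x, HasFDerivAt P (D + D2 (x - x0)) x := by
    intro x
    have hid : HasFDerivAt (fun y : E3 => y - x0) (ContinuousLinearMap.id ℝ E3) x :=
      (hasFDerivAt_id x).sub_const x0
    have h1 := D2.hasFDerivAt_of_bilinear hid hid
    have h2 : HasFDerivAt (fun y : E3 => D (y - x0)) _ x := D.hasFDerivAt.comp x hid
    have h3 := (h2.const_add (z x0)).add (h1.const_mul (1 / 2))
    refine h3.congr_fderiv ?_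
    ext y
    have := hs y (x - x0)
    simp at this ⊢
    linarith
  have fP : fderiv ℝ (fun y => z y - P y) = fun x => fderiv ℝ z x - (D + D2 (x - x0)) := by
    ext1 x
    have : HasFDerivAt (fun y => z y - P y) _ x := (dz x).hasFDerivAt.sub (dP x)
    exact this.fderiv
  have fP2 : ∀ x, fderiv ℝ (fderiv ℝ (fun y => z y - P y)) x = fderiv ℝ (fderiv ℝ z) x - D2 := by
    intro x
    rw [fP]
    have hid : HasFDerivAt (fun y : E3 => y - x0) (ContinuousLinearMap.id ℝ E3) x :=
      (hasFDerivAt_id x).sub_const x0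
    have h2 : HasFDerivAt (fun y : E3 => D2 (y - x0)) _ x := D2.hasFDerivAt.comp x hid
    have h3 : HasFDerivAt (fun x => fderiv ℝ z x - (D + D2 (x - x0))) _ x :=
      (dz1 x).hasFDerivAt.sub (h2.const_add D)
    rw [h3.fderiv]; rfl
  have hΛ0 : 0 ≤ Λ := (norm_nonneg _).trans (hΛ 0)
  have b2 : ∀ x ∈ tet w, ‖fderiv ℝ (fderiv ℝ (fun y => z y - P y)) x‖ ≤ Λ := by
    intro x hx
    rw [fP2]
    have := Convex.norm_image_sub_le_of_norm_fderiv_le (f := fderiv ℝ (fderiv ℝ z)) (𝕜 := ℝ)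
      (fun x _ => dz2 x) (fun x _ => by
        rw [norm_fd1, norm_iteratedFDeriv_fderiv, norm_iteratedFDeriv_fderiv]; exact hΛ x) (tet_convex w) hx0 hx
    refine this.trans (mul_le_of_le_one_right hΛ0 ?_)
    rw [← dist_eq_norm]; exact h.dist_le hx hx0
  have d1 : Differentiable ℝ (fderiv ℝ (fun y => z y - P y)) := by
    rw [fP]; fun_prop
  have b1 : ∀ x ∈ tet w, ‖fderiv ℝ (fun y => z y - P y) x‖ ≤ Λ := by
    intro x hx
    have := Convex.norm_image_sub_le_of_norm_fderiv_le (f := fderiv ℝ (fun y => z y - P y)) (𝕜 := ℝ)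
      (fun x _ => d1 x) b2 (tet_convex w) hx0 hx
    have e0 : fderiv ℝ (fun y => z y - P y) x0 = 0 := by rw [fP]; simp [D]
    rw [e0, sub_zero] at this
    refine this.trans (mul_le_of_le_one_right hΛ0 ?_)
    rw [← dist_eq_norm]; exact h.dist_le hx hx0
  refine ⟨P, ?_, fun x hx => ⟨?_, b1 x hx, b2 x hx⟩⟩
  · have e : P = fun x => (ev (D, z x0 - D x0) x) + ∑ i, ∑ j, (1 / 2 * D2 (bs i) (bs j)) *
        (ev (EuclideanSpace.proj i, -x0 i) x * ev (EuclideanSpace.proj j, -x0 j) x) := by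
      ext x
      simp only [hP, ev]
      rw [quad_expand D2, Finset.mul_sum]
      congr 1
      · rw [map_sub]; ring
      · refine Finset.sum_congr rfl fun i _ => ?_
        rw [Finset.mul_sum]
        refine Finset.sum_congr rfl fun j _ => ?_
        simp only [PiLp.sub_apply, show ∀ k, EuclideanSpace.proj k x = x k from fun k => rfl]
        ring
    rw [e]
    exact (Pol3.lin (by omega) _).add (Pol3.sum _ fun i => Pol3.sum _ fun j =>
      (Pol3.quad hr _ _).smul _)
  · have dzP : Differentiable ℝ (fun y => z y - P y) := dz.sub fun x => (dP x).differentiableAt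
    have := h.mvt dzP b1 hx hx0
    have e0 : z x0 - P x0 = 0 := by simp [hP]
    rwa [e0, sub_zero] at this

/-- local constant of the consistency estimate -/
def CL (r : ℕ) (c : ℝ) : ℝ := 3 * (3 * (1 + Ci r c) / c + (1 + Ci r c * Ci r c))

lemma pdpd_le (i : Fin 3) {f : E3 → ℝ} {x : E3} (hf : DifferentiableAt ℝ (fderiv ℝ f) x) :
    |pd i (pd i f) x| ≤ ‖fderiv ℝ (fderiv ℝ f) x‖ := by
  have h : HasFDerivAt (fun y => fderiv ℝ f y (bs i)) _ x :=
    hf.hasFDerivAt.clm_apply (hasFDerivAt_const (bs i) x)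
  have e : pd i (pd i f) x = (fderiv ℝ (fderiv ℝ f) x (bs i)) (bs i) := by
    show fderiv ℝ (fun y => fderiv ℝ f y (bs i)) x (bs i) = _
    rw [h.fderiv]; simp
  rw [e, ← Real.norm_eq_abs]
  refine (ContinuousLinearMap.le_opNorm₂ _ _ _).trans ?_
  rw [bs_norm]; simp

lemma loc_T (hr : 2 ≤ r) (hc : 0 < c) {w : Fin 4 → E3} {L : Fin 4 → AF} (h : Tet1 c w L)
    {z : E3 → ℝ} (hz : ContDiff ℝ 3 z) {Λ : ℝ} (hΛ : ∀ x, ‖iteratedFDeriv ℝ 3 z x‖ ≤ Λ)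
    {e : E3 → ℝ} {K : ℝ≥0} (he : LipschitzWith K e) {N : ℝ} (heN : ∀ x, |e x| ≤ N) :
    |∫ x in tet w, ∑ i, pd i e x * pd i (fun y => z y - ipol r w L z y) x| ≤
      CL r c * N * Λ * volume.real (tet w) := by
  have hr1 : 1 ≤ r := by omega
  obtain ⟨P, hP, hb⟩ := tay hr h hz hΛ
  have hCi := Ci_nonneg r hc
  have hN : 0 ≤ N := (abs_nonneg _).trans (heN 0)
  set Rm : E3 → ℝ := fun y => z y - P y with hRm
  have cR : ContDiff ℝ 3 Rm := hz.sub (hP.contDiff 3)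
  have pI : Pol3 r (ipol r w L Rm) := ipol_pol r w L Rm
  have eq : (fun y => z y - ipol r w L z y) = fun y => Rm y - ipol r w L Rm y := by
    ext y
    have : ipol r w L z y = ipol r w L (fun x => Rm x + P x) y := by simp [hRm]
    rw [this, ipol_add, ipol_poly hr1 h.1 hP]; simp [hRm]; ring
  rw [eq]
  have dR : Differentiable ℝ Rm := cR.differentiable (by norm_num)
  have pde : ∀ i, pd i (fun y => Rm y - ipol r w L Rm y) =
      fun x => pd i Rm x - pd i (ipol r w L Rm) x := by
    intro i; ext x
    have : HasFDerivAt (fun y => Rm y - ipol r w L Rm y) _ x :=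
      (dR x).hasFDerivAt.sub (pI.diff x).hasFDerivAt
    unfold pd; rw [this.fderiv]; rfl
  have cpR : ∀ i, ContDiff ℝ 1 (pd i Rm) := fun i => by
    have : ContDiff ℝ 2 (fderiv ℝ Rm) := cR.fderiv_right (by norm_num)
    exact (this.of_le (by norm_num)).clm_apply contDiff_const
  have dR1 : Differentiable ℝ (fderiv ℝ Rm) :=
    (cR.fderiv_right (m := 2) (by norm_num)).differentiable (by norm_num)
  obtain ⟨xc, hxc⟩ := h.2.2
  have bI : ∀ x ∈ tet w, ‖fderiv ℝ (ipol r w L Rm) x‖ ≤ Ci r c * Λ := fun x hx =>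
    fderiv_ipol_le hr1 hc h (fun y hy => (hb y hy).1) hx
  have key : ∀ i, |∫ x in tet w, pd i e x * pd i (fun y => Rm y - ipol r w L Rm y) x| ≤
      N * volume.real (tet w) * (3 * ((1 + Ci r c) * Λ) / c + (1 + Ci r c * Ci r c) * Λ) := by
    intro i
    rw [pde i]
    apply tv hc (tet_compact w) (tet_convex w) hxc he heN ((cpR i).sub ((pI.pd i).contDiff 1)) i
    · intro x hx
      refine (abs_sub _ _).trans ?_
      have h1 := (pd_le i Rm x).trans (hb x hx).2.1
      have h2 := (pd_le i (ipol r w L Rm) x).trans (bI x hx)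
      linarith
    · intro x hx
      have : HasFDerivAt (fun y => pd i Rm y - pd i (ipol r w L Rm) y) _ x :=
        ((cpR i).differentiable (by norm_num) x).hasFDerivAt.sub ((pI.pd i).diff x).hasFDerivAt
      have e2 : pd i (fun y => pd i Rm y - pd i (ipol r w L Rm) y) x =
          pd i (pd i Rm) x - pd i (pd i (ipol r w L Rm)) x := by
        conv_lhs => unfold pd
        exact congrArg (· (bs i)) this.fderiv
      rw [e2]
      refine (abs_sub _ _).trans ?_
      have h1 := (pdpd_le i (dR1 x)).trans (hb x hx).2.2
      have h2 := (pd_le i _ x).trans (inv_est hr1 hc h (pI.pd i)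
        (fun y hy => (pd_le i _ y).trans (bI y hy)) hx)
      linarith
  have fin : volume (tet w) ≠ ⊤ := (tet_compact w).measure_lt_top.ne
  rw [integral_finsetSum]
  · refine (Finset.abs_sum_le_sum_abs _ _).trans ((Finset.sum_le_sum fun i _ => key i).trans ?_)
    apply le_of_eq
    simp only [Finset.sum_const, Finset.card_univ, Fintype.card_fin, nsmul_eq_mul, CL]
    field_simp
    push_cast; ring
  · intro i _
    rw [pde i]
    obtain ⟨m1, B1, hB1⟩ := BM.pd he i
    have hcont : Continuous fun x => pd i Rm x - pd i (ipol r w L Rm) x :=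
      (cpR i).continuous.sub ((pI.pd i).contDiff 0).continuous
    have : IntegrableOn (fun x => pd i Rm x - pd i (ipol r w L Rm) x) (tet w) :=
      hcont.continuousOn.integrableOn_compact (tet_compact w)
    exact Integrable.bdd_mul this m1.aestronglyMeasurable (Filter.Eventually.of_forall hB1)

lemma CL_nonneg (r : ℕ) (hc : 0 < c) : 0 ≤ CL r c := by
  have := Ci_nonneg r hc
  unfold CL; positivity

def CT (r : ℕ) (c : ℝ) : ℝ := CL r c * 8 * volume.real (closedBall (0:E3) 1)

lemma CT_nonneg (r : ℕ) (hc : 0 < c) : 0 ≤ CT r c := by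
  have := CL_nonneg r hc
  unfold CT; positivity

lemma Mesh.glob (h : Mesh c Ω T) (hr : 2 ≤ r) (hc : 0 < c) {z : E3 → ℝ} (hz : ContDiff ℝ 3 z)
    {Λ : ℝ} (hΛ : ∀ x, ‖iteratedFDeriv ℝ 3 z x‖ ≤ Λ) {y : E3} {s : ℝ} (hs : 1 ≤ s)
    (zs : ∀ x ∉ closedBall y s, z x = 0) (zb : ∀ x ∈ frontier Ω, z x = 0)
    {e : E3 → ℝ} {K : ℝ≥0} (he : LipschitzWith K e) {N : ℝ} (heN : ∀ x, |e x| ≤ N) :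
    |∫ x in Ω, ∑ i, pd i e x * pd i (fun y => z y - gI r T z y) x| ≤ CT r c * N * Λ * s ^ 3 := by
  have hr1 : 1 ≤ r := by omega
  have hN : 0 ≤ N := (abs_nonneg _).trans (heN 0)
  have hΛ0 : 0 ≤ Λ := (norm_nonneg _).trans (hΛ 0)
  have hCL := CL_nonneg r hc
  have zc : HasCompactSupport z := HasCompactSupport.intro (isCompact_closedBall y s) zs
  obtain ⟨K1, l1⟩ := hz.lipschitzWith_of_hasCompactSupport zc (by norm_num)
  obtain ⟨K2, l2⟩ := h.lip (h.gI_pw hr1 zb)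
  have l3 : LipschitzWith _ (fun y => z y - gI r T z y) := l1.sub l2
  set A := CL r c * N * Λ
  have hA : 0 ≤ A := by positivity
  set H : E3 → ℝ := (closedBall y (s + 1)).indicator fun _ => A with hH
  have bH : BM H := ⟨measurable_const.indicator measurableSet_closedBall, A, fun x => by
    by_cases hx : x ∈ closedBall y (s + 1)
    · rw [hH, indicator_of_mem hx, abs_of_nonneg hA]
    · rw [hH, indicator_of_notMem hx, abs_zero]; exact hA⟩
  have hH0 : ∀ x, 0 ≤ H x := fun x => indicator_nonneg (fun _ _ => hA) x
  have h1 := h.sum_le (G := fun x => ∑ i, pd i e x * pd i (fun y => z y - gI r T z y) x) (H := H)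
    (h.int (BM.sum fun i => (BM.pd he i).mul (BM.pd l3 i))) (h.int bH) (by
      intro w hw
      have ht := h.tet1 hw
      have e1 : ∫ x in tet w, ∑ i, pd i e x * pd i (fun y => z y - gI r T z y) x =
          ∫ x in tet w, ∑ i, pd i e x * pd i (fun y => z y - ipol r w (lam w) z y) x := by
        apply integral_congr_ae
        filter_upwards [tet_ae_int w] with x hx
        refine Finset.sum_congr rfl fun i _ => ?_
        congr 1
        unfold pd
        rw [fderiv_eq_tet (fun y hy => ?_) hx]
        rw [h.gI_eq r z hw hy]
      rw [e1]
      by_cases hi : ∃ x ∈ tet w, x ∈ closedBall y s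
      · obtain ⟨x, hx, hxb⟩ := hi
        refine (loc_T hr hc ht hz hΛ he heN).trans ?_
        have : ∫ x in tet w, H x = ∫ x in tet w, A := by
          apply setIntegral_congr_fun (tet_compact w).measurableSet
          intro p hp
          rw [hH, indicator_of_mem]
          rw [mem_closedBall] at *
          have := ht.dist_le hp hx
          linarith [dist_triangle p x y]
        rw [this, setIntegral_const, smul_eq_mul, mul_comm]
      · push Not at hi
        have : ∫ x in tet w, ∑ i, pd i e x * pd i (fun y => z y - ipol r w (lam w) z y) x = 0 := by
          rw [← integral_zero E3 ℝ (μ := volume.restrict (tet w))]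
          apply integral_congr_ae
          filter_upwards [tet_ae_int w] with x hx
          apply Finset.sum_eq_zero
          intro i _
          unfold pd
          rw [fderiv_eq_tet (f := fun y => z y - ipol r w (lam w) z y) (p := fun _ => 0)
            (fun p hp => ?_) hx]
          · simp
          · rw [ipol_congr hr1 ht.1 (w := fun _ => 0) (fun q hq => zs q (hi q hq)) hp,
              ipol_poly hr1 ht.1 (Pol3.const hr1 0), zs p (hi p hp), sub_zero]
        rw [this, abs_zero]
        exact integral_nonneg hH0)
  refine h1.trans ?_
  have iH : Integrable H := (integrable_indicator_iff measurableSet_closedBall).2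
    (integrableOn_const measure_closedBall_lt_top.ne)
  calc ∫ x in Ω, H x ≤ ∫ x, H x := setIntegral_le_integral iH (Filter.Eventually.of_forall hH0)
    _ = volume.real (closedBall y (s + 1)) * A := by
      rw [hH, integral_indicator measurableSet_closedBall, setIntegral_const, smul_eq_mul]
    _ = (s + 1) ^ 3 * volume.real (closedBall (0:E3) 1) * A := by
      rw [Measure.real, Measure.addHaar_closedBall' volume _ (by positivity),
        finrank_euclideanSpace_fin, ENNReal.toReal_mul, ENNReal.toReal_ofReal (by positivity)]; rfl
    _ ≤ (2 * s) ^ 3 * volume.real (closedBall (0:E3) 1) * A := by gcongr; linarith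
    _ = _ := by simp only [A, CT]; ring

lemma Sol.testT (S : Sol r c Ω T u v U M) (hr : 2 ≤ r) (hc : 0 < c) {z : E3 → ℝ}
    (hz : ContDiff ℝ 3 z) {Λ : ℝ} (hΛ : ∀ x, ‖iteratedFDeriv ℝ 3 z x‖ ≤ Λ) {y : E3} {s : ℝ}
    (hs : 1 ≤ s) (zs : ∀ x ∉ closedBall y s, z x = 0) (zb : ∀ x ∈ frontier Ω, z x = 0) :
    |∫ x, (u x - v x) * ∑ i, pd i (pd i z) x| ≤ CT r c * (U + M) * Λ * s ^ 3 := by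
  have hr1 : 1 ≤ r := by omega
  obtain ⟨K1, l1⟩ := S.ul
  obtain ⟨K2, l2⟩ := S.mesh.lip S.vp
  have le : LipschitzWith _ (fun y => u y - v y) := l1.sub l2
  set e : E3 → ℝ := fun y => u y - v y with he
  have zc : HasCompactSupport z := HasCompactSupport.intro (isCompact_closedBall y s) zs
  obtain ⟨K3, l3⟩ := hz.lipschitzWith_of_hasCompactSupport zc (by norm_num)
  have hpw := S.mesh.gI_pw hr1 zb
  obtain ⟨K4, l4⟩ := S.mesh.lip hpw
  have h1 := S.mesh.glob hr hc hz hΛ hs zs zb le (N := U + M) (fun x =>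
    (abs_sub _ _).trans (add_le_add (S.uU x) (S.vM x)))
  have h2 : ∫ x in Ω, ∑ i, pd i e x * pd i (fun y => z y - gI r T z y) x =
      (∫ x in Ω, ∑ i, pd i e x * pd i z x) - ∫ x in Ω, ∑ i, pd i e x * pd i (gI r T z) x := by
    rw [← integral_sub (S.mesh.int' (BM.sum fun i => (BM.pd le i).mul (BM.pd l3 i)))
      (S.mesh.int' (BM.sum fun i => (BM.pd le i).mul (BM.pd l4 i)))]
    apply integral_congr_ae
    filter_upwards [ae_restrict_of_ae (pd_sub_ae l3 l4)] with x hx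
    rw [← Finset.sum_sub_distrib]
    exact Finset.sum_congr rfl fun i _ => by rw [hx i]; ring
  rw [h2, S.orth _ hpw, sub_zero] at h1
  have ez : ∀ x ∉ Ω, e x = 0 := fun x hx => by simp [he, S.uz x hx, S.vp.1 x hx]
  have h3 : ∫ x in Ω, ∑ i, pd i e x * pd i z x = ∫ x, ∑ i, pd i e x * pd i z x := by
    apply setIntegral_eq_integral_of_ae_compl_eq_zero
    filter_upwards [S.mesh.pd_out ez] with x hx hxo
    simp [hx hxo]
  have c1 : ∀ i, ContDiff ℝ 2 (pd i z) := fun i =>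
    (hz.fderiv_right (m := 2) (by norm_num)).clm_apply contDiff_const
  have cs : ∀ i, HasCompactSupport (pd i z) := fun i => zc.fderiv_apply ℝ (bs i)
  have ec : HasCompactSupport e := S.mesh.cs ez
  have h4 : ∫ x, ∑ i, pd i e x * pd i z x = - ∫ x, e x * ∑ i, pd i (pd i z) x := by
    have c2 : ∀ i, Continuous (pd i (pd i z)) := fun i =>
      ((c1 i).continuous_fderiv (by norm_num)).clm_apply continuous_const
    simp_rw [Finset.mul_sum]
    rw [integral_finsetSum, integral_finsetSum, ← Finset.sum_neg_distrib]
    · refine Finset.sum_congr rfl fun i _ => ?_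
      obtain ⟨K5, l5⟩ := (c1 i).lipschitzWith_of_hasCompactSupport (cs i) (by norm_num)
      exact ibp le l5 (cs i) i
    · intro i _
      exact ((le.continuous.mul (c2 i)).integrable_of_hasCompactSupport ec.mul_right)
    · intro i _
      obtain ⟨m1, B, hB⟩ := BM.pd le i
      exact ((c1 i).continuous.integrable_of_hasCompactSupport (cs i)).bdd_mul
        m1.aestronglyMeasurable (Filter.Eventually.of_forall hB)
  rwa [h3, h4, abs_neg] at h1

def pp (k : ℕ) (t : ℝ) : ℝ := (max t 0) ^ k

lemma pp_cont (k : ℕ) : Continuous (pp k) := by unfold pp; fun_prop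

lemma pp_nonneg (k : ℕ) (t : ℝ) : 0 ≤ pp k t := pow_nonneg (le_max_right _ _) _

lemma pp_zero {k : ℕ} (hk : k ≠ 0) {t : ℝ} (ht : t ≤ 0) : pp k t = 0 := by
  rw [pp, max_eq_right ht, zero_pow hk]

lemma pp_deriv (k : ℕ) (t : ℝ) : HasDerivAt (pp (k + 2)) ((k + 2) * pp (k + 1) t) t := by
  rcases lt_trichotomy t 0 with h | h | h
  · rw [pp_zero (by omega) h.le, mul_zero]
    refine (hasDerivAt_const t (0:ℝ)).congr_of_eventuallyEq ?_
    filter_upwards [Iio_mem_nhds h] with s hs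
    exact pp_zero (by omega) hs.le
  · subst h
    rw [pp_zero (by omega) le_rfl, mul_zero]
    have h1 : HasFDerivAt (pp (k + 2)) (0 : ℝ →L[ℝ] ℝ) 0 := by
      refine Asymptotics.IsBigO.hasFDerivAt (n := k + 2) (𝕜 := ℝ) (Asymptotics.IsBigO.of_bound 1 ?_) (by omega)
      refine Filter.Eventually.of_forall fun s => ?_
      rw [one_mul, sub_zero, Real.norm_of_nonneg (pp_nonneg _ _), norm_pow, norm_norm, pp]
      exact pow_le_pow_left₀ (le_max_right _ _) (max_le (le_abs_self s) (abs_nonneg s)) _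
    simpa using h1.hasDerivAt
  · have h1 := hasDerivAt_pow (k + 2) t
    have e : ((k + 2 : ℕ) : ℝ) * t ^ (k + 2 - 1) = (k + 2) * pp (k + 1) t := by
      rw [pp, max_eq_left h.le]; push_cast; rfl
    rw [← e]
    refine h1.congr_of_eventuallyEq ?_
    filter_upwards [Ioi_mem_nhds h] with s hs
    rw [pp, max_eq_left (le_of_lt hs)]

lemma pp_contDiff (k : ℕ) : ContDiff ℝ k (pp (k + 1)) := by
  induction k with
  | zero => exact contDiff_zero.2 (pp_cont _)
  | succ k ih =>
    have : ((k + 1 : ℕ) : WithTop ℕ∞) = (k : WithTop ℕ∞) + 1 := by push_cast; rfl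
    rw [this, contDiff_succ_iff_deriv]
    refine ⟨fun t => (pp_deriv k t).differentiableAt, by simp, ?_⟩
    have : deriv (pp (k + 1 + 1)) = fun t => (k + 2) * pp (k + 1) t := by
      ext t; exact (pp_deriv k t).deriv
    rw [this]
    exact contDiff_const.mul ih

def zt (α : ℝ) (n y : E3) (t : ℝ) (x : E3) : ℝ :=
  (α + ⟪n, x - y⟫) * pp 4 (1 - t ^ 2 * ‖x - y‖ ^ 2)

lemma hfd_pd {f : E3 → ℝ} {f' : E3 →L[ℝ] ℝ} {x : E3} (h : HasFDerivAt f f' x) (i : Fin 3) :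
    pd i f x = f' (bs i) := by rw [pd, h.fderiv]

lemma hfd_q (y : E3) (t : ℝ) (x : E3) :
    HasFDerivAt (fun x : E3 => 1 - t ^ 2 * ‖x - y‖ ^ 2) (-((2 * t ^ 2) • innerSL ℝ (x - y))) x := by
  have h1 : HasFDerivAt (fun x : E3 => ‖x - y‖ ^ 2) _ x := ((hasFDerivAt_id x).sub_const y).norm_sq
  refine ((h1.const_mul (t ^ 2)).const_sub 1).congr_fderiv ?_
  ext z
  simp
  ring

lemma hfd_pp (k : ℕ) (y : E3) (t : ℝ) (x : E3) :
    HasFDerivAt (fun x : E3 => pp (k + 2) (1 - t ^ 2 * ‖x - y‖ ^ 2))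
      ((-(2 * (k + 2) * t ^ 2 * pp (k + 1) (1 - t ^ 2 * ‖x - y‖ ^ 2))) • innerSL ℝ (x - y)) x := by
  have := (pp_deriv k (1 - t ^ 2 * ‖x - y‖ ^ 2)).comp_hasFDerivAt x (hfd_q y t x)
  refine this.congr_fderiv ?_
  ext z
  simp
  ring

lemma hfd_l (α : ℝ) (n y x : E3) : HasFDerivAt (fun x : E3 => α + ⟪n, x - y⟫) (innerSL ℝ n) x := by
  have := ((innerSL ℝ n).hasFDerivAt (x := x - y)).comp x ((hasFDerivAt_id x).sub_const y)
  exact (this.const_add α).congr_fderiv (by ext; simp)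

lemma zt_lap (α : ℝ) (n y : E3) (t : ℝ) (x : E3) : ∑ i, pd i (pd i (zt α n y t)) x =
    (α + ⟪n, x - y⟫) * (-24 * t ^ 2 * pp 3 (1 - t ^ 2 * ‖x - y‖ ^ 2) +
      48 * t ^ 4 * ‖x - y‖ ^ 2 * pp 2 (1 - t ^ 2 * ‖x - y‖ ^ 2)) -
    16 * t ^ 2 * ⟪n, x - y⟫ * pp 3 (1 - t ^ 2 * ‖x - y‖ ^ 2) := by
  have h1 : ∀ i, pd i (zt α n y t) = fun x => pp 4 (1 - t ^ 2 * ‖x - y‖ ^ 2) * ⟪n, bs i⟫ +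
      (α + ⟪n, x - y⟫) * (-8 * t ^ 2 * ⟪x - y, bs i⟫ * pp 3 (1 - t ^ 2 * ‖x - y‖ ^ 2)) := by
    intro i; ext x
    have : HasFDerivAt (zt α n y t) _ x := (hfd_l α n y x).mul (hfd_pp 2 y t x)
    rw [hfd_pd this i]
    simp
    simp only [inner_sub_left]
    ring
  have h2 : ∀ i, pd i (pd i (zt α n y t)) x =
      -16 * t ^ 2 * (⟪n, bs i⟫ * ⟪x - y, bs i⟫) * pp 3 (1 - t ^ 2 * ‖x - y‖ ^ 2) +
      (α + ⟪n, x - y⟫) * (-8 * t ^ 2 * pp 3 (1 - t ^ 2 * ‖x - y‖ ^ 2) +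
      48 * t ^ 4 * ⟪x - y, bs i⟫ ^ 2 * pp 2 (1 - t ^ 2 * ‖x - y‖ ^ 2)) := by
    intro i
    rw [h1 i]
    have hX : HasFDerivAt (fun x : E3 => ⟪x - y, bs i⟫) (innerSL ℝ (bs i)) x := by
      have := hfd_l 0 (bs i) y x
      simp only [zero_add] at this
      convert this using 2
      exact real_inner_comm _ _
    have : HasFDerivAt (fun x => pp 4 (1 - t ^ 2 * ‖x - y‖ ^ 2) * ⟪n, bs i⟫ +
      (α + ⟪n, x - y⟫) * (-8 * t ^ 2 * ⟪x - y, bs i⟫ * pp 3 (1 - t ^ 2 * ‖x - y‖ ^ 2))) _ x :=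
      ((hfd_pp 2 y t x).mul_const _).add
        ((hfd_l α n y x).mul ((hX.const_mul (-8 * t ^ 2)).mul (hfd_pp 1 y t x)))
    rw [hfd_pd this i]
    have hb : ‖bs i‖ = 1 := bs_norm i
    simp [hb]
    simp only [inner_sub_left]
    ring
  have e1 : ∑ i, ⟪n, bs i⟫ * ⟪x - y, bs i⟫ = ⟪n, x - y⟫ := by
    simp [bs, Fin.sum_univ_three, PiLp.inner_apply]
    ring
  have e2 : ∑ i, ⟪x - y, bs i⟫ ^ 2 = ‖x - y‖ ^ 2 := by
    rw [EuclideanSpace.norm_sq_eq]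
    simp [bs, Fin.sum_univ_three, PiLp.inner_apply]
  simp only [h2]
  rw [← e1, ← e2]
  simp only [Fin.sum_univ_three]
  ring

lemma scl3 {F : Type*} [NormedAddCommGroup F] [NormedSpace ℝ F] {f : E3 → F} (hf : ContDiff ℝ 3 f)
    {Λ : ℝ} (hΛ : ∀ x, ‖iteratedFDeriv ℝ 3 f x‖ ≤ Λ) {t : ℝ} (ht : 0 ≤ t) (y x : E3) :
    ‖iteratedFDeriv ℝ 3 (fun x => f (t • (x - y))) x‖ ≤ t ^ 3 * Λ := by
  rw [iteratedFDeriv_comp_sub 3 y (f := fun x => f (t • x)) x, iteratedFDeriv_comp_const_smul t hf]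
  simp only [norm_smul, norm_pow, Real.norm_of_nonneg ht]
  gcongr
  exact hΛ _

lemma bump3 {F : Type*} [NormedAddCommGroup F] [NormedSpace ℝ F] {f : E3 → F} (hf : ContDiff ℝ 3 f)
    (h0 : ∀ x ∉ closedBall (0:E3) 1, f x = 0) :
    ∃ Λ, 0 ≤ Λ ∧ ∀ x, ‖iteratedFDeriv ℝ 3 f x‖ ≤ Λ := by
  have h : HasCompactSupport f := HasCompactSupport.intro (isCompact_closedBall 0 1) h0
  obtain ⟨B, hB⟩ := (hf.continuous_iteratedFDeriv' (m := 3)).bounded_above_of_compact_support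
    (h.iteratedFDeriv 3)
  exact ⟨B, (norm_nonneg _).trans (hB 0), hB⟩

lemma b_cd : ContDiff ℝ 3 (fun x : E3 => pp 4 (1 - ‖x‖ ^ 2)) :=
  (pp_contDiff 3).comp (contDiff_const.sub (contDiff_norm_sq ℝ))

lemma b_z (x : E3) (hx : x ∉ closedBall (0:E3) 1) : pp 4 (1 - ‖x‖ ^ 2) = 0 := by
  rw [mem_closedBall_zero_iff, not_le] at hx
  exact pp_zero (by norm_num) (by nlinarith)

lemma zt_cd (α : ℝ) (n y : E3) (t : ℝ) : ContDiff ℝ 3 (zt α n y t) := by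
  have h1 : ContDiff ℝ 3 (fun x : E3 => 1 - t ^ 2 * ‖x - y‖ ^ 2) :=
    contDiff_const.sub (contDiff_const.mul ((contDiff_id.sub contDiff_const).norm_sq ℝ))
  have h2 : ContDiff ℝ 3 (fun x : E3 => α + ⟪n, x - y⟫) :=
    contDiff_const.add (contDiff_const.inner ℝ (contDiff_id.sub contDiff_const))
  exact h2.mul ((pp_contDiff 3).comp h1)

lemma zt_z (α : ℝ) (n y : E3) {t : ℝ} {x : E3} (hx : 1 ≤ t * ‖x - y‖) :
    zt α n y t x = 0 := by
  rw [zt, pp_zero (by norm_num) (by nlinarith), mul_zero]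

lemma nsq (t : ℝ) (x : E3) : ‖t • x‖ ^ 2 = t ^ 2 * ‖x‖ ^ 2 := by
  rw [norm_smul, mul_pow, Real.norm_eq_abs, sq_abs]

/-- test-function bounds -/
lemma zt_bds : ∃ Λ, 0 ≤ Λ ∧ (∀ y t, 0 < t → ∀ x, ‖iteratedFDeriv ℝ 3 (zt 1 0 y t) x‖ ≤ t ^ 3 * Λ) ∧
    ∀ n y t, ‖n‖ = 1 → 0 < t → ∀ x, ‖iteratedFDeriv ℝ 3 (zt 0 n y t) x‖ ≤ t ^ 2 * Λ := by
  obtain ⟨Λ1, h1, b1⟩ := bump3 b_cd b_z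
  have cd2 : ContDiff ℝ 3 (fun x : E3 => pp 4 (1 - ‖x‖ ^ 2) • x) := b_cd.smul contDiff_id
  obtain ⟨Λ2, h2, b2⟩ := bump3 cd2 (fun x hx => by rw [b_z x hx, zero_smul])
  refine ⟨max Λ1 Λ2, h1.trans (le_max_left _ _), fun y t ht x => ?_, fun n y t hn ht x => ?_⟩
  · have e : zt 1 0 y t = fun x => (fun x : E3 => pp 4 (1 - ‖x‖ ^ 2)) (t • (x - y)) := by
      ext x; simp [zt, nsq]
    rw [e]
    exact (scl3 b_cd b1 ht.le y x).trans (by gcongr; exact le_max_left _ _)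
  · have e : zt 0 n y t = (t⁻¹ • innerSL ℝ n) ∘
        fun x => (fun x : E3 => pp 4 (1 - ‖x‖ ^ 2) • x) (t • (x - y)) := by
      ext x
      simp only [zt, Function.comp, FunLike.coe_smul, Pi.smul_apply, innerSL_apply_apply,
        inner_smul_right, nsq, smul_eq_mul]
      field_simp
      ring
    have cd3 : ContDiff ℝ 3 (fun x => (fun x : E3 => pp 4 (1 - ‖x‖ ^ 2) • x) (t • (x - y))) :=
      cd2.comp (by fun_prop : ContDiff ℝ 3 fun x : E3 => t • (x - y))
    rw [e]
    refine ((t⁻¹ • innerSL ℝ n).norm_iteratedFDeriv_comp_left cd3.contDiffAt le_rfl).trans ?_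
    have := scl3 cd2 b2 ht.le y x
    calc _ ≤ t⁻¹ * (t ^ 3 * Λ2) := by
          gcongr
          rw [norm_smul, innerSL_apply_norm, hn, mul_one, Real.norm_of_nonneg (by positivity)]
      _ = t ^ 2 * Λ2 := by field_simp
      _ ≤ _ := by gcongr; exact le_max_right _ _

lemma pp_le1 (k : ℕ) {t : ℝ} (ht : t ≤ 1) : pp k t ≤ 1 :=
  pow_le_one₀ (le_max_right _ _) (max_le ht zero_le_one)

lemma dint {e : E3 → ℝ} (ce : Continuous e) (cs : HasCompactSupport e) (j : ℕ) (y : E3) (t0 : ℝ) :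
    HasDerivAt (fun t : ℝ => ∫ x, e x * (t ^ (j + 1) * pp 3 (1 - t ^ 2 * ‖x - y‖ ^ 2)))
      (∫ x, e x * ((j + 1) * t0 ^ j * pp 3 (1 - t0 ^ 2 * ‖x - y‖ ^ 2) -
        6 * t0 ^ (j + 2) * ‖x - y‖ ^ 2 * pp 2 (1 - t0 ^ 2 * ‖x - y‖ ^ 2))) t0 := by
  have c3 := pp_cont 3
  have c2 := pp_cont 2
  set τ := |t0| + 1 with hτ
  have τ0 : 0 ≤ τ := by positivity
  refine (hasDerivAt_integral_of_dominated_loc_of_deriv_le (μ := volume) (s := ball t0 1)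
    (bound := fun x => |e x| * ((j + 1) * τ ^ j + 6 * τ ^ (j + 2) * ‖x - y‖ ^ 2))
    (F' := fun t x => e x * ((j + 1) * t ^ j * pp 3 (1 - t ^ 2 * ‖x - y‖ ^ 2) -
        6 * t ^ (j + 2) * ‖x - y‖ ^ 2 * pp 2 (1 - t ^ 2 * ‖x - y‖ ^ 2)))
    (ball_mem_nhds t0 one_pos) ?_ ?_ ?_ ?_ ?_ ?_).2
  · exact Filter.Eventually.of_forall fun t => (by fun_prop : Continuous _).aestronglyMeasurable
  · exact (by fun_prop : Continuous _).integrable_of_hasCompactSupport cs.mul_right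
  · exact (by fun_prop : Continuous _).aestronglyMeasurable
  · refine Filter.Eventually.of_forall fun x t ht => ?_
    have htτ : |t| ≤ τ := by
      rw [mem_ball, Real.dist_eq] at ht
      have := abs_sub_abs_le_abs_sub t t0
      linarith
    have q : 1 - t ^ 2 * ‖x - y‖ ^ 2 ≤ 1 := by nlinarith [mul_nonneg (sq_nonneg t) (sq_nonneg ‖x - y‖)]
    have p3 := pp_le1 3 q
    have p2 := pp_le1 2 q
    have n3 := pp_nonneg 3 (1 - t ^ 2 * ‖x - y‖ ^ 2)
    have n2 := pp_nonneg 2 (1 - t ^ 2 * ‖x - y‖ ^ 2)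
    generalize pp 3 (1 - t ^ 2 * ‖x - y‖ ^ 2) = a at *
    generalize pp 2 (1 - t ^ 2 * ‖x - y‖ ^ 2) = b at *
    rw [Real.norm_eq_abs, abs_mul]
    gcongr
    refine (abs_sub _ _).trans ?_
    rw [abs_mul, abs_mul, abs_mul, abs_mul, abs_mul, abs_of_nonneg n3, abs_of_nonneg n2, abs_pow, abs_pow,
      abs_of_nonneg (by positivity : (0:ℝ) ≤ j + 1), abs_of_nonneg (sq_nonneg ‖x - y‖),
      abs_of_nonneg (by norm_num : (0:ℝ) ≤ 6)]
    gcongr ?_ + ?_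
    · calc _ ≤ (j + 1) * τ ^ j * 1 := by gcongr
        _ = _ := by ring
    · calc _ ≤ 6 * τ ^ (j + 2) * ‖x - y‖ ^ 2 * 1 := by gcongr
        _ = _ := by ring
  · exact (by fun_prop : Continuous _).integrable_of_hasCompactSupport
      (HasCompactSupport.mul_right (f := fun x => |e x|) (by simpa using cs.norm))
  · refine Filter.Eventually.of_forall fun x t _ => ?_
    have h1 : HasDerivAt (fun t : ℝ => 1 - t ^ 2 * ‖x - y‖ ^ 2) (-(2 * t * ‖x - y‖ ^ 2)) t := by
      have := ((hasDerivAt_pow 2 t).mul_const (‖x - y‖ ^ 2)).const_sub 1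
      simpa using this
    have h2 := (pp_deriv 1 (1 - t ^ 2 * ‖x - y‖ ^ 2)).comp t h1
    have h3 := ((hasDerivAt_pow (j + 1) t).mul h2).const_mul (e x)
    refine h3.congr_deriv ?_
    simp only [Nat.add_sub_cancel, Function.comp]
    push_cast
    ring

lemma Sol.e_cont (S : Sol r c Ω T u v U M) : Continuous (fun x => u x - v x) ∧
    HasCompactSupport (fun x => u x - v x) ∧ ∀ x ∉ Ω, u x - v x = 0 := by
  obtain ⟨K1, l1⟩ := S.ul
  obtain ⟨K2, l2⟩ := S.mesh.lip S.vp
  have h0 : ∀ x ∉ Ω, u x - v x = 0 := fun x hx => by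
    rw [S.uz x hx, S.vp.1 x hx, sub_zero]
  refine ⟨l1.continuous.sub l2.continuous, ?_, h0⟩
  exact HasCompactSupport.intro S.mesh.bd.isCompact_closure
    (fun x hx => h0 x (fun h => hx (subset_closure h)))

lemma mvt {f f' : ℝ → ℝ} {a b B : ℝ} (hab : a ≤ b) (hd : ∀ t, HasDerivAt f (f' t) t)
    (hB : ∀ t, a ≤ t → t ≤ b → |f' t| ≤ B) : |f b - f a| ≤ B * (b - a) := by
  have := (convex_Icc a b).norm_image_sub_le_of_norm_hasDerivWithin_le (f := f) (f' := f') (C := B)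
    (fun x _ => (hd x).hasDerivWithinAt) (fun x hx => hB x hx.1 hx.2)
    (left_mem_Icc.2 hab) (right_mem_Icc.2 hab)
  rwa [Real.norm_eq_abs, Real.norm_of_nonneg (sub_nonneg.2 hab)] at this

lemma Sol.HG (r : ℕ) (hr : 2 ≤ r) {c : ℝ} (hc : 0 < c) : ∃ C, 0 ≤ C ∧
    ∀ (Ω : Set E3) (T : Finset (Fin 4 → E3)) (u v : E3 → ℝ) (U M : ℝ), Sol r c Ω T u v U M →
    ∀ (y : E3) (a b : ℝ), 0 < a → a ≤ b → b ≤ 1 →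
    ((∀ x ∈ frontier Ω, 1 ≤ a * ‖x - y‖) →
      |(∫ x, (u x - v x) * (b ^ 3 * pp 3 (1 - b ^ 2 * ‖x - y‖ ^ 2))) -
        ∫ x, (u x - v x) * (a ^ 3 * pp 3 (1 - a ^ 2 * ‖x - y‖ ^ 2))| ≤ C * (U + M) * (b - a)) ∧
    ∀ n : E3, ‖n‖ = 1 → (∀ x ∈ frontier Ω, ⟪n, x - y⟫ = 0 ∨ 1 ≤ a * ‖x - y‖) →
      |(∫ x, ((u x - v x) * ⟪n, x - y⟫) * (b ^ 5 * pp 3 (1 - b ^ 2 * ‖x - y‖ ^ 2))) -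
        ∫ x, ((u x - v x) * ⟪n, x - y⟫) * (a ^ 5 * pp 3 (1 - a ^ 2 * ‖x - y‖ ^ 2))| ≤
          C * (U + M) * b * (b - a) := by
  obtain ⟨Λ, Λ0, b1, b2⟩ := zt_bds
  have hCT := CT_nonneg r hc
  refine ⟨CT r c * Λ, by positivity, fun Ω T u v U M S y a b a0 ab b1' => ?_⟩
  obtain ⟨ce, cs, e0⟩ := S.e_cont
  have U0 := S.U0
  have M0 := S.M0
  have tm : ∀ (α : ℝ) (n : E3) (t Λ' : ℝ), a ≤ t → t ≤ b →
      (∀ x ∈ frontier Ω, α + ⟪n, x - y⟫ = 0 ∨ 1 ≤ a * ‖x - y‖) →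
      (∀ x, ‖iteratedFDeriv ℝ 3 (zt α n y t) x‖ ≤ Λ') →
      |∫ x, (u x - v x) * ∑ i, pd i (pd i (zt α n y t)) x| ≤ CT r c * (U + M) * Λ' * t⁻¹ ^ 3 := by
    intro α n t Λ' h1 h2 hz hΛ
    have t0 : 0 < t := a0.trans_le h1
    refine S.testT hr hc (zt_cd α n y t) hΛ (y := y) (one_le_inv_iff₀.2 ⟨t0, h2.trans b1'⟩) ?_ ?_
    · intro x hx
      rw [mem_closedBall, dist_eq_norm, not_le, inv_lt_iff_one_lt_mul₀ t0] at hx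
      exact zt_z _ _ _ (by linarith)
    · intro x hx
      rcases hz x hx with h | h
      · rw [zt, h, zero_mul]
      · exact zt_z _ _ _ (h.trans (by gcongr))
  constructor
  · intro hz
    refine mvt (f := fun t : ℝ => ∫ x, (u x - v x) * (t ^ 3 * pp 3 (1 - t ^ 2 * ‖x - y‖ ^ 2))) ab
      (fun t => dint ce cs 2 y t) fun t h1 h2 => ?_
    have t0 : 0 < t := a0.trans_le h1
    have h := tm 1 0 t _ h1 h2 (fun x hx => Or.inr (hz x hx)) (b1 y t t0)
    simp only [zt_lap] at h
    have e : (∫ x, (u x - v x) * ((((2:ℕ):ℝ) + 1) * t ^ 2 * pp 3 (1 - t ^ 2 * ‖x - y‖ ^ 2) -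
        6 * t ^ (2 + 2) * ‖x - y‖ ^ 2 * pp 2 (1 - t ^ 2 * ‖x - y‖ ^ 2))) = (-1 / 8) * ∫ x, (u x - v x) *
        ((1 + ⟪(0:E3), x - y⟫) * (-24 * t ^ 2 * pp 3 (1 - t ^ 2 * ‖x - y‖ ^ 2) +
      48 * t ^ 4 * ‖x - y‖ ^ 2 * pp 2 (1 - t ^ 2 * ‖x - y‖ ^ 2)) -
    16 * t ^ 2 * ⟪(0:E3), x - y⟫ * pp 3 (1 - t ^ 2 * ‖x - y‖ ^ 2)) := by
      rw [← integral_const_mul]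
      congr 1; ext x
      rw [inner_zero_left]; push_cast; ring
    rw [e, abs_mul]
    have e2 : CT r c * (U + M) * (t ^ 3 * Λ) * t⁻¹ ^ 3 = CT r c * Λ * (U + M) := by field_simp
    rw [e2] at h
    have : |(-1 / 8 : ℝ)| ≤ 1 := by norm_num [abs_div]
    exact (mul_le_of_le_one_left (abs_nonneg _) this).trans h
  · intro n hn hz
    refine mvt (f := fun t : ℝ => ∫ x, ((u x - v x) * ⟪n, x - y⟫) *
      (t ^ 5 * pp 3 (1 - t ^ 2 * ‖x - y‖ ^ 2))) ab
      (fun t => dint (e := fun x => (u x - v x) * ⟪n, x - y⟫) (ce.mul (by fun_prop)) cs.mul_right 4 y t)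
      fun t h1 h2 => ?_
    have t0 : 0 < t := a0.trans_le h1
    have h := tm 0 n t _ h1 h2 (fun x hx => by rw [zero_add]; exact hz x hx) (b2 n y t hn t0)
    simp only [zt_lap] at h
    have e : (∫ x, ((u x - v x) * ⟪n, x - y⟫) * ((((4:ℕ):ℝ) + 1) * t ^ 4 * pp 3 (1 - t ^ 2 * ‖x - y‖ ^ 2) -
        6 * t ^ (4 + 2) * ‖x - y‖ ^ 2 * pp 2 (1 - t ^ 2 * ‖x - y‖ ^ 2))) = (-1 / 8) * (t ^ 2 * ∫ x, (u x - v x) *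
        ((0 + ⟪n, x - y⟫) * (-24 * t ^ 2 * pp 3 (1 - t ^ 2 * ‖x - y‖ ^ 2) +
      48 * t ^ 4 * ‖x - y‖ ^ 2 * pp 2 (1 - t ^ 2 * ‖x - y‖ ^ 2)) -
    16 * t ^ 2 * ⟪n, x - y⟫ * pp 3 (1 - t ^ 2 * ‖x - y‖ ^ 2))) := by
      rw [← integral_const_mul, ← integral_const_mul]
      congr 1; ext x
      push_cast; ring
    rw [e, abs_mul]
    have : |(-1 / 8 : ℝ)| ≤ 1 := by norm_num [abs_div]
    refine (mul_le_of_le_one_left (abs_nonneg _) this).trans ?_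
    rw [abs_mul, abs_of_nonneg (sq_nonneg t)]
    calc _ ≤ t ^ 2 * (CT r c * (U + M) * (t ^ 2 * Λ) * t⁻¹ ^ 3) := by gcongr
      _ = CT r c * Λ * (U + M) * t := by field_simp
      _ ≤ _ := by gcongr

def wW (x : E3) : ℝ := pp 3 (1 - ‖x‖ ^ 2)

lemma wW_cont : Continuous wW := (pp_cont 3).comp (by fun_prop)

lemma wW_is : IsW wW := by
  have hz : ∀ x ∉ ball (0:E3) 1, wW x = 0 := fun x hx => by
    rw [mem_ball_zero_iff, not_lt] at hx
    exact pp_zero (by norm_num) (by nlinarith)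
  refine ⟨wW_cont.measurable, fun x => pp_nonneg _ _, fun x => pp_le1 _ (by nlinarith [sq_nonneg ‖x‖]), hz, ?_⟩
  refine wW_cont.integral_pos_of_hasCompactSupport_nonneg_nonzero
    (HasCompactSupport.intro (isCompact_closedBall 0 1)
      fun x hx => hz x (fun h => hx (ball_subset_closedBall h))) (fun x => pp_nonneg _ _) (x := 0) ?_
  simp [wW, pp]

lemma wW_int : Integrable wW := by simpa using wW_is.intg1 one_pos

def kn (n x : E3) : ℝ := max ⟪n, x⟫ 0 * wW x

lemma kn_nonneg (n x : E3) : 0 ≤ kn n x := mul_nonneg (le_max_right _ _) (wW_is.nn x)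

lemma kn_le {n : E3} (hn : ‖n‖ = 1) (x : E3) : kn n x ≤ wW x := by
  by_cases hx : x ∈ ball (0:E3) 1
  · refine mul_le_of_le_one_left (wW_is.nn x) (max_le ?_ zero_le_one)
    have := real_inner_le_norm n x
    rw [mem_ball_zero_iff] at hx
    rw [hn] at this
    linarith
  · rw [kn, wW_is.z x hx, mul_zero]

lemma kn_cont (n : E3) : Continuous (kn n) :=
  ((by fun_prop : Continuous fun x : E3 => max ⟪n, x⟫ 0)).mul wW_cont

lemma kn_int {n : E3} (hn : ‖n‖ = 1) : Integrable (kn n) :=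
  wW_int.mono' (kn_cont n).aestronglyMeasurable (Filter.Eventually.of_forall fun x => by
    rw [Real.norm_of_nonneg (kn_nonneg n x)]; exact kn_le hn x)

lemma kn_low : ∃ J, 0 < J ∧ ∀ n, ‖n‖ = 1 → J ≤ ∫ x, kn n x := by
  refine ⟨1 / 4 * (7 / 16) ^ 3 * volume.real (ball (0:E3) (1 / 4)), ?_, fun n hn => ?_⟩
  · have : 0 < volume.real (ball (0:E3) (1 / 4)) :=
      ENNReal.toReal_pos (measure_ball_pos _ _ (by norm_num)).ne' measure_ball_lt_top.ne
    positivity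
  · have e : volume.real (ball (0:E3) (1 / 4)) = volume.real (ball ((1 / 2 : ℝ) • n) (1 / 4)) := by
      rw [Measure.real, Measure.real, Measure.addHaar_ball_center volume ((1 / 2 : ℝ) • n)]
    calc _ = ∫ x in ball ((1 / 2 : ℝ) • n) (1 / 4), (1 / 4 * (7 / 16) ^ 3 : ℝ) := by
          rw [setIntegral_const, smul_eq_mul, e, mul_comm]
      _ ≤ ∫ x in ball ((1 / 2 : ℝ) • n) (1 / 4), kn n x := by
          refine setIntegral_mono_on (integrableOn_const measure_ball_lt_top.ne) (kn_int hn).integrableOn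
            measurableSet_ball fun x hx => ?_
          rw [mem_ball, dist_eq_norm] at hx
          have h1 : ⟪n, x⟫ = 1 / 2 + ⟪n, x - (1 / 2 : ℝ) • n⟫ := by
            rw [inner_sub_right, inner_smul_right, real_inner_self_eq_norm_sq, hn]; ring
          have h2 := abs_le.1 (abs_real_inner_le_norm n (x - (1 / 2 : ℝ) • n))
          rw [hn, one_mul] at h2
          have h3 : ‖x‖ ≤ 3 / 4 := by
            have := norm_add_le (x - (1 / 2 : ℝ) • n) ((1 / 2 : ℝ) • n)
            rw [sub_add_cancel, norm_smul, hn] at this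
            norm_num at this
            linarith
          refine mul_le_mul ((by linarith : 1 / 4 ≤ ⟪n, x⟫).trans (le_max_left _ _)) ?_ (by norm_num)
            (le_max_right _ _)
          refine pow_le_pow_left₀ (by norm_num) (le_max_of_le_left ?_) 3
          nlinarith [norm_nonneg x]
      _ ≤ _ := setIntegral_le_integral (kn_int hn) (Filter.Eventually.of_forall (kn_nonneg n))

lemma sint (f : E3 → ℝ) {d : ℝ} (hd : 0 < d) (y : E3) :
    ∫ x, f (d⁻¹ • (x - y)) = d ^ 3 * ∫ x, f x := by
  rw [integral_sub_right_eq_self (fun x => f (d⁻¹ • x)) y, scale_int f hd]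

lemma sintg {f : E3 → ℝ} (hf : Integrable f) {d : ℝ} (hd : 0 < d) (y : E3) :
    Integrable (fun x => f (d⁻¹ • (x - y))) :=
  ((scale_intg hf hd).comp_sub_right y :)

lemma bintg {g K : E3 → ℝ} (hK : Integrable K) (bg : BM g) {d : ℝ}
    (hd : 0 < d) (y : E3) : Integrable (fun x => g x * K (d⁻¹ • (x - y))) := by
  obtain ⟨m, B, hB⟩ := bg
  exact (sintg hK hd y).bdd_mul m.aestronglyMeasurable (Filter.Eventually.of_forall hB)

lemma bint {g K : E3 → ℝ} (hK : Integrable K) (K0 : ∀ x, 0 ≤ K x) {B : ℝ} (hg : ∀ x, |g x| ≤ B)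
    {d : ℝ} (hd : 0 < d) (y : E3) : |∫ x, g x * K (d⁻¹ • (x - y))| ≤ B * (d ^ 3 * ∫ x, K x) := by
  rw [← sint K hd y, ← integral_const_mul, ← Real.norm_eq_abs]
  refine norm_integral_le_of_norm_le ((sintg hK hd y).const_mul B) (Filter.Eventually.of_forall fun x => ?_)
  rw [norm_mul, Real.norm_of_nonneg (K0 _)]
  exact mul_le_mul_of_nonneg_right (hg x) (K0 _)

lemma wW_s (d : ℝ) (x y : E3) : wW (d⁻¹ • (x - y)) = pp 3 (1 - d⁻¹ ^ 2 * ‖x - y‖ ^ 2) := by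
  rw [wW, nsq]

lemma Sol.neg (S : Sol r c Ω T u v U M) :
    Sol r c Ω T (fun x => -u x) (fun x => -v x) U M := by
  obtain ⟨K, hK⟩ := S.ul
  have e : ∀ i x, pd i (fun y => -u y - -v y) x = -pd i (fun y => u y - v y) x := fun i x => by
    have : (fun y => -u y - -v y) = fun y => -(u y - v y) := by ext; ring
    rw [this, pd, pd, fderiv_fun_neg]; rfl
  refine ⟨S.mesh, S.z0, ⟨K, hK.neg⟩, fun x hx => by rw [S.uz x hx, neg_zero],
    fun x => by rw [abs_neg]; exact S.uU x, ?_, fun x => by rw [abs_neg]; exact S.vM x, fun χ hχ => ?_⟩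
  · refine ⟨fun x hx => by simp [S.vp.1 x hx], fun w hw => ?_⟩
    obtain ⟨p, hp, he⟩ := S.vp.2 w hw
    exact ⟨_, hp.smul (-1), fun x hx => by simp [he x hx]⟩
  · have := S.orth χ hχ
    simp only [e, neg_mul, Finset.sum_neg_distrib, integral_neg, this, neg_zero]

/-- half-ball contact geometry at distance `ρ` in direction `n` -/
structure Geo (Ω : Set E3) (s0 ρ : ℝ) (n : E3) : Prop where
  n1 : ‖n‖ = 1
  ρ0 : 0 < ρ
  ball : ball 0 ρ ⊆ Ω
  sup : ∀ x ∈ Ω, ⟪n, x⟫ < ρ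
  half : ∀ x, ‖x - ρ • n‖ < s0 * ρ → ⟪n, x⟫ < ρ → x ∈ Ω

lemma Geo.tau {s0 ρ : ℝ} {n : E3} (g : Geo Ω s0 ρ n) (x : E3) : ⟪-n, x - ρ • n⟫ = ρ - ⟪n, x⟫ := by
  rw [inner_neg_left, inner_sub_right, inner_smul_right, real_inner_self_eq_norm_sq, g.n1]; ring

lemma Geo.fr {s0 ρ : ℝ} {n : E3} (g : Geo Ω s0 ρ n) (hs : 0 < s0) (op : IsOpen Ω) {x : E3}
    (hx : x ∈ frontier Ω) :
    ⟪-n, x - ρ • n⟫ = 0 ∨ 1 ≤ (s0 * ρ)⁻¹ * ‖x - ρ • n‖ := by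
  rw [op.frontier_eq] at hx
  have hcl : ⟪n, x⟫ ≤ ρ := by
    have : closure Ω ⊆ {x | ⟪n, x⟫ ≤ ρ} :=
      closure_minimal (fun x hx => (g.sup x hx).le) (isClosed_le (by fun_prop) (by fun_prop))
    exact this hx.1
  rw [g.tau]
  by_contra! h
  have h1 : ⟪n, x⟫ < ρ := lt_of_le_of_ne hcl (fun h' => h.1 (by rw [h', sub_self]))
  refine hx.2 (g.half x ?_ h1)
  have h2 := h.2
  have := g.ρ0
  rwa [inv_mul_lt_iff₀ (by positivity), mul_one] at h2

lemma Sol.bmv (S : Sol r c Ω T u v U M) : BM u ∧ BM v := by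
  obtain ⟨K1, l1⟩ := S.ul
  obtain ⟨K2, l2⟩ := S.mesh.lip S.vp
  exact ⟨⟨l1.continuous.measurable, U, S.uU⟩, ⟨l2.continuous.measurable, M, S.vM⟩⟩

/-- first-moment estimate near the contact point -/
lemma Sol.mom {C : ℝ} (S : Sol r c Ω T u v U M) {s0 ρ : ℝ} {n : E3} (g : Geo Ω s0 ρ n) (hs : 0 < s0)
    {d : ℝ} (hd : 1 ≤ d) (hds : d ≤ s0 * ρ)
    (hG : ∀ (y : E3) (a b : ℝ), 0 < a → a ≤ b → b ≤ 1 → ∀ n : E3, ‖n‖ = 1 →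
      (∀ x ∈ frontier Ω, ⟪n, x - y⟫ = 0 ∨ 1 ≤ a * ‖x - y‖) →
      |(∫ x, ((u x - v x) * ⟪n, x - y⟫) * (b ^ 5 * pp 3 (1 - b ^ 2 * ‖x - y‖ ^ 2))) -
        ∫ x, ((u x - v x) * ⟪n, x - y⟫) * (a ^ 5 * pp 3 (1 - a ^ 2 * ‖x - y‖ ^ 2))| ≤
          C * (U + M) * b * (b - a)) (hC : 0 ≤ C) :
    |∫ x, (u x - v x) * kn (-n) (d⁻¹ • (x - ρ • n))| ≤
      (U + M) * (C * d ^ 2 + d ^ 4 * (∫ x, wW x) / (s0 * ρ)) := by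
  have U0 := S.U0
  have M0 := S.M0
  have hρ := g.ρ0
  set D := s0 * ρ with hD
  have d0 : 0 < d := by linarith
  have D0 : 0 < D := by positivity
  have nn : ‖-n‖ = 1 := by rw [norm_neg, g.n1]
  have h := hG (ρ • n) D⁻¹ d⁻¹ (by positivity) (inv_anti₀ d0 hds) (inv_le_one_of_one_le₀ hd) (-n) nn
    (fun x hx => g.fr hs S.mesh.op hx)
  have key : ∀ d : ℝ, 0 < d → ∫ x, ((u x - v x) * ⟪-n, x - ρ • n⟫) *
      (d⁻¹ ^ 5 * pp 3 (1 - d⁻¹ ^ 2 * ‖x - ρ • n‖ ^ 2)) =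
      d⁻¹ ^ 4 * ∫ x, (u x - v x) * kn (-n) (d⁻¹ • (x - ρ • n)) := by
    intro d d0
    rw [← integral_const_mul]
    congr 1; ext x
    by_cases hx : x ∈ Ω
    · have h1 := g.sup x hx
      rw [kn, wW_s, inner_smul_right, max_eq_left, ]
      · ring
      · rw [g.tau]; have : 0 ≤ ρ - ⟪n, x⟫ := by linarith
        positivity
    · rw [S.e_cont.2.2 x hx]; ring
  rw [key d d0, key D D0] at h
  have hI := wW_is.pos
  have bD : |∫ x, (u x - v x) * kn (-n) (D⁻¹ • (x - ρ • n))| ≤ (U + M) * (D ^ 3 * ∫ x, wW x) := by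
    refine (bint (kn_int nn) (kn_nonneg _) (B := U + M) (fun x => ?_) D0 _).trans ?_
    · exact (abs_sub _ _).trans (add_le_add (S.uU x) (S.vM x))
    · exact mul_le_mul_of_nonneg_left (mul_le_mul_of_nonneg_left
        (integral_mono (kn_int nn) wW_int (kn_le nn)) (by positivity)) (by positivity)
  generalize (∫ x, (u x - v x) * kn (-n) (D⁻¹ • (x - ρ • n))) = A at *
  generalize (∫ x, (u x - v x) * kn (-n) (d⁻¹ • (x - ρ • n))) = A' at *
  generalize (∫ x, wW x) = I at *
  have h1 : |d⁻¹ ^ 4 * A'| ≤ C * (U + M) * d⁻¹ * d⁻¹ + D⁻¹ ^ 4 * ((U + M) * (D ^ 3 * I)) := by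
    have e : d⁻¹ ^ 4 * A' = (d⁻¹ ^ 4 * A' - D⁻¹ ^ 4 * A) + D⁻¹ ^ 4 * A := by ring
    rw [e]
    refine (abs_add_le _ _).trans (add_le_add (h.trans ?_) ?_)
    · have : 0 < D⁻¹ := by positivity
      gcongr
      linarith
    · rw [abs_mul, abs_of_nonneg (by positivity : 0 ≤ D⁻¹ ^ 4)]
      gcongr
  rw [abs_mul, abs_of_nonneg (by positivity : 0 ≤ d⁻¹ ^ 4)] at h1
  have h2 := mul_le_mul_of_nonneg_left h1 (by positivity : 0 ≤ d ^ 4)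
  calc |A'| = d ^ 4 * (d⁻¹ ^ 4 * |A'|) := by field_simp
    _ ≤ _ := h2
    _ = _ := by field_simp

lemma Geo.pw {s0 ρ : ℝ} {n : E3} (g : Geo Ω s0 ρ n) {δ : ℝ} (hδ : 0 < δ) (x : E3) :
    kn (-n) ((δ * ρ)⁻¹ • (x - ρ • n)) ≤
      δ * wW ((δ * ρ)⁻¹ • (x - ρ • n)) + δ⁻¹ ^ 6 * wW (ρ⁻¹ • (x - 0)) := by
  have hρ := g.ρ0
  have nn : ‖-n‖ = 1 := by rw [norm_neg, g.n1]
  set z := (δ * ρ)⁻¹ • (x - ρ • n) with hz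
  have w0 := wW_is.nn z
  have w1 := wW_is.nn (ρ⁻¹ • (x - 0))
  rcases le_total (⟪-n, z⟫) δ with h | h
  · have : kn (-n) z ≤ δ * wW z := mul_le_mul_of_nonneg_right (max_le h hδ.le) w0
    have : 0 ≤ δ⁻¹ ^ 6 * wW (ρ⁻¹ • (x - 0)) := by positivity
    linarith
  · by_cases hb : z ∈ Metric.ball (0:E3) 1
    · rw [mem_ball_zero_iff] at hb
      have hx : ρ⁻¹ • (x - 0) = n + δ • z := by
        rw [hz, sub_zero, smul_smul, smul_sub, smul_smul]
        have e1 : δ * (δ * ρ)⁻¹ = ρ⁻¹ := by field_simp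
        rw [e1, inv_mul_cancel₀ hρ.ne', one_smul]; abel
      have hn : ‖n + δ • z‖ ^ 2 ≤ 1 - δ ^ 2 := by
        rw [norm_add_sq_real, g.n1, inner_smul_right, nsq]
        rw [inner_neg_left] at h
        have : ‖z‖ ^ 2 ≤ 1 := by nlinarith [norm_nonneg z]
        nlinarith [mul_le_mul_of_nonneg_left h hδ.le, mul_le_mul_of_nonneg_left this (sq_nonneg δ)]
      have hw : δ ^ 6 ≤ wW (ρ⁻¹ • (x - 0)) := by
        rw [hx, wW, pp, show δ ^ 6 = (δ ^ 2) ^ 3 by ring]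
        exact pow_le_pow_left₀ (by positivity) (le_max_of_le_left (by linarith)) 3
      have h1 := (kn_le nn z).trans (wW_is.le z)
      have h2 : 1 ≤ δ⁻¹ ^ 6 * wW (ρ⁻¹ • (x - 0)) := by
        calc (1:ℝ) = δ⁻¹ ^ 6 * δ ^ 6 := by field_simp
          _ ≤ _ := by gcongr
      nlinarith
    · rw [kn, wW_is.z z hb, mul_zero, mul_zero, zero_add]
      positivity

lemma gain_arith {U M J I C δ s0 ρ m A B : ℝ} (hρ : 0 < ρ) (hδ : 0 < δ) (hs : 0 < s0) (hU : 0 ≤ U)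
    (hM : 0 ≤ M) (hI : 0 < I) (hJ : 0 < J) (hA : |A| ≤ (U + M) * (C * (δ * ρ) ^ 2 + (δ * ρ) ^ 4 * I / (s0 * ρ)))
    (hB : |B| ≤ U * ((δ * ρ) ^ 3 * I))
    (h : M * ((δ * ρ) ^ 3 * J) - (B - A) ≤ δ * (2 * M * ((δ * ρ) ^ 3 * I)) + δ⁻¹ ^ 6 * (M * (ρ ^ 3 * I) - m * (ρ ^ 3 * I)))
    (d1 : δ * I / s0 + 2 * δ * I ≤ J / 4) (d2 : C ≤ δ * ρ * (J / 4)) :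
    m ≤ (1 - δ ^ 9 * J / (2 * I)) * M + δ ^ 9 * (I + J) / I * U := by
  have a1 := (abs_le.1 hA).1
  have b1 := (abs_le.1 hB).2
  have e1 : (U + M) * (C * (δ * ρ) ^ 2 + (δ * ρ) ^ 4 * I / (s0 * ρ)) ≤
      (U + M) * ((δ * ρ) ^ 3 * (J / 4 + δ * I / s0)) := by
    have : C * (δ * ρ) ^ 2 + (δ * ρ) ^ 4 * I / (s0 * ρ) ≤ (δ * ρ) ^ 3 * (J / 4 + δ * I / s0) := by
      calc _ ≤ (δ * ρ * (J / 4)) * (δ * ρ) ^ 2 + (δ * ρ) ^ 4 * I / (s0 * ρ) := by gcongr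
        _ = _ := by field_simp
    gcongr
  have e2 : (δ * ρ) ^ 3 * (M * J - U * I - (U + M) * (J / 4 + δ * I / s0) - 2 * M * δ * I) ≤
      δ⁻¹ ^ 6 * ρ ^ 3 * I * (M - m) := by
    nlinarith
  have e3 : M * J - U * I - (U + M) * (J / 4 + δ * I / s0) - 2 * M * δ * I ≤ δ⁻¹ ^ 9 * I * (M - m) := by
    refine le_of_mul_le_mul_left (e2.trans_eq ?_) (by positivity : 0 < (δ * ρ) ^ 3)
    field_simp
  have e4 : M * J / 2 - U * (I + J) ≤ δ⁻¹ ^ 9 * I * (M - m) := by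
    refine le_trans ?_ e3
    have : 0 ≤ δ * I / s0 := by positivity
    have : 0 ≤ δ * I := by positivity
    nlinarith
  have e5 := mul_le_mul_of_nonneg_left e4 (by positivity : 0 ≤ δ ^ 9 / I)
  have e6 : δ ^ 9 / I * (δ⁻¹ ^ 9 * I * (M - m)) = M - m := by field_simp
  rw [e6] at e5
  have e7 : (1 - δ ^ 9 * J / (2 * I)) * M + δ ^ 9 * (I + J) / I * U = M - δ ^ 9 / I * (M * J / 2 - U * (I + J)) := by
    field_simp; ring
  rw [e7]; linarith

/-- gain: the mean at scale `ρ` is strictly smaller than `M` -/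
lemma Sol.gain (r : ℕ) (hr : 2 ≤ r) {c : ℝ} (hc : 0 < c) {s0 : ℝ} (hs : 0 < s0) :
    ∃ γ C L, 0 < γ ∧ 0 ≤ C ∧ 0 ≤ L ∧
    ∀ (Ω : Set E3) (T : Finset (Fin 4 → E3)) (u v : E3 → ℝ) (U M : ℝ), Sol r c Ω T u v U M →
    ∀ n ρ, Geo Ω s0 ρ n → L ≤ ρ → mn wW v ρ ≤ (1 - γ) * M + C * U := by
  obtain ⟨C, C0, hC⟩ := Sol.HG r hr hc
  obtain ⟨J, J0, hJ⟩ := kn_low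
  have hI := wW_is.pos
  set I := ∫ x, wW x with hIdef
  set δ := min s0 (J / 4 / (I / s0 + 2 * I)) with hδ
  have δ0 : 0 < δ := lt_min hs (by positivity)
  have d1 : δ * I / s0 + 2 * δ * I ≤ J / 4 := by
    have := (le_div_iff₀ (by positivity : 0 < I / s0 + 2 * I)).1
      (min_le_right s0 (J / 4 / (I / s0 + 2 * I)))
    calc _ = δ * (I / s0 + 2 * I) := by ring
      _ ≤ _ := this
  refine ⟨δ ^ 9 * J / (2 * I), δ ^ 9 * (I + J) / I, 1 / δ + C / (δ * (J / 4)), by positivity,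
    by positivity, by positivity, fun Ω T u v U M S n ρ g hL => ?_⟩
  have hρ := g.ρ0
  have nn : ‖-n‖ = 1 := by rw [norm_neg, g.n1]
  have dd : 1 ≤ δ * ρ := by
    have : 1 / δ ≤ ρ := le_trans (le_add_of_nonneg_right (by positivity)) hL
    rw [div_le_iff₀ δ0] at this; linarith
  have d2 : C ≤ δ * ρ * (J / 4) := by
    have : C / (δ * (J / 4)) ≤ ρ := le_trans (le_add_of_nonneg_left (by positivity)) hL
    rw [div_le_iff₀ (by positivity)] at this; linarith
  have d0 : 0 < δ * ρ := by positivity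
  obtain ⟨bu, bv⟩ := S.bmv
  have hA := S.mom g hs dd (by gcongr; exact min_le_left _ _)
    (fun y a b h1 h2 h3 => (hC Ω T u v U M S y a b h1 h2 h3).2) C0
  have hB : |∫ x, u x * kn (-n) ((δ * ρ)⁻¹ • (x - ρ • n))| ≤ U * ((δ * ρ) ^ 3 * I) :=
    (bint (kn_int nn) (kn_nonneg _) S.uU d0 _).trans (mul_le_mul_of_nonneg_left
      (mul_le_mul_of_nonneg_left (integral_mono (kn_int nn) wW_int (kn_le nn)) (by positivity)) S.U0)
  have i1 := bintg (kn_int nn) bu d0 (ρ • n)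
  have i2 := bintg (kn_int nn) bv d0 (ρ • n)
  have i3 := (sintg (kn_int nn) d0 (ρ • n)).const_mul M
  have i4 := bintg wW_int bv d0 (ρ • n)
  have i5 := (sintg wW_int d0 (ρ • n)).const_mul M
  have i6 := bintg wW_int bv hρ 0
  have i7 := (sintg wW_int hρ 0).const_mul M
  refine gain_arith hρ δ0 hs S.U0 S.M0 hI J0 hA hB ?_ d1 d2
  have eA : (∫ x, (u x - v x) * kn (-n) ((δ * ρ)⁻¹ • (x - ρ • n))) =
      (∫ x, u x * kn (-n) ((δ * ρ)⁻¹ • (x - ρ • n))) - ∫ x, v x * kn (-n) ((δ * ρ)⁻¹ • (x - ρ • n)) := by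
    rw [← integral_sub i1 i2]; congr 1; ext x; ring
  rw [eA, sub_sub_cancel]
  have em : mn wW v ρ * (ρ ^ 3 * I) = ∫ x, v x * wW (ρ⁻¹ • (x - 0)) := by
    rw [mn, ← hIdef, div_mul_cancel₀ _ (by positivity)]; simp only [sub_zero]
  have e4 := (abs_le.1 (bint wW_int wW_is.nn S.vM d0 (ρ • n))).1
  rw [em]
  have i8 : Integrable (fun x => δ * (M * wW ((δ * ρ)⁻¹ • (x - ρ • n)) -
      v x * wW ((δ * ρ)⁻¹ • (x - ρ • n)))) := (i5.sub i4).const_mul δ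
  have i9 : Integrable (fun x => δ⁻¹ ^ 6 * (M * wW (ρ⁻¹ • (x - 0)) - v x * wW (ρ⁻¹ • (x - 0)))) :=
    (i7.sub i6).const_mul _
  have m1 : (∫ x, (M * kn (-n) ((δ * ρ)⁻¹ • (x - ρ • n)) - v x * kn (-n) ((δ * ρ)⁻¹ • (x - ρ • n)))) ≤
      ∫ x, (δ * (M * wW ((δ * ρ)⁻¹ • (x - ρ • n)) - v x * wW ((δ * ρ)⁻¹ • (x - ρ • n))) +
        δ⁻¹ ^ 6 * (M * wW (ρ⁻¹ • (x - 0)) - v x * wW (ρ⁻¹ • (x - 0)))) := by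
    refine integral_mono (i3.sub i2) (i8.add i9) fun x => ?_
    have h1 := g.pw δ0 x
    have h2 : 0 ≤ M - v x := sub_nonneg.2 ((abs_le.1 (S.vM x)).2)
    have := mul_le_mul_of_nonneg_left h1 h2
    simp only []
    linarith
  rw [integral_sub i3 i2, integral_add i8 i9,
    integral_const_mul, integral_const_mul, integral_const_mul, integral_sub i5 i4, integral_sub i7 i6,
    integral_const_mul, integral_const_mul, sint _ d0, sint _ d0, sint _ hρ] at m1
  have m2 : M * ((δ * ρ) ^ 3 * J) ≤ M * ((δ * ρ) ^ 3 * ∫ x, kn (-n) x) :=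
    mul_le_mul_of_nonneg_left (mul_le_mul_of_nonneg_left (hJ _ nn) (by positivity)) S.M0
  have m3 := mul_le_mul_of_nonneg_left e4 δ0.le
  rw [← hIdef] at m1 m3
  linarith

lemma sq_ab {x η C : ℝ} (hη : 0 < η) (hU : 0 ≤ U) (hM : 0 ≤ M) (hC : 0 ≤ C)
    (h : x ^ 2 ≤ η ^ 2 * M ^ 2 + C * (U * M)) : |x| ≤ η * M + C / (2 * η) * U := by
  refine abs_le_of_sq_le_sq (h.trans ?_) (by positivity)
  have e : (η * M + C / (2 * η) * U) ^ 2 = η ^ 2 * M ^ 2 + C * (U * M) + (C / (2 * η) * U) ^ 2 := by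
    field_simp; ring
  rw [e]; nlinarith [sq_nonneg (C / (2 * η) * U)]

lemma Sol.mn_cmp {C : ℝ} (S : Sol r c Ω T u v U M) {ρ Q : ℝ} (hQ : 1 ≤ Q) (hQρ : Q ≤ ρ) (hC : 0 ≤ C)
    (hb : ball 0 ρ ⊆ Ω)
    (hH : ∀ (y : E3) (a b : ℝ), 0 < a → a ≤ b → b ≤ 1 →
      (∀ x ∈ frontier Ω, 1 ≤ a * ‖x - y‖) →
      |(∫ x, (u x - v x) * (b ^ 3 * pp 3 (1 - b ^ 2 * ‖x - y‖ ^ 2))) -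
        ∫ x, (u x - v x) * (a ^ 3 * pp 3 (1 - a ^ 2 * ‖x - y‖ ^ 2))| ≤ C * (U + M) * (b - a)) :
    |mn wW v Q| ≤ |mn wW v ρ| + 2 * U + C / ((∫ x, wW x) * Q) * (U + M) := by
  have Q0 : 0 < Q := by linarith
  have ρ0 : 0 < ρ := by linarith
  have hI := wW_is.pos
  have U0 := S.U0
  have M0 := S.M0
  obtain ⟨bu, bv⟩ := S.bmv
  have h := hH 0 ρ⁻¹ Q⁻¹ (by positivity) (inv_anti₀ Q0 hQρ) (inv_le_one_of_one_le₀ hQ) (by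
    intro x hx
    rw [S.mesh.op.frontier_eq] at hx
    have : x ∉ ball 0 ρ := fun h => hx.2 (hb h)
    rw [mem_ball_zero_iff, not_lt] at this
    rwa [sub_zero, inv_mul_eq_div, one_le_div ρ0])
  have key : ∀ d : ℝ, 0 < d → ∫ x, (u x - v x) * (d⁻¹ ^ 3 * pp 3 (1 - d⁻¹ ^ 2 * ‖x - 0‖ ^ 2)) =
      (∫ x, wW x) * (mn wW u d - mn wW v d) := by
    intro d d0
    rw [mn, mn, ← sub_div, ← integral_sub (wW_is.intg d0 bu) (wW_is.intg d0 bv)]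
    have : (∫ x, wW x) * ((∫ x, (u x * wW (d⁻¹ • x) - v x * wW (d⁻¹ • x))) / (d ^ 3 * ∫ x, wW x)) =
        d⁻¹ ^ 3 * ∫ x, (u x * wW (d⁻¹ • x) - v x * wW (d⁻¹ • x)) := by
      generalize (∫ x, (u x * wW (d⁻¹ • x) - v x * wW (d⁻¹ • x))) = A
      generalize (∫ x, wW x) = I at *
      field_simp
    rw [this, ← integral_const_mul]
    congr 1; ext x
    rw [← wW_s, sub_zero]; ring
  rw [key Q Q0, key ρ ρ0] at h
  have a1 := abs_le.1 (mn_le wW_is bu S.uU Q0)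
  have a2 := abs_le.1 (mn_le wW_is bu S.uU ρ0)
  have a3 := abs_le.1 (le_refl |mn wW v ρ|)
  generalize mn wW u Q = p1 at *
  generalize mn wW u ρ = p2 at *
  generalize mn wW v Q = p3 at *
  generalize mn wW v ρ = p4 at *
  generalize (∫ x, wW x) = I at *
  have h2 : |I * ((p1 - p3) - (p2 - p4))| ≤ C * (U + M) * Q⁻¹ := by
    have : 0 ≤ ρ⁻¹ := by positivity
    have h3 : C * (U + M) * (Q⁻¹ - ρ⁻¹) ≤ C * (U + M) * Q⁻¹ := by gcongr; linarith
    rw [mul_sub]; exact h.trans h3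
  rw [abs_mul, abs_of_pos hI, ← le_div_iff₀' hI] at h2
  have e : C * (U + M) * Q⁻¹ / I = C / (I * Q) * (U + M) := by field_simp
  rw [e] at h2
  have h3 := abs_le.1 h2
  rw [abs_le]
  constructor <;> linarith

theorem Sol.core (r : ℕ) (hr : 2 ≤ r) {c : ℝ} (hc : 0 < c) {s0 : ℝ} (hs : 0 < s0) :
    ∃ γ C, 0 < γ ∧ 0 ≤ C ∧
    ∀ (Ω : Set E3) (T : Finset (Fin 4 → E3)) (u v : E3 → ℝ) (U M : ℝ), Sol r c Ω T u v U M →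
    ∀ n ρ, Geo Ω s0 ρ n → |v 0| ≤ (1 - γ) * M + C * U := by
  obtain ⟨γ, Cg, L, γ0, Cg0, L0, hg⟩ := Sol.gain r hr hc hs
  obtain ⟨C, C0, hC⟩ := Sol.HG r hr hc
  have hI := wW_is.pos
  set η := min γ 1 / 4 with hη
  have η0 : 0 < η := by have := lt_min γ0 one_pos; positivity
  have ηγ : 4 * η ≤ γ := by rw [hη]; linarith [min_le_left γ 1]
  have η1 : 4 * η ≤ 1 := by rw [hη]; linarith [min_le_right γ 1]
  clear_value η
  obtain ⟨L1, Ci, R1, Ci0, hi⟩ := Sol.interior r (by omega) hc wW_is (ε := η ^ 2) (by positivity)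
    (max 1 (C / ((∫ x, wW x) * η)))
  obtain ⟨Cs, Cs0, hst⟩ := Sol.strip r (by omega) hc (ε := η ^ 2) (by positivity) (max L (max L1 R1))
  refine ⟨2 * η, Ci / (2 * η) + Cg + 2 + η + Cs / (2 * η), by positivity, by positivity,
    fun Ω T u v U M S n ρ g => ?_⟩
  have U0 := S.U0
  have M0 := S.M0
  have k1 : 0 ≤ Ci / (2 * η) * U := by positivity
  have k2 : 0 ≤ Cg * U := by positivity
  have k3 : 0 ≤ Cs / (2 * η) * U := by positivity
  have k4 : 0 ≤ η * U := by positivity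
  have k5 : 4 * η * M ≤ γ * M := by gcongr
  have k6 : 4 * η * M ≤ 1 * M := by gcongr
  rcases le_total ρ (max L (max L1 R1)) with h | h
  · have h1 := sq_ab η0 U0 M0 Cs0 (hst Ω T u v U M S n ρ g.n1 g.ρ0.le h
      (fun x hx => S.vp.1 x (fun hΩ => absurd (g.sup x hΩ) (not_lt.2 hx))))
    linarith
  · obtain ⟨hL, h'⟩ := max_le_iff.1 h
    obtain ⟨hL1, hR1⟩ := max_le_iff.1 h'
    obtain ⟨Q, hQ, hQ1, hv⟩ := hi Ω T u v U M S ρ hL1 g.ball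
    obtain ⟨hQ2, hQ3⟩ := max_le_iff.1 hQ
    have h1 := sq_ab η0 U0 M0 Ci0 hv
    have h2 := S.mn_cmp hQ2 (hQ1.trans hR1) C0 g.ball
      (fun y a b h1 h2 h3 => (hC Ω T u v U M S y a b h1 h2 h3).1)
    have h3 : |mn wW v ρ| ≤ (1 - γ) * M + Cg * U := by
      refine abs_le'.2 ⟨hg Ω T u v U M S n ρ g hL, ?_⟩
      have := hg Ω T _ _ U M S.neg n ρ g hL
      have e : mn wW (fun x => -v x) ρ = -mn wW v ρ := by
        simp only [mn, neg_mul, integral_neg, neg_div]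
      rwa [e] at this
    have h4 : C / ((∫ x, wW x) * Q) ≤ η := by
      rw [div_le_iff₀ (by positivity)] at hQ3 ⊢
      linarith
    have h5 := mul_le_mul_of_nonneg_right h4 (add_nonneg U0 M0)
    have h6 : |v 0| ≤ |v 0 - mn wW v Q| + |mn wW v Q| := by
      have := abs_add_le (v 0 - mn wW v Q) (mn wW v Q)
      rwa [sub_add_cancel] at this
    linarith

/-- a ball in `K` touching a supporting plane with normal `n` -/
structure Tch (K : Set E3) (p : E3) (σ : ℝ) (n : E3) : Prop where
  n1 : ‖n‖ = 1
  σ0 : 0 < σ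
  cb : closedBall p σ ⊆ K
  sp : ∀ x ∈ K, ⟪n, x⟫ ≤ ⟪n, p⟫ + σ

lemma cb_mem (p : E3) {σ : ℝ} (hσ : 0 ≤ σ) {n : E3} (hn : ‖n‖ = 1) : p + σ • n ∈ closedBall p σ := by
  rw [mem_closedBall, dist_eq_norm, add_sub_cancel_left, norm_smul, hn, mul_one, Real.norm_of_nonneg hσ]

lemma inn_add {n m p : E3} {σ : ℝ} : ⟪m, p + σ • n⟫ = ⟪m, p⟫ + σ * ⟪m, n⟫ := by
  rw [inner_add_right, inner_smul_right]

lemma touch {K : Set E3} (hK : IsCompact K) (hcv : Convex ℝ K) {p : E3} (hp : p ∈ interior K) :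
    ∃ n, Tch K p (infDist p Kᶜ) n := by
  have hne : (Kᶜ : Set E3).Nonempty := by
    rw [nonempty_compl]
    rintro rfl
    exact noncompact_univ E3 hK
  have hσ : 0 < infDist p Kᶜ := by
    rw [← infDist_closure, ← isClosed_closure.notMem_iff_infDist_pos hne.closure, closure_compl]
    exact fun h => h hp
  obtain ⟨y, hy, hd⟩ := isClosed_closure.exists_infDist_eq_dist hne.closure p
  rw [infDist_closure] at hd
  set σ := infDist p Kᶜ with hσdef
  have hb : ball p σ ⊆ K := by
    intro x hx
    by_contra h
    have := infDist_le_dist_of_mem (x := p) (show x ∈ Kᶜ from h)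
    rw [mem_ball, dist_comm] at hx
    linarith
  have cb : closedBall p σ ⊆ K := by
    rw [← closure_ball p hσ.ne']; exact closure_minimal hb hK.isClosed
  rw [closure_compl] at hy
  obtain ⟨f, hf⟩ := geometric_hahn_banach_open_point hcv.interior isOpen_interior hy
  have hcl : closure (interior K) = K := by
    rw [hcv.closure_interior_eq_closure_of_nonempty_interior ⟨p, hp⟩, hK.isClosed.closure_eq]
  have hf2 : ∀ x ∈ K, f x ≤ f y := by
    have : closure (interior K) ⊆ {x | f x ≤ f y} :=
      closure_minimal (fun x hx => (hf x hx).le) (isClosed_le (by fun_prop) (by fun_prop))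
    rwa [hcl] at this
  set w := (InnerProductSpace.toDual ℝ E3).symm f with hw
  have hfw : ∀ x, f x = ⟪w, x⟫ := fun x => (InnerProductSpace.toDual_symm_apply).symm
  have w0 : w ≠ 0 := by
    intro h
    have := hf p hp
    rw [hfw, hfw, h, inner_zero_left, inner_zero_left] at this
    exact lt_irrefl _ this
  have wp : 0 < ‖w‖ := norm_pos_iff.2 w0
  have yn : ‖y - p‖ = σ := by rw [hd, dist_eq_norm, norm_sub_rev]
  set n := σ⁻¹ • (y - p) with hn
  have n1 : ‖n‖ = 1 := by
    rw [hn, norm_smul, yn, norm_inv, Real.norm_of_nonneg hσ.le, inv_mul_cancel₀ hσ.ne']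
  have yp : y = p + σ • n := by rw [hn, smul_smul, mul_inv_cancel₀ hσ.ne', one_smul]; abel
  clear_value n
  have w1 : ‖(‖w‖⁻¹ • w)‖ = 1 := by
    rw [norm_smul, norm_inv, norm_norm, inv_mul_cancel₀ wp.ne']
  have h1 := hf2 _ (cb (cb_mem p hσ.le w1))
  rw [hfw, hfw, inn_add, yp, inn_add, inner_smul_right, real_inner_self_eq_norm_sq] at h1
  have h2 : ‖w‖ ≤ ⟪w, n⟫ := by
    have e : ‖w‖⁻¹ * ‖w‖ ^ 2 = ‖w‖ := by field_simp
    rw [e] at h1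
    exact le_of_mul_le_mul_left (by linarith) hσ
  have h3 : w = ‖w‖ • n := by
    have h4 := real_inner_le_norm w n
    rw [n1, mul_one] at h4
    have := (inner_eq_norm_mul_iff_real (x := w) (y := n)).1 (by rw [n1]; linarith)
    rwa [n1, one_smul] at this
  refine ⟨n, n1, hσ, cb, fun x hx => ?_⟩
  have h5 := hf2 x hx
  rw [hfw, hfw, h3, real_inner_smul_left, real_inner_smul_left] at h5
  have h6 := le_of_mul_le_mul_left h5 wp
  rwa [yp, inn_add, real_inner_self_eq_norm_sq, n1, one_pow, mul_one] at h6

lemma Tch.fin (S : Finset E3) :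
    {n | ∃ p σ, Tch (convexHull ℝ (S : Set E3)) p σ n}.Finite := by
  classical
  choose! p σ h using fun (n : E3) (hn : ∃ p σ, Tch (convexHull ℝ (S : Set E3)) p σ n) => hn
  refine Set.Finite.of_finite_image (f := fun n => S.filter fun s => ⟪n, s⟫ = ⟪n, p n⟫ + σ n)
    (S.powerset.finite_toSet.subset ?_) ?_
  · rintro _ ⟨n, _, rfl⟩
    exact Finset.mem_coe.2 (Finset.mem_powerset.2 (Finset.filter_subset _ _))
  · intro n hn m hm hnm
    have g := h n hn
    have g' := h m hm
    have hy : p n + σ n • n ∈ convexHull ℝ (S : Set E3) := g.cb (cb_mem _ g.σ0.le g.n1)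
    rw [Finset.mem_convexHull'] at hy
    obtain ⟨w, w0, w1, wy⟩ := hy
    have hS : ∀ s ∈ S, s ∈ convexHull ℝ (S : Set E3) := fun s hs => subset_convexHull ℝ _ hs
    have ex : ∀ q : E3, ∑ s ∈ S, w s * ⟪q, s⟫ = ⟪q, p n⟫ + σ n * ⟪q, n⟫ := fun q => by
      rw [← inn_add, ← wy, inner_sum]
      exact Finset.sum_congr rfl fun s _ => (inner_smul_right _ _ _).symm
    have z : ∀ s ∈ S, w s * (⟪n, p n⟫ + σ n - ⟪n, s⟫) = 0 := by
      refine (Finset.sum_eq_zero_iff_of_nonneg fun s hs =>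
        mul_nonneg (w0 s hs) (sub_nonneg.2 (g.sp s (hS s hs)))).1 ?_
      simp only [mul_sub, Finset.sum_sub_distrib]
      rw [ex n, ← Finset.sum_mul, w1, real_inner_self_eq_norm_sq, g.n1]; ring
    have z' : ∀ s ∈ S, w s * ⟪m, s⟫ = w s * (⟪m, p m⟫ + σ m) := by
      intro s hs
      rcases mul_eq_zero.1 (z s hs) with h0 | h0
      · rw [h0, zero_mul, zero_mul]
      · have : s ∈ S.filter fun s => ⟪n, s⟫ = ⟪n, p n⟫ + σ n :=
          Finset.mem_filter.2 ⟨hs, by linarith⟩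
        rw [show (S.filter fun s => ⟪n, s⟫ = ⟪n, p n⟫ + σ n) = _ from hnm] at this
        rw [(Finset.mem_filter.1 this).2]
    have e1 := ex m
    rw [Finset.sum_congr rfl z', ← Finset.sum_mul, w1, one_mul] at e1
    have e2 := g'.sp _ (g.cb (cb_mem _ g.σ0.le g'.n1))
    rw [inn_add, real_inner_self_eq_norm_sq, g'.n1, e1] at e2
    have e3 : 1 ≤ ⟪m, n⟫ := le_of_mul_le_mul_left (by linarith) g.σ0
    have e4 : ‖n - m‖ ^ 2 ≤ 0 := by
      rw [norm_sub_sq_real, g.n1, g'.n1, real_inner_comm]; linarith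
    have : ‖n - m‖ = 0 := by nlinarith [norm_nonneg (n - m)]
    exact sub_eq_zero.1 (norm_eq_zero.1 this)

lemma gap {N : Set E3} (hN : N.Finite) (h1 : ∀ n ∈ N, ‖n‖ = 1) :
    ∃ s0, 0 < s0 ∧ ∀ n ∈ N, ∀ m ∈ N, n ≠ m → s0 ≤ 1 - ⟪m, n⟫ := by
  have hF : ((fun q : E3 × E3 => 1 - ⟪q.2, q.1⟫) '' {q | (q ∈ N ×ˢ N) ∧ q.1 ≠ q.2}).Finite :=
    ((hN.prod hN).subset fun q hq => hq.1).image _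
  rcases Set.eq_empty_or_nonempty ((fun q : E3 × E3 => 1 - ⟪q.2, q.1⟫) '' {q | (q ∈ N ×ˢ N) ∧ q.1 ≠ q.2}) with he | hne
  · refine ⟨1, one_pos, fun n hn m hm hnm => ?_⟩
    exact absurd (Set.mem_image_of_mem (fun q : E3 × E3 => 1 - ⟪q.2, q.1⟫)
      (show (n, m) ∈ {q : E3 × E3 | (q ∈ N ×ˢ N) ∧ q.1 ≠ q.2} from ⟨⟨hn, hm⟩, hnm⟩)) (by rw [he]; simp)
  · obtain ⟨a, ⟨q, hq, rfl⟩, ha⟩ := Set.exists_min_image _ id hF hne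
    refine ⟨_, ?_, fun n hn m hm hnm => ha _ ⟨(n, m), ⟨⟨hn, hm⟩, hnm⟩, rfl⟩⟩
    have := (inner_lt_one_iff_real_of_norm_eq_one (h1 _ hq.1.2) (h1 _ hq.1.1)).2 (Ne.symm hq.2)
    simpa using this

theorem geom (hΩ : IsConvexPolyhedron Ω) : ∃ s0, 0 < s0 ∧ ∀ x0 ∈ Ω, ∃ ρ n, ‖n‖ = 1 ∧ 0 < ρ ∧
    ball x0 ρ ⊆ Ω ∧ (∀ x ∈ Ω, ⟪n, x - x0⟫ < ρ) ∧
    ∀ x, ‖x - x0 - ρ • n‖ < s0 * ρ → ⟪n, x - x0⟫ < ρ → x ∈ Ω := by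
  obtain ⟨op, -, -, S, rfl⟩ := hΩ
  set K := convexHull ℝ (S : Set E3) with hKdef
  have hK : IsCompact K := S.finite_toSet.isCompact_convexHull ℝ
  have hcv : Convex ℝ K := convex_convexHull ℝ _
  obtain ⟨s0, s00, hs⟩ := gap (Tch.fin S) (fun n ⟨p, σ, h⟩ => h.n1)
  refine ⟨s0, s00, fun x0 hx0 => ?_⟩
  obtain ⟨n, g⟩ := touch hK hcv hx0
  set ρ := infDist x0 Kᶜ with hρ
  refine ⟨ρ, n, g.n1, g.σ0, interior_maximal (ball_subset_closedBall.trans g.cb) isOpen_ball, ?_, ?_⟩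
  · intro x hx
    obtain ⟨ε, ε0, hε⟩ := Metric.isOpen_iff.1 isOpen_interior x hx
    have h1 := g.sp (x + (ε / 2) • n) (interior_subset (hε (by
      have := cb_mem x (half_pos ε0).le g.n1
      rw [mem_closedBall] at this; rw [mem_ball]; linarith)))
    rw [inn_add, real_inner_self_eq_norm_sq, g.n1] at h1
    rw [inner_sub_right]; linarith
  · have key : {x : E3 | ‖x - x0 - ρ • n‖ < s0 * ρ} ∩ {x | ⟪n, x - x0⟫ < ρ} ⊆ K := by
      rintro x ⟨hx1, hx2⟩
      by_contra hxK
      have hx1' : ‖x - x0 - ρ • n‖ < s0 * ρ := hx1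
      have hx2' : ⟪n, x - x0⟫ < ρ := hx2
      obtain ⟨ε, ε0, hε⟩ := Metric.isOpen_iff.1 hK.isClosed.isOpen_compl x hxK
      have ρ0 := g.σ0
      set q : ℝ → E3 := fun t => x0 + t • (x - x0) with hq
      have hqc : Continuous q := by rw [hq]; fun_prop
      -- a parameter close to one with `q t` outside of `K`
      obtain ⟨t1, t10, t11, ht1⟩ : ∃ t1 : ℝ, 0 ≤ t1 ∧ t1 < 1 ∧ q t1 ∈ Kᶜ := by
        have h1 : Filter.Tendsto q (nhdsWithin 1 (Iio 1)) (nhds x) := by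
          have : Filter.Tendsto q (nhds 1) (nhds (q 1)) := hqc.tendsto 1
          have e : q 1 = x := by simp [hq]
          rw [e] at this
          exact this.mono_left nhdsWithin_le_nhds
        have h2 : q ⁻¹' ball x ε ∈ nhdsWithin (1:ℝ) (Iio 1) := h1 (ball_mem_nhds x ε0)
        have h3 : Ioo (0:ℝ) 1 ∈ nhdsWithin (1:ℝ) (Iio 1) := Ioo_mem_nhdsLT one_pos
        obtain ⟨t, ht, ht'⟩ := Filter.nonempty_of_mem (Filter.inter_mem h2 h3)
        exact ⟨t, ht'.1.le, ht'.2, hε ht⟩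
      have hcont : ContinuousOn (fun t => infDist (q t) Kᶜ - (1 - t) * (ρ / 2)) (Icc 0 t1) :=
        (((continuous_infDist_pt _).comp hqc).sub (by fun_prop)).continuousOn
      have h0 : (0:ℝ) ∈ Icc (infDist (q t1) Kᶜ - (1 - t1) * (ρ / 2)) (infDist (q 0) Kᶜ - (1 - 0) * (ρ / 2)) := by
        rw [infDist_zero_of_mem ht1]
        have : q 0 = x0 := by simp [hq]
        rw [this, ← hρ]
        constructor
        · have : 0 ≤ (1 - t1) * (ρ / 2) := by
            have : 0 ≤ 1 - t1 := by linarith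
            positivity
          linarith
        · linarith
      obtain ⟨t, ht, hft⟩ := intermediate_value_Icc' t10 hcont h0
      have hσ : infDist (q t) Kᶜ = (1 - t) * (ρ / 2) := by simpa [sub_eq_zero] using hft
      have tlt : t < 1 := ht.2.trans_lt t11
      have σ0 : 0 < (1 - t) * (ρ / 2) := by
        have : 0 < 1 - t := by linarith
        positivity
      have t0 : 0 < t := by
        rcases ht.1.eq_or_lt with h | h
        · rw [← h] at hσ
          have : q 0 = x0 := by simp [hq]
          rw [this, ← hρ] at hσ
          linarith
        · exact h
      have hint : q t ∈ interior K := by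
        by_contra h
        rw [← mem_compl_iff, ← closure_compl] at h
        have := infDist_zero_of_mem_closure h
        linarith
      obtain ⟨m, g'⟩ := touch hK hcv hint
      rw [hσ] at g'
      have a1 := g'.sp _ (g.cb (cb_mem x0 ρ0.le g'.n1))
      have a2 := g'.sp _ (g'.cb (cb_mem _ σ0.le g'.n1))
      rw [inn_add, real_inner_self_eq_norm_sq, g'.n1] at a1
      have hqt : ⟪m, q t⟫ = ⟪m, x0⟫ + t * ⟪m, x - x0⟫ := by rw [hq]; exact inn_add
      rw [hqt] at a1
      -- `m` separates `x`
      have b1 : ρ * (1 - (1 - t) / 2) ≤ t * ⟪m, x - x0⟫ := by linarith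
      by_cases hnm : n = m
      · rw [← hnm] at b1
        have : t * ⟪n, x - x0⟫ ≤ t * ρ := by gcongr
        nlinarith
      · have c1 := hs n ⟨_, _, g⟩ m ⟨_, _, g'⟩ hnm
        have c2 : ⟪m, x - x0⟫ ≤ ρ * ⟪m, n⟫ + ‖x - x0 - ρ • n‖ := by
          have := real_inner_le_norm m (x - x0 - ρ • n)
          rw [inner_sub_right m (x - x0), inner_smul_right, g'.n1] at this
          linarith
        have c3 : ⟪m, x - x0⟫ < ρ := by nlinarith
        have : t * ⟪m, x - x0⟫ ≤ t * ρ := by gcongr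
        nlinarith
    intro x h1 h2
    refine interior_maximal key (IsOpen.inter ?_ ?_) ⟨h1, h2⟩
    · exact isOpen_lt (by fun_prop) (by fun_prop)
    · exact isOpen_lt (by fun_prop) (by fun_prop)

lemma Pol3.comp {f : E3 → ℝ} (hf : Pol3 r f) (x0 : E3) (h : ℝ) : Pol3 r (fun x => f (x0 + h • x)) := by
  change f ∈ Submodule.span ℝ {g : E3 → ℝ | ∃ A : Fin r → AF, g = fun x => ∏ j, ev (A j) x} at hf
  induction hf using Submodule.span_induction with
  | mem g hg =>
    obtain ⟨A, rfl⟩ := hg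
    refine Submodule.subset_span ⟨fun j => (h • (A j).1, (A j).1 x0 + (A j).2), ?_⟩
    ext x
    refine Finset.prod_congr rfl fun j _ => ?_
    simp [ev]; ring
  | zero => exact Submodule.zero_mem _
  | add f g _ _ h1 h2 => exact Submodule.add_mem _ h1 h2
  | smul a f _ h1 => exact Submodule.smul_mem _ a h1

def hom (x0 : E3) {h : ℝ} (hh : 0 < h) : E3 ≃ₜ E3 where
  toFun x := x0 + h • x
  invFun x := h⁻¹ • (x - x0)
  left_inv x := by simp [smul_smul, hh.ne']
  right_inv x := by simp [smul_smul, hh.ne']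
  continuous_toFun := by fun_prop
  continuous_invFun := by fun_prop

def psA (x0 : E3) (h : ℝ) : E3 →ᵃ[ℝ] E3 := h⁻¹ • (AffineMap.id ℝ E3 - AffineMap.const ℝ E3 x0)

lemma psA_eq (x0 : E3) {h : ℝ} (hh : 0 < h) : ⇑(psA x0 h) = (hom x0 hh).symm := by
  ext x; simp [psA, hom]

open Classical in
def Tsc (x0 : E3) (h : ℝ) (T : Finset (Fin 4 → E3)) : Finset (Fin 4 → E3) :=
  T.image fun v i => h⁻¹ • (v i - x0)

lemma hull_sc (x0 : E3) {h : ℝ} (hh : 0 < h) (s : Set E3) :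
    convexHull ℝ ((hom x0 hh).symm '' s) = hom x0 hh ⁻¹' convexHull ℝ s := by
  rw [← psA_eq, ← AffineMap.image_convexHull, psA_eq, Homeomorph.image_symm]

lemma range_sc (x0 : E3) {h : ℝ} (hh : 0 < h) (v : Fin 4 → E3) :
    Set.range (fun i => h⁻¹ • (v i - x0)) = (hom x0 hh).symm '' Set.range v := by
  rw [← Set.range_comp]; rfl

lemma tet_sc (x0 : E3) {h : ℝ} (hh : 0 < h) (v : Fin 4 → E3) :
    tet (fun i => h⁻¹ • (v i - x0)) = hom x0 hh ⁻¹' tet v := by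
  rw [tet, range_sc x0 hh, hull_sc, tet]

lemma hom_dist (x0 : E3) {h : ℝ} (hh : 0 < h) (x y : E3) :
    dist (hom x0 hh x) (hom x0 hh y) = h * dist x y := by
  show dist (x0 + h • x) (x0 + h • y) = _
  rw [dist_add_left, dist_smul₀, Real.norm_of_nonneg hh.le]

lemma mesh_sc {Ω : Set E3} (hΩ : IsConvexPolyhedron Ω) {T : Finset (Fin 4 → E3)} {h : ℝ} (hh : 0 < h) {c : ℝ}
    (hT : IsTetPartition Ω T h c) (x0 : E3) : Mesh c (hom x0 hh ⁻¹' Ω) (Tsc x0 h T) := by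
  obtain ⟨op, bd, cv, -⟩ := hΩ
  obtain ⟨p1, p2, p3, p4, p5, p6⟩ := hT
  have im : ∀ P : (Fin 4 → E3) → Prop, (∀ v ∈ T, P fun i => h⁻¹ • (v i - x0)) → ∀ v ∈ Tsc x0 h T, P v := by
    intro P hP v hv
    obtain ⟨w, hw, rfl⟩ := Finset.mem_image.1 hv
    exact hP w hw
  refine ⟨op.preimage (hom x0 hh).continuous, ?_, ?_, im _ ?_, ?_, im _ ?_, im _ ?_, im _ ?_, im _ ?_⟩
  · obtain ⟨R, hR⟩ := bd.subset_closedBall (hom x0 hh 0)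
    refine (isBounded_closedBall (x := (0:E3)) (r := R / h)).subset fun x hx => ?_
    have := hR hx
    rw [mem_closedBall, hom_dist] at this
    rw [mem_closedBall, le_div_iff₀ hh]; linarith
  · rw [← Homeomorph.image_symm, ← psA_eq]
    exact cv.affine_image _
  · intro v hv
    have := (p1 v hv).map' (psA x0 h) (by rw [psA_eq x0 hh]; exact (hom x0 hh).symm.injective)
    rwa [psA_eq x0 hh] at this
  · rw [← Homeomorph.preimage_closure, ← p2]
    simp only [preimage_iUnion]
    ext x
    simp only [mem_iUnion, exists_prop]
    constructor
    · rintro ⟨v, hv, hx⟩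
      obtain ⟨w, hw, rfl⟩ := Finset.mem_image.1 hv
      exact ⟨w, hw, by rwa [tet_sc x0 hh] at hx⟩
    · rintro ⟨v, hv, hx⟩
      exact ⟨_, Finset.mem_image_of_mem _ hv, by rwa [tet_sc x0 hh]⟩
  · intro v hv
    refine im _ fun w hw hne => ?_
    rw [tet_sc x0 hh, tet_sc x0 hh] at hne ⊢
    rw [← Homeomorph.preimage_interior, ← Homeomorph.preimage_interior, ← preimage_inter,
      p3 v hv w hw (fun e => hne (by rw [e])), preimage_empty]
  · intro v hv
    refine im _ fun w hw hne => ?_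
    rw [tet_sc x0 hh, tet_sc x0 hh] at hne ⊢
    rw [← preimage_inter, range_sc x0 hh, range_sc x0 hh, ← image_inter (hom x0 hh).symm.injective, hull_sc]
    rcases p4 v hv w hw (fun e => hne (by rw [e])) with e | e
    · left; rw [e, preimage_empty]
    · right; rw [e]
  · intro v hv
    rw [tet_sc x0 hh]
    refine Metric.diam_le_of_forall_dist_le zero_le_one fun x hx y hy => ?_
    have := (Metric.dist_le_diam_of_mem (tet_compact v).isBounded hx hy).trans (p5 v hv)
    rw [hom_dist] at this
    exact le_of_mul_le_mul_left (by linarith) hh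
  · intro v hv
    obtain ⟨x, hx⟩ := p6 v hv
    rw [tet_sc x0 hh]
    refine ⟨(hom x0 hh).symm x, fun y hy => hx ?_⟩
    rw [mem_closedBall] at hy ⊢
    rw [← (hom x0 hh).apply_symm_apply x, hom_dist]
    nlinarith

lemma pd_sc (i : Fin 3) (f : E3 → ℝ) (x0 : E3) (h : ℝ) (x : E3) :
    pd i (fun y => f (x0 + h • y)) x = h * pd i f (x0 + h • x) := by
  have := fderiv_comp_smul (𝕜 := ℝ) (f := fun z => f (x0 + z)) (x := x) h
  rw [fderiv_comp_add_left] at this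
  simp only [pd, this]
  rfl

lemma inner_grad (f g : E3 → ℝ) (x : E3) :
    ⟪gradient f x, gradient g x⟫ = ∑ i, pd i f x * pd i g x := by
  have key : ∀ (f : E3 → ℝ) i, (gradient f x) i = pd i f x := by
    intro f i
    have := inner_gradient_left (𝕜 := ℝ) (f := f) (x := x) (y := bs i)
    rw [pd, ← this, bs, EuclideanSpace.inner_single_right]; simp
  rw [PiLp.inner_apply]
  refine Finset.sum_congr rfl fun i _ => ?_
  rw [key, key]; simp [mul_comm]

lemma ind_zero (op : IsOpen Ω) {f : E3 → ℝ} (hf : ∀ x ∈ frontier Ω, f x = 0) {x : E3} (hx : x ∈ closure Ω) :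
    Ω.indicator f x = f x := by
  by_cases h : x ∈ Ω
  · rw [indicator_of_mem h]
  · rw [indicator_of_notMem h, hf x (by rw [op.frontier_eq]; exact ⟨hx, h⟩)]

lemma biSup_indic (f : E3 → ℝ) : (⨆ x ∈ Ω, |f x|) = ⨆ x, |Ω.indicator f x| := by
  congr 1; ext x
  by_cases h : x ∈ Ω
  · simp [h]
  · simp [h]

lemma bdd_ind (bd : Bornology.IsBounded Ω) {f : E3 → ℝ} (hf : ContinuousOn f (closure Ω)) :
    BddAbove (Set.range fun x => |Ω.indicator f x|) := by
  obtain ⟨K, hK⟩ := (Metric.isCompact_of_isClosed_isBounded isClosed_closure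
    bd.closure).exists_bound_of_continuousOn hf
  refine ⟨max K 0, ?_⟩
  rintro _ ⟨x, rfl⟩
  by_cases h : x ∈ Ω
  · simp only [indicator_of_mem h]; exact (hK x (subset_closure h)).trans (le_max_left _ _)
  · simp [h]

lemma sol_sc (hΩ : IsConvexPolyhedron Ω) {h : ℝ} (hh : 0 < h) (hT : IsTetPartition Ω T h c)
    {x0 : E3} (hx0 : x0 ∈ Ω)
    (hu : ∃ K : ℝ≥0, LipschitzOnWith K u (closure Ω)) (hu0 : ∀ x ∈ frontier Ω, u x = 0)
    (hv : MemSh0 Ω T r v)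
    (orth : ∀ χ : E3 → ℝ, MemSh0 Ω T r χ →
          ∫ x in Ω, ⟪gradient (fun y => u y - v y) x, gradient χ x⟫ = 0) :
    Sol r c (hom x0 hh ⁻¹' Ω) (Tsc x0 h T) (fun x => Ω.indicator u (x0 + h • x))
      (fun x => Ω.indicator v (x0 + h • x)) (⨆ x, |Ω.indicator u x|) (⨆ x, |Ω.indicator v x|) := by
  have hm := mesh_sc hΩ hh hT x0
  obtain ⟨op, bd, cv, -⟩ := hΩ
  have tsub : ∀ w ∈ T, tet w ⊆ closure Ω := fun w hw => by
    rw [← hT.2.1]; exact subset_biUnion_of_mem (u := fun v => tet v) hw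
  refine ⟨hm, ?_, ?_, fun x hx => indicator_of_notMem (s := Ω) (a := x0 + h • x) hx _, fun x => le_ciSup (bdd_ind bd ?_) (x0 + h • x),
    ⟨fun x hx => indicator_of_notMem (s := Ω) (a := x0 + h • x) hx _, ?_⟩, fun x => le_ciSup (bdd_ind bd hv.1.1) (x0 + h • x), ?_⟩
  · show x0 + h • (0:E3) ∈ Ω
    simpa using hx0
  · obtain ⟨K, hK⟩ := hu
    have l : LipschitzWith K (Ω.indicator u) := by
      refine glue_lip (fun b : Bool => if b then closure Ω else Ωᶜ) ?_ ?_ ?_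
      · rintro (_ | _)
        · simpa using op
        · simp
      · intro x
        by_cases hx : x ∈ Ω
        · exact ⟨true, by simpa using subset_closure hx⟩
        · exact ⟨false, by simpa using hx⟩
      · rintro (_ | _)
        · refine LipschitzOnWith.of_dist_le_mul fun x hx y hy => ?_
          rw [indicator_of_notMem (by simpa using hx), indicator_of_notMem (by simpa using hy), dist_self]
          positivity
        · refine LipschitzOnWith.of_dist_le_mul fun x hx y hy => ?_
          simp only [if_true] at hx hy
          rw [ind_zero op hu0 hx, ind_zero op hu0 hy]
          exact hK.dist_le_mul x hx y hy
    refine ⟨K * Real.toNNReal h, LipschitzWith.of_dist_le_mul fun x y => ?_⟩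
    refine (l.dist_le_mul _ _).trans (le_of_eq ?_)
    rw [dist_add_left, dist_smul₀, Real.norm_of_nonneg hh.le, NNReal.coe_mul, Real.coe_toNNReal _ hh.le]; ring
  · exact hu.choose_spec.continuousOn
  · intro w' hw'
    obtain ⟨w, hw, rfl⟩ := Finset.mem_image.1 hw'
    obtain ⟨p, hp, he⟩ := hv.1.2 w hw
    refine ⟨_, (pol3_of_mv p hp).comp x0 h, fun x hx => ?_⟩
    rw [tet_sc x0 hh] at hx
    have hx' : x0 + h • x ∈ tet w := hx
    exact (ind_zero op hv.2 (tsub w hw hx')).trans (he _ hx')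
  · intro χ hχ
    obtain ⟨K, hK⟩ := hm.lip hχ
    set g : E3 → ℝ := fun x => χ (h⁻¹ • (x - x0)) with hg
    have gχ : ∀ x, χ x = g (x0 + h • x) := fun x => by simp [hg, smul_smul, hh.ne']
    have gm : MemSh0 Ω T r g := by
      refine ⟨⟨(hK.continuous.comp (by fun_prop)).continuousOn, fun w hw => ?_⟩, fun x hx => ?_⟩
      · obtain ⟨p, hp, he⟩ := hχ.2 _ (Finset.mem_image_of_mem _ hw)
        obtain ⟨q, hq, hq'⟩ := mv_of_pol3 (hp.comp (-(h⁻¹ • x0)) h⁻¹)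
        refine ⟨q, hq, fun x hx => ?_⟩
        rw [← hq' x]
        have e : -(h⁻¹ • x0) + h⁻¹ • x = h⁻¹ • (x - x0) := by rw [smul_sub]; abel
        rw [e]
        refine he _ ?_
        rw [tet_sc x0 hh]
        show x0 + h • (h⁻¹ • (x - x0)) ∈ tet w
        simpa [smul_smul, hh.ne'] using hx
      · refine hχ.1 _ fun hx' => ?_
        have : x0 + h • (h⁻¹ • (x - x0)) ∈ Ω := hx'
        rw [op.frontier_eq] at hx
        exact hx.2 (by simpa [smul_smul, hh.ne'] using this)
    have h0 := orth g gm
    have e1 : ∀ x ∈ Ω, ⟪gradient (fun y => u y - v y) x, gradient g x⟫ =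
        ∑ i, pd i (fun y => Ω.indicator u y - Ω.indicator v y) x * pd i g x := by
      intro x hx
      rw [← inner_grad]
      congr 1
      refine Filter.EventuallyEq.gradient_eq ?_
      filter_upwards [op.mem_nhds hx] with y hy
      simp [hy]
    rw [setIntegral_congr_fun op.measurableSet e1] at h0
    set G : E3 → ℝ := fun x => ∑ i, pd i (fun y => Ω.indicator u y - Ω.indicator v y) x * pd i g x with hG
    have e2 : ∀ x, ∑ i, pd i (fun y => Ω.indicator u (x0 + h • y) - Ω.indicator v (x0 + h • y)) x * pd i χ x
        = h * h * G (x0 + h • x) := by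
      intro x
      have : χ = fun x => g (x0 + h • x) := funext gχ
      rw [hG, Finset.mul_sum]
      refine Finset.sum_congr rfl fun i _ => ?_
      rw [this, pd_sc i (fun y => Ω.indicator u y - Ω.indicator v y), pd_sc]; ring
    simp only [e2]
    rw [integral_const_mul, ← integral_indicator hm.op.measurableSet]
    have e3 : (hom x0 hh ⁻¹' Ω).indicator (fun x => G (x0 + h • x)) = fun x => Ω.indicator G (x0 + h • x) := by
      ext x
      simp only [indicator]
      rfl
    rw [e3, Measure.integral_comp_smul volume (fun z => Ω.indicator G (x0 + z)) h,
      integral_add_left_eq_self, integral_indicator op.measurableSet, h0]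
    simp

lemma final_bound (hΩ : IsConvexPolyhedron Ω) (hc : 0 < c) (hr : 2 ≤ r) :
    ∃ C : ℝ, ∀ h : ℝ, 0 < h → ∀ T : Finset (Fin 4 → E3), IsTetPartition Ω T h c →
      ∀ u : E3 → ℝ, (∃ K : ℝ≥0, LipschitzOnWith K u (closure Ω)) →
        (∀ x ∈ frontier Ω, u x = 0) →
      ∀ u_h : E3 → ℝ, MemSh0 Ω T r u_h →
        (∀ χ : E3 → ℝ, MemSh0 Ω T r χ →
          ∫ x in Ω, ⟪gradient (fun y => u y - u_h y) x, gradient χ x⟫ = 0) →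
        (⨆ x ∈ Ω, |u_h x|) ≤ C * ⨆ x ∈ Ω, |u x| := by
  obtain ⟨s0, hs, hg⟩ := geom hΩ
  obtain ⟨γ, C, hγ, hC, core⟩ := Sol.core r hr hc hs
  refine ⟨C / γ, fun h hh T hT u hu hu0 v hv orth => ?_⟩
  rw [biSup_indic, biSup_indic]
  rcases Ω.eq_empty_or_nonempty with he | ⟨x1, hx1⟩
  · simp [he]
  have key : ∀ x0 ∈ Ω, |Ω.indicator v x0| ≤
      (1 - γ) * (⨆ x, |Ω.indicator v x|) + C * ⨆ x, |Ω.indicator u x| := by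
    intro x0 hx0
    obtain ⟨ρ, n, n1, ρ0, hb, hsup, hhalf⟩ := hg x0 hx0
    have S := sol_sc hΩ hh hT hx0 hu hu0 hv orth
    have e : h * (ρ / h) = ρ := by field_simp
    have := core _ _ _ _ _ _ S n (ρ / h) ⟨n1, by positivity, fun x hx => hb ?_, fun x hx => ?_, fun x hx hx' => ?_⟩
    · simpa using this
    · show x0 + h • x ∈ _
      rw [mem_ball_zero_iff] at hx
      rw [mem_ball, dist_eq_norm, add_sub_cancel_left, norm_smul, Real.norm_of_nonneg hh.le, ← e]
      exact mul_lt_mul_of_pos_left hx hh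
    · have hx' : x0 + h • x ∈ Ω := hx
      have := hsup _ hx'
      rw [add_sub_cancel_left, inner_smul_right] at this
      rw [lt_div_iff₀ hh]; linarith
    · show x0 + h • x ∈ Ω
      refine hhalf _ ?_ ?_
      · have : x0 + h • x - x0 - ρ • n = h • (x - (ρ / h) • n) := by
          rw [smul_sub, smul_smul, e]; abel
        rw [this, norm_smul, Real.norm_of_nonneg hh.le]
        calc _ < h * (s0 * (ρ / h)) := mul_lt_mul_of_pos_left hx hh
          _ = s0 * (h * (ρ / h)) := by ring
          _ = _ := by rw [e]
      · rw [add_sub_cancel_left, inner_smul_right]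
        rw [lt_div_iff₀ hh] at hx'; linarith
  have fin : (⨆ x, |Ω.indicator v x|) ≤ (1 - γ) * (⨆ x, |Ω.indicator v x|) + C * ⨆ x, |Ω.indicator u x| := by
    refine ciSup_le fun x => ?_
    by_cases hx : x ∈ Ω
    · exact key x hx
    · rw [indicator_of_notMem hx, abs_zero]
      exact (abs_nonneg _).trans (key x1 hx1)
  rw [div_mul_eq_mul_div, le_div_iff₀ hγ]
  linarith

end

/-- **`L^∞`-stability of the Ritz projection without logarithmic factor (Theorem 5.1).** -/
theorem ritz_Linfty_stability
    (Ω Ωt : Set E3) (hΩ : IsConvexPolyhedron Ω) (hΩt : IsConvexPolyhedron Ωt)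
    (hsub : closure Ω ⊆ Ωt) (c : ℝ) (hc : 0 < c) (r : ℕ) (hr : 2 ≤ r) :
    ∃ C : ℝ, ∀ h : ℝ, 0 < h →
      ∀ Tt : Finset (Fin 4 → E3), IsTetPartition Ωt Tt h c →
      ∀ T : Finset (Fin 4 → E3), T ⊆ Tt →
        (∀ v ∈ Tt, (v ∈ T ↔ tet v ⊆ closure Ω)) → IsTetPartition Ω T h c →
      ∀ u : E3 → ℝ, (∃ K : ℝ≥0, LipschitzOnWith K u (closure Ω)) →
        (∀ x ∈ frontier Ω, u x = 0) →
      ∀ u_h : E3 → ℝ, MemSh0 Ω T r u_h →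
        (∀ χ : E3 → ℝ, MemSh0 Ω T r χ →
          ∫ x in Ω, ⟪gradient (fun y => u y - u_h y) x, gradient χ x⟫ = 0) →
        (⨆ x ∈ Ω, |u_h x|) ≤ C * ⨆ x ∈ Ω, |u x| := by
  obtain ⟨C, hC⟩ := final_bound hΩ hc hr
  exact ⟨C, fun h hh _ _ T _ _ hT u hu hu0 v hv ho => hC h hh T hT u hu hu0 v hv ho⟩
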